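/- In the good-path setting, assume in addition that ∫ x^{4+θ} dν < ∞ for some θ > 0. Then for every ε > 0 there exists L* > 1 such that for every ζ ∈ B_{L*} and every t ∈ [L* − 1, L*], d[ζ(t), Δ_ν(⟨χ, ζ(t)⟩)] ≤ ε. -/

import Mathlib

open MeasureTheory Filter Set
noncomputable section
namespace PSQ

/-- ⟨g, ζ⟩ = ∫ g dζ -/
def pair (g : ℝ → ℝ) (ζ : Measure ℝ) : ℝ := ∫ x, g x ∂ζ

/-- total mass ⟨1, ζ⟩ of a finite measure, as a real number -/
def mass (ζ : Measure ℝ) : ℝ := (ζ Set.univ).toReal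

/-- truncated Dirac measure δ⁺ₓ -/
def dplus (x : ℝ) : Measure ℝ := if 0 < x then Measure.dirac x else 0

/-- positive part x⁺ -/
def pos (x : ℝ) : ℝ := max x 0

/-- the arrival counting process E(t) = sup{i : U i ≤ t} -/
def Ecount (U : ℕ → ℝ) (t : ℝ) : ℕ := sSup {i : ℕ | U i ≤ t}

/-- the standing hypotheses on the data of a pathwise processor sharing queue:
nondecreasing arrival times with `U 0 = 0`, `U 1 > 0`, `U i → ∞`, and strictly positive
service times and initial service times. -/
def QueueHyps (U v : ℕ → ℝ) (Z0 : ℕ) (vt : ℕ → ℝ) : Prop :=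
  U 0 = 0 ∧ Monotone U ∧ 0 < U 1 ∧ Tendsto U atTop atTop ∧
    (∀ i, 1 ≤ i → 0 < v i) ∧ (∀ j, 1 ≤ j → 0 < vt j)

/-- the defining equations of the state descriptor μ and the cumulative service per
job S:  `S t = ∫_0^t φ(⟨1, μ(s)⟩) ds` (recall `(0:ℝ)⁻¹ = 0` in Lean, matching φ(0)=0)
and `μ(t) = Σ_j δ⁺_{(ṽ_j - S(t))⁺} + Σ_{i ≤ E(t)} δ⁺_{(v_i - S(t) + S(U_i))⁺}`. -/
def StateEqns (U v : ℕ → ℝ) (Z0 : ℕ) (vt : ℕ → ℝ)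
    (μ : ℝ → Measure ℝ) (S : ℝ → ℝ) : Prop :=
  ∀ t, 0 ≤ t →
    (S t = ∫ s in (0:ℝ)..t, (mass (μ s))⁻¹) ∧
    μ t = (∑ j ∈ Finset.range Z0, dplus (pos (vt (j+1) - S t)))
        + ∑ i ∈ Finset.range (Ecount U t), dplus (pos (v (i+1) - S t + S (U (i+1))))

/-- fluid scaled state descriptor μ̄^r(t) = r⁻¹ μ(rt) -/
def fmu (μ : ℝ → Measure ℝ) (r t : ℝ) : Measure ℝ := ENNReal.ofReal (1/r) • μ (r*t)

/-- fluid scaled arrival process Ē^r(t) = r⁻¹ E(rt) -/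
def fE (U : ℕ → ℝ) (r t : ℝ) : ℝ := (Ecount U (r*t) : ℝ) / r

/-- fluid scaled cumulative service S̄^r_{t,t'} = S(r t') - S(r t) -/
def fS (S : ℝ → ℝ) (r t t' : ℝ) : ℝ := S (r*t') - S (r*t)

end PSQ
end

namespace PSQ

/-- The constraints tying together the constants of the good-path properties:
`ε ∈ (0,1)`, `l, p, κ, γ > 0`, `M > 1`, `l < ε/(32α)`, `κ < l/(2M)`,
`γ < (κε/4) ∧ (l/4)`. -/
def GoodConsts (α ε l p κ γ M : ℝ) : Prop :=
  ε ∈ Set.Ioo (0:ℝ) 1 ∧ 0 < l ∧ 0 < p ∧ 0 < κ ∧ 0 < γ ∧ 1 < M ∧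
    l < ε/(32*α) ∧ κ < l/(2*M) ∧ γ < min (κ*ε/4) (l/4)

/-- A processor sharing path satisfies the level-(ε, l, κ, γ, M) good-path properties
(for r, T, L), with `N = ⌈64M²/(κε²)⌉ + 1`. -/
def GoodPath (U v : ℕ → ℝ) (μ : ℝ → Measure ℝ) (ν : Measure ℝ)
    (T L r ε l p κ γ M : ℝ) : Prop :=
  ∀ m : ℕ, m ≤ ⌊r * T⌋₊ →
    (∀ t ∈ Set.Icc (0:ℝ) L, fE U r ((m:ℝ) + t + l) - fE U r ((m:ℝ) + t) ≤ ε/16) ∧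
    (∀ t ∈ Set.Icc (0:ℝ) L,
      max (max (mass (fmu μ r ((m:ℝ)+t))) (pair id (fmu μ r ((m:ℝ)+t))))
        (pair (fun x => x ^ ((1:ℝ)+p)) (fmu μ r ((m:ℝ)+t))) ≤ M) ∧
    (∀ x : ℝ, 0 ≤ x → ((fmu μ r 0) (Set.Icc x (x+κ))).toReal ≤ ε/4) ∧
    (∀ t ∈ Set.Icc (0:ℝ) L,
      |pair id (fmu μ r ((m:ℝ)+t)) - pair id (fmu μ r (m:ℝ))| ≤ γ/4) ∧
    (∀ t ∈ Set.Icc (0:ℝ) L, ∀ k : ℕ, k ≤ ⌈64*M^2/(κ*ε^2)⌉₊ + 1 →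
      (1/r) * (∑ i ∈ Finset.Ioc (Ecount U (r*((m:ℝ)+t))) (Ecount U (r*((m:ℝ)+t+l))),
          if (k:ℝ)*κ ≤ v i ∧ v i < ((k:ℝ)+1)*κ then (1:ℝ) else 0)
        ≤ (ε/8) * (ν (Set.Ico (((k:ℝ)-1/2)*κ) (((k:ℝ)+3/2)*κ))).toReal)

end PSQ

namespace PSQ

/-- the metric d on finite measures built from the families (g_k), (h_k)
(with 0-based indexing, so `g k` plays the role of the paper's `g_{k+1}`). -/
noncomputable def dmet (g h : ℕ → ℝ → ℝ) (ζ₁ ζ₂ : Measure ℝ) : ℝ :=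
  (∑' k : ℕ, (2:ℝ)⁻¹^(k+1) * min |pair (g k) ζ₁ - pair (g k) ζ₂| 1)
    + ⨆ k : ℕ, |pair (h k) ζ₁ - pair (h k) ζ₂|

/-- the hypotheses on the families (g_k), (h_k) defining the metric d (0-based
indexing: `h k` vanishes on [0,k] and equals 1 on [k+1,∞), i.e. it is the paper's
`h_{k+1}`); the family (g_k) is convergence determining for weak convergence of
finite Borel measures on ℝ₊. -/
def MetricFamilies (g h : ℕ → ℝ → ℝ) : Prop :=
  (∀ k, (∀ x, 0 ≤ g k x ∧ g k x ≤ 1) ∧ ContDiff ℝ 1 (g k) ∧ ∃ C, ∀ x, |deriv (g k) x| ≤ C) ∧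
  (∀ k, (∀ x, 0 ≤ h k x ∧ h k x ≤ 1) ∧ ContDiff ℝ 1 (h k) ∧
    (∀ x ∈ Set.Icc (0:ℝ) (k:ℝ), h k x = 0) ∧ (∀ x, (k:ℝ)+1 ≤ x → h k x = 1) ∧
    (∀ x, |deriv (h k) x| ≤ 2)) ∧
  (∀ (ζs : ℕ → Measure ℝ) (ζ : Measure ℝ),
    (∀ j, IsFiniteMeasure (ζs j)) → IsFiniteMeasure ζ →
    (∀ j, ζs j (Set.Iio 0) = 0) → ζ (Set.Iio 0) = 0 →
    (∀ k, Tendsto (fun j => pair (g k) (ζs j)) atTop (nhds (pair (g k) ζ))) →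
    ∀ f : ℝ → ℝ, Continuous f → (∃ C, ∀ x, |f x| ≤ C) →
      Tendsto (fun j => pair f (ζs j)) atTop (nhds (pair f ζ)))

end PSQ

namespace PSQ

/-- the excess lifetime distribution ν_e associated with ν:
it has density y ↦ β·ν((y,∞)) on [0,∞) with β = (∫x dν)⁻¹, so that
ν_e([0,x]) = β ∫_0^x ν((y,∞)) dy. -/
noncomputable def nue (ν : Measure ℝ) : Measure ℝ :=
  (volume.restrict (Set.Ici (0:ℝ))).withDensity
    fun y => ν (Set.Ioi y) * (ENNReal.ofReal (∫ x, x ∂ν))⁻¹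

/-- the lifting map Δ: w ↦ (w/⟨χ,νe⟩)·νe -/
noncomputable def Delta (νe : Measure ℝ) (w : ℝ) : Measure ℝ :=
  ENNReal.ofReal (w / ∫ x, x ∂νe) • νe

/-- sums of g(v_i) over arrivals i with s < U_i-index ≤ t,
i.e. Σ_{i = E(s)+1}^{E(t)} g(v_i). -/
noncomputable def arrSum (U w : ℕ → ℝ) (g : ℝ → ℝ) (s t : ℝ) : ℝ :=
  ∑ i ∈ Finset.Ioc (Ecount U s) (Ecount U t), g (w i)

/-- weak continuity of a measure-valued path on a set -/
def WeaklyContinuousOn (ζ : ℝ → Measure ℝ) (s : Set ℝ) : Prop :=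
  ∀ f : ℝ → ℝ, Continuous f → (∃ C, ∀ x, |f x| ≤ C) →
    ContinuousOn (fun t => pair f (ζ t)) s

/-- fluid model solution on [0,L] for critical data (α, ν) -/
def IsFluidSol (α : ℝ) (ν : Measure ℝ) (L : ℝ) (ζ : ℝ → Measure ℝ) : Prop :=
  (∀ t ∈ Set.Icc (0:ℝ) L, IsFiniteMeasure (ζ t) ∧ ζ t (Set.Iio 0) = 0 ∧ ζ t {0} = 0) ∧
  WeaklyContinuousOn ζ (Set.Icc 0 L) ∧
  ((ζ 0 = 0 ∧ ∀ t ∈ Set.Icc (0:ℝ) L, ζ t = 0) ∨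
   ((∀ t ∈ Set.Icc (0:ℝ) L, ζ t ≠ 0) ∧
    ∀ t ∈ Set.Icc (0:ℝ) L, ∀ gf : ℝ → ℝ, ContDiff ℝ 1 gf →
      (∃ C, ∀ x, |gf x| ≤ C ∧ |deriv gf x| ≤ C) → gf 0 = 0 → deriv gf 0 = 0 →
      pair gf (ζ t) = pair gf (ζ 0)
        - (∫ s in (0:ℝ)..t, pair (deriv gf) (ζ s) / mass (ζ s)) + α * t * pair gf ν))

/-- The good-path setting: all the fixed data (heavy traffic sequence R, threshold
sequences ε_n, l_n, κ_n, γ_n, constants p, M, a dense family V of test functions, the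
families g, h defining the metric d, the sequence r_n) together with their standing
hypotheses. -/
structure Setting where
  α : ℝ
  ν : Measure ℝ
  T : ℝ
  R : ℕ → ℝ
  εseq : ℕ → ℝ
  lseq : ℕ → ℝ
  κseq : ℕ → ℝ
  γseq : ℕ → ℝ
  p : ℝ
  M : ℝ
  V : ℕ → ℝ → ℝ
  gmet : ℕ → ℝ → ℝ
  hmet : ℕ → ℝ → ℝ
  rseq : ℕ → ℝ
  hα : 0 < α
  hν : IsProbabilityMeasure ν
  hν0 : ν {0} = 0
  hνsupp : ν (Set.Iio 0) = 0
  hνint : Integrable (fun x => x) ν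
  hcrit : α * ∫ x, x ∂ν = 1
  hT : 1 < T
  hR : ∀ n, 0 < R n
  hRmono : StrictMono R
  hRtop : Tendsto R atTop atTop
  hε : ∀ n, εseq n ∈ Set.Ioo (0:ℝ) 1
  hεanti : StrictAnti εseq
  hεlim : Tendsto εseq atTop (nhds 0)
  hp : 0 < p
  hM : 1 < M
  hl : ∀ n, 0 < lseq n
  hκ : ∀ n, 0 < κseq n
  hγ : ∀ n, 0 < γseq n
  hlε : ∀ n, lseq n < εseq n/(32*α)
  hκl : ∀ n, κseq n < lseq n/(2*M)
  hγc : ∀ n, γseq n < min (κseq n * εseq n/4) (lseq n/4)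
  hVsupp : ∀ k, HasCompactSupport (V k)
  hVdiff : ∀ k, ContDiff ℝ 1 (V k)
  hV0 : ∀ k, V k 0 = 0 ∧ deriv (V k) 0 = 0
  hVdense : ∀ g : ℝ → ℝ, HasCompactSupport g → ContDiff ℝ 1 g →
    g 0 = 0 → deriv g 0 = 0 →
    ∃ φ : ℕ → ℕ, (∃ C, ∀ j x, |V (φ j) x| ≤ C ∧ |deriv (V (φ j)) x| ≤ C) ∧
      (∀ x, Tendsto (fun j => V (φ j) x) atTop (nhds (g x))) ∧
      (∀ x, Tendsto (fun j => deriv (V (φ j)) x) atTop (nhds (deriv g x)))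
  hmetfam : MetricFamilies gmet hmet
  hrpos : ∀ n, 0 < rseq n
  hrmono : StrictMono rseq
  hrtop : Tendsto rseq atTop atTop

/-- the excess lifetime distribution of the setting -/
noncomputable def Setting.nuE (S : Setting) : Measure ℝ := nue S.ν

/-- the index n(r) -/
noncomputable def Setting.nIdx (S : Setting) (r : ℝ) : ℕ := sSup {n : ℕ | S.rseq n < r}

/-- membership in the invariant manifold M_ν -/
def Setting.onManifold (S : Setting) (ξ : Measure ℝ) : Prop :=
  ∃ c : ℝ, 0 ≤ c ∧ ξ = ENNReal.ofReal c • S.nuE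

/-- the distance of a measure-valued path on [0,L] to the good paths B_L^r :
ζ ∈ B_L^r iff ζ agrees on [0,L] with some shifted fluid scaled state descriptor
μ̄^{r,m}, 0 ≤ m ≤ ⌊rT⌋, of a processor-sharing path satisfying, for all n' ≤ n(r),
the level-(ε_{n'}, l_{n'}, κ_{n'}, γ_{n'}, M) good-path properties, the law of large
numbers bounds for the test family V, and whose initial measure is ε_{n'}-close to
the invariant manifold. -/
def Setting.memBLr (S : Setting) (L r : ℝ) (ζ : ℝ → Measure ℝ) : Prop :=
  ∃ (U v : ℕ → ℝ) (Z0 : ℕ) (vt : ℕ → ℝ) (μ : ℝ → Measure ℝ) (Sf : ℝ → ℝ) (m : ℕ),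
    QueueHyps U v Z0 vt ∧ StateEqns U v Z0 vt μ Sf ∧ m ≤ ⌊r * S.T⌋₊ ∧
    (∀ t ∈ Set.Icc (0:ℝ) L, ζ t = fmu μ r ((m:ℝ)+t)) ∧
    ∀ n' : ℕ, n' ≤ S.nIdx r →
      GoodPath U v μ S.ν S.T L r (S.εseq n') (S.lseq n') S.p (S.κseq n') (S.γseq n') S.M ∧
      (∀ k : ℕ, k ≤ n' → ∀ j : ℕ, 1 ≤ j → j ≤ ⌊L / S.lseq n'⌋₊ → ∀ m' : ℕ, m' ≤ ⌊r*S.T⌋₊ →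
        |(1/r) * arrSum U v (S.V k) (r*(m':ℝ)) (r*((m':ℝ) + (j:ℝ) * S.lseq n'))
          - S.α * (j:ℝ) * S.lseq n' * pair (S.V k) S.ν| ≤ S.εseq n') ∧
      (∃ ξ : Measure ℝ, S.onManifold ξ ∧
        max (dmet S.gmet S.hmet (fmu μ r 0) ξ) |pair id (fmu μ r 0) - pair id ξ| < S.εseq n')

/-- the set B_L of uniform limits of good paths: weakly continuous M_F-valued paths
on [0,L] that are uniform (in the metric d) limits of paths ζ^j ∈ B_L^{r̃_j} along a
subsequence r̃_j → ∞ of R. -/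
def Setting.memBL (S : Setting) (L : ℝ) (ζ : ℝ → Measure ℝ) : Prop :=
  (∀ t ∈ Set.Icc (0:ℝ) L, IsFiniteMeasure (ζ t) ∧ ζ t (Set.Iio 0) = 0) ∧
  (∀ t ∈ Set.Icc (0:ℝ) L, ∀ ε : ℝ, 0 < ε → ∃ δ : ℝ, 0 < δ ∧
    ∀ s ∈ Set.Icc (0:ℝ) L, |s - t| < δ → dmet S.gmet S.hmet (ζ s) (ζ t) < ε) ∧
  ∃ (φ : ℕ → ℕ) (ζs : ℕ → ℝ → Measure ℝ), StrictMono φ ∧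
    (∀ j, S.memBLr L (S.R (φ j)) (ζs j)) ∧
    ∀ ε : ℝ, 0 < ε → ∃ J : ℕ, ∀ j, J ≤ j → ∀ t ∈ Set.Icc (0:ℝ) L,
      dmet S.gmet S.hmet (ζs j t) (ζ t) ≤ ε

end PSQ

open scoped ENNReal

namespace PSQ

theorem setLIntegral_translate (f : ℝ → ℝ≥0∞) (a : ℝ) (s : Set ℝ) (hs : MeasurableSet s) :
    ∫⁻ x in (fun x => x + a) ⁻¹' s, f (x + a) = ∫⁻ x in s, f x := by
  rw [← lintegral_indicator hs, ← lintegral_indicator ((measurable_add_const a) hs),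
    ← lintegral_add_right_eq_self (s.indicator f) a]
  rfl

theorem lintegral_renewal_contraction {κ y n : ℝ → ℝ≥0∞} (hκ : Measurable κ) (hy : Measurable y)
    (hn : Measurable n) (hκ1 : ∫⁻ x, κ x ≤ 1) {h : ℝ} (hh : 0 ≤ h)
    (hyfin : ∫⁻ v in Ioo 0 h, y v ≠ ⊤)
    (hren : ∀ᵐ v ∂(volume.restrict (Ioo 0 h)),
      y v ≤ n v + ∫⁻ s in Ioo 0 v, κ (v - s) * y s) :
    ∫⁻ x in Ioi 0, (n (x + h) + ∫⁻ v in Ioo 0 h, κ (x + h - v) * y v) ≤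
      ∫⁻ x in Ioi 0, n x := by
  have hmeas : Measurable fun p : ℝ × ℝ => κ (p.1 + h - p.2) * y p.2 :=
    (hκ.comp ((measurable_fst.add_const h).sub measurable_snd)).mul (hy.comp measurable_snd)
  have hmeas' : Measurable fun p : ℝ × ℝ => κ (p.1 - p.2) * y p.2 :=
    (hκ.comp (measurable_fst.sub measurable_snd)).mul (hy.comp measurable_snd)
  have htrans : ∀ (a : ℝ) (s : Set ℝ), MeasurableSet s →
      ∫⁻ x in (fun x => x + a) ⁻¹' s, κ (x + a) = ∫⁻ z in s, κ z :=
    fun a s hs => setLIntegral_translate κ a s hs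
  have hA : ∫⁻ x in Ioi 0, ∫⁻ v in Ioo 0 h, κ (x + h - v) * y v =
      ∫⁻ v in Ioo 0 h, (∫⁻ z in Ioi (h - v), κ z) * y v := by
    rw [lintegral_lintegral_swap hmeas.aemeasurable]
    refine lintegral_congr fun v => ?_
    rw [lintegral_mul_const _ (by fun_prop)]
    congr 1
    rw [← htrans (h - v) _ measurableSet_Ioi]
    simp only [preimage_add_const_Ioi, sub_self]
    refine lintegral_congr fun x => ?_
    congr 1; ring
  have hB : ∫⁻ v in Ioo 0 h, y v ≤ (∫⁻ v in Ioo 0 h, n v) +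
      ∫⁻ s in Ioo 0 h, (∫⁻ z in Iio (h - s), κ z) * y s := by
    calc ∫⁻ v in Ioo 0 h, y v
        ≤ ∫⁻ v in Ioo 0 h, (n v + ∫⁻ s in Ioo 0 v, κ (v - s) * y s) := lintegral_mono_ae hren
      _ = (∫⁻ v in Ioo 0 h, n v) + ∫⁻ v in Ioo 0 h, ∫⁻ s in Ioo 0 v, κ (v - s) * y s :=
          lintegral_add_left hn _
      _ ≤ (∫⁻ v in Ioo 0 h, n v) + ∫⁻ v in Ioo 0 h, ∫⁻ s in Ioo 0 h, κ (v - s) * y s := by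
          refine add_le_add le_rfl (setLIntegral_mono' measurableSet_Ioo fun v hv => ?_)
          exact lintegral_mono_set (Ioo_subset_Ioo_right hv.2.le)
      _ ≤ _ := by
          rw [lintegral_lintegral_swap hmeas'.aemeasurable]
          gcongr with s
          rw [lintegral_mul_const _ (by fun_prop)]
          refine mul_le_mul_left ?_ _
          have : ∫⁻ v in Iio h, κ (v - s) = ∫⁻ z in Iio (h - s), κ z := by
            rw [← htrans (-s) _ measurableSet_Iio]
            simp [sub_eq_add_neg]
          rw [← this]
          exact lintegral_mono_set Ioo_subset_Iio_self
  have hsum : (∫⁻ v in Ioo 0 h, (∫⁻ z in Ioi (h - v), κ z) * y v) +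
      ∫⁻ s in Ioo 0 h, (∫⁻ z in Iio (h - s), κ z) * y s ≤ ∫⁻ v in Ioo 0 h, y v := by
    have hm1 : Measurable fun v => ∫⁻ z in Ioi (h - v), κ z := by
      have : Monotone fun v => ∫⁻ z in Ioi (h - v), κ z := fun a b hab =>
        lintegral_mono_set (Ioi_subset_Ioi (by linarith))
      exact this.measurable
    rw [← lintegral_add_left (by fun_prop)]
    refine lintegral_mono fun v => ?_
    rw [← add_mul]
    refine mul_le_of_le_one_left zero_le ?_
    rw [← lintegral_union measurableSet_Iio]
    · exact (setLIntegral_le_lintegral _ _).trans hκ1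
    · exact disjoint_left.2 fun z hz hz' => lt_asymm (mem_Ioi.1 hz) (mem_Iio.1 hz')
  have hfin : ∫⁻ s in Ioo 0 h, (∫⁻ z in Iio (h - s), κ z) * y s ≠ ⊤ :=
    ne_top_of_le_ne_top hyfin (le_trans le_add_self hsum)
  have hkey : ∫⁻ v in Ioo 0 h, (∫⁻ z in Ioi (h - v), κ z) * y v ≤ ∫⁻ v in Ioo 0 h, n v :=
    (ENNReal.add_le_add_iff_right hfin).1 (hsum.trans hB)
  rw [lintegral_add_left (by fun_prop), hA]
  have hn' : ∫⁻ x in Ioi 0, n (x + h) = ∫⁻ x in Ioi h, n x := by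
    rw [← setLIntegral_translate n h _ measurableSet_Ioi]; simp
  rw [hn', ← Ioc_union_Ioi_eq_Ioi hh,
    lintegral_union measurableSet_Ioi (disjoint_left.2 fun z hz hz' => not_lt.2 hz.2 hz'),
    add_comm]
  refine add_le_add ?_ le_rfl
  exact hkey.trans (lintegral_mono_set Ioo_subset_Ioc_self)

end PSQ

namespace PSQ

structure RenewalKernel (k : ℝ → ℝ) (α : ℝ) : Prop where
  meas : Measurable k
  nonneg : ∀ x, 0 ≤ k x
  neg : ∀ x < 0, k x = 0
  anti : AntitoneOn k (Ici 0)
  le : ∀ x, k x ≤ α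
  int : Integrable k
  one : ∫ x, k x = 1

theorem energy_estimate {k : ℝ → ℝ} {α : ℝ} (K : RenewalKernel k α) {Z H : ℝ → ℝ} {A M : ℝ}
    (hZ : Measurable Z) (hZ0 : ∀ x, 0 ≤ Z x) (hZM : ∀ x, Z x ≤ M)
    (hZneg : ∀ x < 0, Z x = 0) (hH0 : ∀ x, 0 < x → 0 ≤ H x) (hH : IntegrableOn H (Ioi 0))
    (hren : ∀ᵐ u ∂(volume.restrict (Ioo 0 A)), Z u = H u + ∫ y, k y * Z (u - y)) :
    ∫⁻ u in Ioo 0 A, ∫⁻ y, ENNReal.ofReal (k y * (Z u - Z (u - y)) ^ 2) ≤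
      ENNReal.ofReal (2 * M * ∫ u in Ioi 0, H u) := by
  have hM0 : 0 ≤ M := (hZ0 0).trans (hZM 0)
  have hZb : ∀ x, |Z x| ≤ M := fun x => by rw [abs_of_nonneg (hZ0 x)]; exact hZM x
  have hint1 : ∀ u, Integrable fun y => k y * Z (u - y) := fun u =>
    K.int.mul_bdd (c := M) (by exact Measurable.aestronglyMeasurable (by fun_prop))
      (ae_of_all _ fun y => by simpa using hZb _)
  have hint2 : ∀ u, Integrable fun y => k y * Z (u - y) ^ 2 := fun u =>
    K.int.mul_bdd (c := M ^ 2) (by exact Measurable.aestronglyMeasurable (by fun_prop))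
      (ae_of_all _ fun y => by
      rw [norm_pow]; exact pow_le_pow_left₀ (norm_nonneg _) (by simpa using hZb _) 2)
  have hexp : ∀ u, ∫ y, k y * (Z u - Z (u - y)) ^ 2 =
      Z u ^ 2 - 2 * Z u * (∫ y, k y * Z (u - y)) + ∫ y, k y * Z (u - y) ^ 2 := fun u => by
    have : ∀ y, k y * (Z u - Z (u - y)) ^ 2 =
        Z u ^ 2 * k y - 2 * Z u * (k y * Z (u - y)) + k y * Z (u - y) ^ 2 := fun y => by ring
    simp_rw [this]
    have hi : Integrable fun y => Z u ^ 2 * k y - 2 * Z u * (k y * Z (u - y)) :=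
      (K.int.const_mul _).sub ((hint1 u).const_mul _)
    rw [integral_add hi (hint2 u),
      integral_sub (K.int.const_mul _) ((hint1 u).const_mul _), integral_const_mul,
      integral_const_mul, K.one, mul_one]
  have hint3 : ∀ u, Integrable fun y => k y * (Z u - Z (u - y)) ^ 2 := fun u => by
    have : (fun y => k y * (Z u - Z (u - y)) ^ 2) = fun y =>
        Z u ^ 2 * k y - 2 * Z u * (k y * Z (u - y)) + k y * Z (u - y) ^ 2 := by ext y; ring
    rw [this]
    exact ((K.int.const_mul _).sub ((hint1 u).const_mul _)).add (hint2 u)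
  have hpt : ∀ᵐ u ∂(volume.restrict (Ioo 0 A)),
      (∫⁻ y, ENNReal.ofReal (k y * (Z u - Z (u - y)) ^ 2)) + ENNReal.ofReal (Z u ^ 2) ≤
      ENNReal.ofReal (2 * M * H u) + ∫⁻ y, ENNReal.ofReal (k y * Z (u - y) ^ 2) := by
    filter_upwards [hren, ae_restrict_mem measurableSet_Ioo] with u hu hu'
    have e0 : 0 ≤ H u := hH0 u hu'.1
    rw [← ofReal_integral_eq_lintegral_ofReal (hint3 u)
        (ae_of_all _ fun y => mul_nonneg (K.nonneg y) (sq_nonneg _)),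
      ← ofReal_integral_eq_lintegral_ofReal (hint2 u)
        (ae_of_all _ fun y => mul_nonneg (K.nonneg y) (sq_nonneg _)),
      ← ENNReal.ofReal_add (integral_nonneg fun y => mul_nonneg (K.nonneg y) (sq_nonneg _))
        (sq_nonneg _),
      ← ENNReal.ofReal_add (by positivity)
        (integral_nonneg fun y => mul_nonneg (K.nonneg y) (sq_nonneg _))]
    apply ENNReal.ofReal_le_ofReal
    rw [hexp u]
    have : ∫ y, k y * Z (u - y) = Z u - H u := by linarith
    rw [this]
    nlinarith [hZM u, hZ0 u]
  have hk1 : ∫⁻ y, ENNReal.ofReal (k y) = 1 := by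
    rw [← ofReal_integral_eq_lintegral_ofReal K.int (ae_of_all _ K.nonneg), K.one,
      ENNReal.ofReal_one]
  have hm2 : Measurable fun p : ℝ × ℝ => ENNReal.ofReal (k p.2 * Z (p.1 - p.2) ^ 2) := by
    have := K.meas; fun_prop
  have hconv : ∫⁻ u in Ioo 0 A, ∫⁻ y, ENNReal.ofReal (k y * Z (u - y) ^ 2) ≤
      ∫⁻ u in Ioo 0 A, ENNReal.ofReal (Z u ^ 2) := by
    rw [lintegral_lintegral_swap hm2.aemeasurable]
    have hkm := K.meas
    calc ∫⁻ y, ∫⁻ u in Ioo 0 A, ENNReal.ofReal (k y * Z (u - y) ^ 2)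
        ≤ ∫⁻ y, ENNReal.ofReal (k y) * ∫⁻ u in Ioo 0 A, ENNReal.ofReal (Z u ^ 2) := by
          refine lintegral_mono fun y => ?_
          rcases lt_or_ge y 0 with hy | hy
          · simp [K.neg y hy]
          simp_rw [ENNReal.ofReal_mul (K.nonneg y)]
          rw [lintegral_const_mul _ (by fun_prop)]
          refine mul_le_mul_right ?_ _
          rw [Measure.restrict_congr_set (Ioo_ae_eq_Ico (a := (0 : ℝ)) (b := A)),
            ← lintegral_indicator measurableSet_Ico, ← lintegral_indicator measurableSet_Ico,
            ← lintegral_sub_right_eq_self ((Ico 0 A).indicator fun u => ENNReal.ofReal (Z u ^ 2)) y]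
          refine lintegral_mono fun u => ?_
          by_cases hu : u ∈ Ico 0 A
          · rw [indicator_of_mem hu]
            by_cases hu' : u - y ∈ Ico 0 A
            · rw [indicator_of_mem hu']
            · rcases lt_or_ge (u - y) 0 with h | h
              · simp [hZneg _ h]
              · exact absurd ⟨h, by linarith [hu.2]⟩ hu'
          · rw [indicator_of_notMem hu]; exact zero_le
      _ = _ := by rw [lintegral_mul_const _ (by fun_prop), hk1, one_mul]
  have hfinZ : ∫⁻ u in Ioo 0 A, ENNReal.ofReal (Z u ^ 2) ≠ ⊤ := by
    refine ne_top_of_le_ne_top ?_ (setLIntegral_mono' (g := fun _ => ENNReal.ofReal (M ^ 2))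
      measurableSet_Ioo fun u _ =>
        ENNReal.ofReal_le_ofReal (pow_le_pow_left₀ (hZ0 u) (hZM u) 2))
    simp [ENNReal.mul_eq_top]
  have hmain := lintegral_mono_ae hpt
  have hmH : ∫⁻ u in Ioo 0 A, ENNReal.ofReal (2 * M * H u) ≤
      ENNReal.ofReal (2 * M * ∫ u in Ioi 0, H u) := by
    rw [← integral_const_mul, ofReal_integral_eq_lintegral_ofReal (hH.const_mul _)]
    · exact lintegral_mono_set Ioo_subset_Ioi_self
    · filter_upwards [ae_restrict_mem measurableSet_Ioi] with u hu
      have := hH0 u hu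
      simp only [Pi.zero_apply]; positivity
  rw [lintegral_add_right _ (by fun_prop), lintegral_add_right _ (by
    exact hm2.lintegral_prod_right')] at hmain
  refine (ENNReal.add_le_add_iff_right hfinZ).1 (hmain.trans ?_)
  gcongr

end PSQ

namespace PSQ

theorem setLIntegral_Ioo_comp_div (f : ℝ → ℝ≥0∞) {a : ℝ} (ha : 0 < a) (δ : ℝ) :
    ∫⁻ y in Ioo 0 (a * δ), f (y / a) = ENNReal.ofReal a * ∫⁻ y in Ioo 0 δ, f y := by
  have h := lintegral_map_equiv (μ := volume) ((Ioo 0 δ).indicator f)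
    (Homeomorph.mulLeft₀ a⁻¹ (inv_ne_zero ha.ne')).toMeasurableEquiv
  have h2 : Measure.map (⇑(Homeomorph.mulLeft₀ a⁻¹ (inv_ne_zero ha.ne')).toMeasurableEquiv)
      (volume : Measure ℝ) = ENNReal.ofReal a • volume := by
    have := Real.map_volume_mul_left (inv_ne_zero ha.ne')
    rw [inv_inv, abs_of_pos ha] at this
    exact this
  rw [h2, lintegral_smul_measure, smul_eq_mul, lintegral_indicator measurableSet_Ioo] at h
  rw [h, ← lintegral_indicator measurableSet_Ioo]
  refine lintegral_congr fun y => ?_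
  have e : (Homeomorph.mulLeft₀ a⁻¹ (inv_ne_zero ha.ne')).toMeasurableEquiv y = y / a := by
    simp [div_eq_inv_mul]
  rw [e]
  by_cases hy : y ∈ Ioo 0 (a * δ)
  · rw [indicator_of_mem hy, indicator_of_mem]
    exact ⟨by have := hy.1; positivity, by rw [div_lt_iff₀ ha]; linarith [hy.2]⟩
  · rw [indicator_of_notMem hy, indicator_of_notMem]
    rintro ⟨h1, h2⟩
    rw [lt_div_iff₀ ha] at h1
    rw [div_lt_iff₀ ha] at h2
    exact hy ⟨by linarith, by linarith⟩

theorem lintegral_increment_chain {Z : ℝ → ℝ} (hZ : Measurable Z) (δ : ℝ) {n : ℕ}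
    (hn : 0 < n) (A : ℝ) :
    ∫⁻ u in Ioo (n * δ) A, ∫⁻ y in Ioo 0 (n * δ), ‖Z u - Z (u - y)‖ₑ ≤
      (n : ℝ≥0∞) ^ 2 * ∫⁻ u in Ioo 0 A, ∫⁻ y in Ioo 0 δ, ‖Z u - Z (u - y)‖ₑ := by
  have hn0 : (0 : ℝ) < n := by exact_mod_cast hn
  have hm : Measurable fun p : ℝ × ℝ => ‖Z p.1 - Z (p.1 - p.2)‖ₑ := by fun_prop
  have hstep : ∀ y ∈ Ioo 0 (n * δ), ∫⁻ u in Ioo (n * δ) A, ‖Z u - Z (u - y)‖ₑ ≤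
      n * ∫⁻ u in Ioo 0 A, ‖Z u - Z (u - y / n)‖ₑ := by
    intro y hy
    calc ∫⁻ u in Ioo (n * δ) A, ‖Z u - Z (u - y)‖ₑ
        ≤ ∫⁻ u in Ioo (n * δ) A, ∑ i ∈ Finset.range n,
            ‖Z (u - i * (y / n)) - Z (u - i * (y / n) - y / n)‖ₑ := by
          refine lintegral_mono fun u => ?_
          have hs : Z u - Z (u - y) = ∑ i ∈ Finset.range n,
              (Z (u - i * (y / n)) - Z (u - i * (y / n) - y / n)) := by
            have := Finset.sum_range_sub' (fun i : ℕ => Z (u - i * (y / n))) n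
            rw [show (n : ℝ) * (y / n) = y by field_simp] at this
            simp only [Nat.cast_zero, zero_mul, sub_zero] at this
            rw [← this]
            refine Finset.sum_congr rfl fun i _ => ?_
            congr 2; push_cast; ring
          rw [hs]
          exact enorm_sum_le _ _
      _ = ∑ i ∈ Finset.range n, ∫⁻ u in Ioo (n * δ) A,
            ‖Z (u - i * (y / n)) - Z (u - i * (y / n) - y / n)‖ₑ :=
          lintegral_finsetSum _ fun i _ => by fun_prop
      _ ≤ ∑ i ∈ Finset.range n, ∫⁻ u in Ioo 0 A, ‖Z u - Z (u - y / n)‖ₑ := by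
          refine Finset.sum_le_sum fun i hi => ?_
          rw [← setLIntegral_translate (fun u => ‖Z u - Z (u - y / n)‖ₑ) (-(i * (y / n))) _
            measurableSet_Ioo]
          refine (lintegral_mono_set (t := (fun u => u + -(i * (y / n))) ⁻¹' Ioo 0 A) ?_).trans
            (le_of_eq ?_)
          · intro u hu
            have h1 : (i : ℝ) * (y / n) ≤ y := by
              have : (i : ℝ) ≤ n := by exact_mod_cast (Finset.mem_range.1 hi).le
              calc (i : ℝ) * (y / n) ≤ n * (y / n) := by
                    have := hy.1; gcongr
                _ = y := by field_simp
            have h2 : 0 ≤ (i : ℝ) * (y / n) := by have := hy.1; positivity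
            exact ⟨by linarith [hu.1, hy.2], by linarith [hu.2]⟩
          · simp [sub_eq_add_neg]
      _ = _ := by simp
  rw [lintegral_lintegral_swap (f := fun u y => ‖Z u - Z (u - y)‖ₑ)
      (μ := volume.restrict (Ioo (n * δ) A)) (ν := volume.restrict (Ioo 0 (n * δ)))
      hm.aemeasurable,
    lintegral_lintegral_swap (f := fun u y => ‖Z u - Z (u - y)‖ₑ)
      (μ := volume.restrict (Ioo 0 A)) (ν := volume.restrict (Ioo 0 δ)) hm.aemeasurable]
  calc ∫⁻ y in Ioo 0 (n * δ), ∫⁻ u in Ioo (n * δ) A, ‖Z u - Z (u - y)‖ₑ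
      ≤ ∫⁻ y in Ioo 0 (n * δ), n * ∫⁻ u in Ioo 0 A, ‖Z u - Z (u - y / n)‖ₑ :=
        setLIntegral_mono' measurableSet_Ioo hstep
    _ = n * ∫⁻ y in Ioo 0 (n * δ), ∫⁻ u in Ioo 0 A, ‖Z u - Z (u - y / n)‖ₑ := by
        refine lintegral_const_mul' _ _ (by simp)
    _ = _ := by
        rw [setLIntegral_Ioo_comp_div (fun y => ∫⁻ u in Ioo 0 A, ‖Z u - Z (u - y)‖ₑ) hn0,
          ENNReal.ofReal_natCast, sq, mul_assoc]

theorem exists_nearly_constant_window {k : ℝ → ℝ} {α : ℝ} (K : RenewalKernel k α) {δ : ℝ}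
    (hδ : 0 < δ) (hkδ : 0 < k δ) {n : ℕ} (hn : 0 < n) {C ε : ℝ} (hC : 0 ≤ C) (hε : 0 < ε) :
    ∃ A : ℝ, n * δ < A ∧ ∀ Z : ℝ → ℝ, Measurable Z →
      ∫⁻ u in Ioo 0 A, ∫⁻ y, ENNReal.ofReal (k y * (Z u - Z (u - y)) ^ 2) ≤ ENNReal.ofReal C →
      ∃ u ∈ Ioo (n * δ) A, ∫⁻ y in Ioo 0 (n * δ), ‖Z u - Z (u - y)‖ₑ ≤ ENNReal.ofReal ε := by
  have hn0 : (0 : ℝ) < n := by exact_mod_cast hn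
  set η : ℝ := ε / (4 * n ^ 2 * δ) with hη
  have hη0 : 0 < η := by positivity
  set Q : ℝ := n ^ 2 * (C / (k δ * η)) with hQ
  have hQ0 : 0 ≤ Q := by positivity
  refine ⟨n * δ + (n * δ + 4 * Q / ε) + 1, by
    have : 0 ≤ 4 * Q / ε := by positivity
    have : 0 < n * δ := by positivity
    linarith, fun Z hZ hen => ?_⟩
  set A : ℝ := n * δ + (n * δ + 4 * Q / ε) + 1 with hA
  have hA0 : 0 < A := by positivity
  by_contra! hcon
  have hlow : ENNReal.ofReal (ε * (A - n * δ)) ≤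
      ∫⁻ u in Ioo (n * δ) A, ∫⁻ y in Ioo 0 (n * δ), ‖Z u - Z (u - y)‖ₑ := by
    calc ENNReal.ofReal (ε * (A - n * δ)) = ∫⁻ u in Ioo (n * δ) A, ENNReal.ofReal ε := by
          rw [setLIntegral_const, Real.volume_Ioo, ENNReal.ofReal_mul hε.le]
      _ ≤ _ := setLIntegral_mono' measurableSet_Ioo fun u hu => (hcon u hu).le
  have hup : ∫⁻ u in Ioo 0 A, ∫⁻ y in Ioo 0 δ, ‖Z u - Z (u - y)‖ₑ ≤
      ENNReal.ofReal (η * δ * A) + ENNReal.ofReal (C / (k δ * η)) := by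
    calc ∫⁻ u in Ioo 0 A, ∫⁻ y in Ioo 0 δ, ‖Z u - Z (u - y)‖ₑ
        ≤ ∫⁻ u in Ioo 0 A, ∫⁻ y in Ioo 0 δ, (ENNReal.ofReal η +
            ENNReal.ofReal (1 / (k δ * η)) *
              ENNReal.ofReal (k y * (Z u - Z (u - y)) ^ 2)) := by
          refine lintegral_mono fun u => setLIntegral_mono' measurableSet_Ioo fun y hy => ?_
          rw [← ENNReal.ofReal_mul (by positivity), ← ENNReal.ofReal_add hη0.le (by
            have := K.nonneg y; positivity), Real.enorm_eq_ofReal_abs]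
          apply ENNReal.ofReal_le_ofReal
          have hky : k δ ≤ k y := K.anti hy.1.le hδ.le hy.2.le
          have h1 : (Z u - Z (u - y)) ^ 2 / η ≤
              1 / (k δ * η) * (k y * (Z u - Z (u - y)) ^ 2) := by
            rw [div_le_iff₀ hη0]
            have : 1 / (k δ * η) * (k y * (Z u - Z (u - y)) ^ 2) * η =
              k y / k δ * (Z u - Z (u - y)) ^ 2 := by field_simp
            rw [this]
            exact le_mul_of_one_le_left (sq_nonneg _) ((one_le_div hkδ).2 hky)
          refine le_trans ?_ (add_le_add le_rfl h1)
          rw [← sq_abs (Z u - Z (u - y))]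
          set a := |Z u - Z (u - y)|
          rw [← sub_nonneg]
          have : η + a ^ 2 / η - a = ((η - a / 2) ^ 2 + 3 / 4 * a ^ 2) / η := by field_simp; ring
          rw [this]; positivity
      _ ≤ ∫⁻ u in Ioo 0 A, (ENNReal.ofReal (η * δ) + ENNReal.ofReal (1 / (k δ * η)) *
            ∫⁻ y, ENNReal.ofReal (k y * (Z u - Z (u - y)) ^ 2)) := by
          refine lintegral_mono fun u => ?_
          rw [lintegral_add_left (by fun_prop), setLIntegral_const, Real.volume_Ioo, sub_zero,
            ENNReal.ofReal_mul hη0.le, lintegral_const_mul' _ _ ENNReal.ofReal_ne_top]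
          gcongr
          exact Measure.restrict_le_self
      _ = ENNReal.ofReal (η * δ * A) + ENNReal.ofReal (1 / (k δ * η)) *
            ∫⁻ u in Ioo 0 A, ∫⁻ y, ENNReal.ofReal (k y * (Z u - Z (u - y)) ^ 2) := by
          rw [lintegral_add_left (by fun_prop), setLIntegral_const, Real.volume_Ioo, sub_zero,
            ENNReal.ofReal_mul (by positivity : 0 ≤ η * δ),
            lintegral_const_mul' _ _ ENNReal.ofReal_ne_top]
      _ ≤ _ := by
          rw [div_eq_mul_one_div C, mul_comm C,
            ENNReal.ofReal_mul (q := C) (show (0 : ℝ) ≤ 1 / (k δ * η) by positivity)]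
          gcongr
  have hfin := hlow.trans ((lintegral_increment_chain hZ δ hn A).trans
    (mul_le_mul_right hup _))
  rw [← ENNReal.ofReal_add (by positivity) (by positivity), ← ENNReal.ofReal_natCast,
    ← ENNReal.ofReal_pow hn0.le, ← ENNReal.ofReal_mul (by positivity),
    ENNReal.ofReal_le_ofReal_iff (by positivity)] at hfin
  have e1 : (n : ℝ) ^ 2 * (η * δ * A + C / (k δ * η)) = ε * A / 4 + Q := by
    rw [hQ, hη]; field_simp
  rw [e1] at hfin
  have e2 : ε * (4 * Q / ε) = 4 * Q := by field_simp
  have e3 : ε * A = 2 * (ε * (n * δ)) + 4 * Q + ε := by rw [hA]; linear_combination e2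
  have : 0 < ε * (n * δ) := by positivity
  nlinarith

end PSQ

namespace PSQ

/-- the integrated tail `∫_x^∞ k` -/
noncomputable def tailInt (k : ℝ → ℝ) (x : ℝ) : ℝ := ∫ y in Ioi x, k y

/-- the tail profile at operational time `u` -/
noncomputable def profile (k Z H : ℝ → ℝ) (u x : ℝ) : ℝ :=
  H (u + x) + ∫ s in Ioi 0, k (x + s) * Z (u - s)

theorem setIntegral_Ioi_comp_add (f : ℝ → ℝ) (a b : ℝ) :
    ∫ s in Ioi b, f (a + s) = ∫ y in Ioi (a + b), f y := by
  rw [← integral_indicator measurableSet_Ioi, ← integral_indicator measurableSet_Ioi,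
    ← integral_add_left_eq_self ((Ioi (a + b)).indicator f) a]
  congr 1 with s
  by_cases h : s ∈ Ioi b
  · rw [indicator_of_mem h, indicator_of_mem (show a + s ∈ Ioi (a + b) from
      add_lt_add_right (mem_Ioi.1 h) a)]
  · rw [indicator_of_notMem h, indicator_of_notMem]
    exact fun h' => h (lt_of_add_lt_add_left (mem_Ioi.1 h'))

theorem tailInt_eq_shift (k : ℝ → ℝ) (x : ℝ) : tailInt k x = ∫ s in Ioi 0, k (x + s) := by
  rw [setIntegral_Ioi_comp_add, add_zero, tailInt]

section
variable {k : ℝ → ℝ} {α : ℝ} (K : RenewalKernel k α)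
include K

theorem RenewalKernel.tailInt_nonneg (x : ℝ) : 0 ≤ tailInt k x :=
  integral_nonneg fun y => K.nonneg y

theorem RenewalKernel.tailInt_zero : tailInt k 0 = 1 := by
  rw [← K.one, tailInt, ← integral_indicator measurableSet_Ioi]
  refine integral_congr_ae ?_
  have : ∀ᵐ y : ℝ, y ≠ 0 := by simp [ae_iff]
  filter_upwards [this] with y hy
  rcases lt_or_gt_of_ne hy with h | h
  · rw [indicator_of_notMem (by simpa using h.le), K.neg y h]
  · rw [indicator_of_mem (mem_Ioi.2 h)]

theorem RenewalKernel.tailInt_antitone : Antitone (tailInt k) := fun _ _ h =>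
  setIntegral_mono_set K.int.integrableOn (ae_of_all _ fun y => K.nonneg y)
    (Ioi_subset_Ioi h).eventuallyLE

theorem RenewalKernel.tailInt_le_one {x : ℝ} (hx : 0 ≤ x) : tailInt k x ≤ 1 :=
  K.tailInt_zero ▸ K.tailInt_antitone hx

theorem RenewalKernel.lintegral_shift (s : ℝ) :
    ∫⁻ x in Ioi 0, ENNReal.ofReal (k (x + s)) = ENNReal.ofReal (tailInt k s) := by
  rw [tailInt_eq_shift, ofReal_integral_eq_lintegral_ofReal
    (K.int.comp_add_left s).integrableOn (ae_of_all _ fun y => K.nonneg _)]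
  simp_rw [add_comm]

theorem RenewalKernel.integrable_mul {Z : ℝ → ℝ} (hZ : Measurable Z) {M : ℝ}
    (hZM : ∀ x, |Z x| ≤ M) (x u : ℝ) :
    Integrable fun s => k (x + s) * Z (u - s) :=
  (K.int.comp_add_left x).mul_bdd (c := M)
    (hZ.comp (measurable_const.sub measurable_id)).aestronglyMeasurable (ae_of_all _ fun _ => hZM _)

theorem RenewalKernel.profile_shift {Z : ℝ → ℝ} (hZ : Measurable Z) {M : ℝ}
    (hZM : ∀ x, |Z x| ≤ M) (H : ℝ → ℝ) (c u x : ℝ) {h : ℝ} (hh : 0 ≤ h) :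
    profile k Z H (u + h) x - c * tailInt k x =
      profile k Z H u (x + h) - c * tailInt k (x + h) +
        ∫ v in Ioo 0 h, k (x + h - v) * (Z (u + v) - c) := by
  have hi := K.integrable_mul hZ hZM
  have h1 : ∫ s in Ioi 0, k (x + s) * Z (u + h - s) =
      (∫ s in Ioc 0 h, k (x + s) * Z (u + h - s)) +
        ∫ s in Ioi h, k (x + s) * Z (u + h - s) := by
    rw [← setIntegral_union (Ioc_disjoint_Ioi le_rfl) measurableSet_Ioi
      (hi x (u + h)).integrableOn (hi x (u + h)).integrableOn, Ioc_union_Ioi_eq_Ioi hh]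
  have h2 : ∫ s in Ioi h, k (x + s) * Z (u + h - s) =
      ∫ s in Ioi 0, k (x + h + s) * Z (u - s) := by
    have := setIntegral_Ioi_comp_add (fun y => k (x + y) * Z (u + h - y)) h 0
    rw [add_zero] at this
    rw [← this]
    congr 1 with s
    rw [show x + (h + s) = x + h + s by ring, show u + h - (h + s) = u - s by ring]
  have h3 : tailInt k x = (∫ s in Ioc 0 h, k (x + s)) + tailInt k (x + h) := by
    rw [tailInt_eq_shift, ← Ioc_union_Ioi_eq_Ioi hh, setIntegral_union
      (Ioc_disjoint_Ioi le_rfl) measurableSet_Ioi (K.int.comp_add_left x).integrableOn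
      (K.int.comp_add_left x).integrableOn, setIntegral_Ioi_comp_add, tailInt]
  have h4 : ∫ v in Ioo 0 h, k (x + h - v) * (Z (u + v) - c) =
      (∫ s in Ioc 0 h, k (x + s) * Z (u + h - s)) - c * ∫ s in Ioc 0 h, k (x + s) := by
    rw [← integral_const_mul, ← integral_sub (hi x (u + h)).integrableOn
      ((K.int.comp_add_left x).integrableOn.const_mul c), ← integral_Ioc_eq_integral_Ioo,
      ← intervalIntegral.integral_of_le hh, ← intervalIntegral.integral_of_le hh]
    have := intervalIntegral.integral_comp_sub_left (a := 0) (b := h)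
      (fun s => k (x + s) * Z (u + h - s) - c * k (x + s)) h
    rw [sub_self, sub_zero] at this
    rw [← this]
    congr 1 with v
    rw [show u + h - (h - v) = u + v by ring, show x + (h - v) = x + h - v by ring]
    ring
  rw [h4, profile, profile, h1, h2, h3, show u + h + x = u + (x + h) by ring]
  ring

theorem RenewalKernel.profile_contraction {Z H : ℝ → ℝ} (hZ : Measurable Z) {M : ℝ}
    (hZM : ∀ x, |Z x| ≤ M) (hH : Measurable H) (c : ℝ) {A u h : ℝ} (hu : 0 ≤ u) (hh : 0 ≤ h)
    (huA : u + h ≤ A)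
    (hren : ∀ᵐ w ∂(volume.restrict (Ioo 0 A)), Z w = H w + ∫ y, k y * Z (w - y)) :
    ∫⁻ x in Ioi 0, ‖profile k Z H (u + h) x - c * tailInt k x‖ₑ ≤
      ∫⁻ x in Ioi 0, ‖profile k Z H u x - c * tailInt k x‖ₑ := by
  have hkm := K.meas
  have hpm : Measurable fun x => profile k Z H u x := by
    have : StronglyMeasurable fun x => ∫ s in Ioi 0, k (x + s) * Z (u - s) := by
      refine StronglyMeasurable.integral_prod_right (f := fun x s => k (x + s) * Z (u - s)) ?_
      exact Measurable.stronglyMeasurable (by fun_prop)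
    have := this.measurable
    unfold profile
    fun_prop
  have htm : Measurable (tailInt k) := K.tailInt_antitone.measurable
  have hbd : ∀ v, ‖Z (u + v) - c‖ₑ ≤ ENNReal.ofReal (M + |c|) := fun v => by
    rw [Real.enorm_eq_ofReal_abs]
    exact ENNReal.ofReal_le_ofReal ((abs_sub _ _).trans (by gcongr; exact hZM _))
  have hn : ∀ f : ℝ → ℝ, ∀ x : ℝ, ∀ h : ℝ, 0 ≤ h → ‖∫ v in Ioo 0 h, k (x - v) * f v‖ₑ ≤
      ∫⁻ v in Ioo 0 h, ENNReal.ofReal (k (x - v)) * ‖f v‖ₑ := fun f x h _ => by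
    refine (enorm_integral_le_lintegral_enorm _).trans (le_of_eq ?_)
    refine lintegral_congr fun v => ?_
    rw [enorm_mul, Real.enorm_eq_ofReal (K.nonneg _)]
  have key := lintegral_renewal_contraction (κ := fun x => ENNReal.ofReal (k x))
    (y := fun v => ‖Z (u + v) - c‖ₑ)
    (n := fun x => ‖profile k Z H u x - c * tailInt k x‖ₑ)
    (by fun_prop) (by fun_prop) (by fun_prop)
    (by rw [← ofReal_integral_eq_lintegral_ofReal K.int (ae_of_all _ K.nonneg), K.one]; simp)
    hh ?_ ?_
  · refine le_trans (lintegral_mono fun x => ?_) key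
    dsimp only
    rw [K.profile_shift hZ hZM H c u x hh]
    exact (enorm_add_le _ _).trans (add_le_add le_rfl (hn _ _ _ hh))
  · refine ((lintegral_mono hbd).trans_lt ?_).ne
    rw [setLIntegral_const]
    exact ENNReal.mul_lt_top ENNReal.ofReal_lt_top (by simp)
  · have h1 : ∀ᵐ v ∂(volume.restrict (Ioo 0 h)), Z (u + v) = H (u + v) +
        ∫ y, k y * Z (u + v - y) := by
      rw [ae_restrict_iff' measurableSet_Ioo] at hren ⊢
      have := (measurePreserving_add_left volume u).quasiMeasurePreserving.ae hren
      filter_upwards [this] with v hv hvm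
      exact hv ⟨by linarith [hvm.1], by linarith [hvm.2]⟩
    filter_upwards [h1, ae_restrict_mem measurableSet_Ioo] with v hv hvm
    have h2 : ∫ y, k y * Z (u + v - y) = ∫ s in Ioi 0, k (0 + s) * Z (u + v - s) := by
      rw [← integral_indicator measurableSet_Ioi]
      refine integral_congr_ae ?_
      have : ∀ᵐ y : ℝ, y ≠ 0 := by simp [ae_iff]
      filter_upwards [this] with y hy
      rcases lt_or_gt_of_ne hy with h | h
      · rw [indicator_of_notMem (by simpa using h.le), K.neg y h, zero_mul]
      · rw [indicator_of_mem (mem_Ioi.2 h), zero_add]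
    have h3 : Z (u + v) - c = profile k Z H (u + v) 0 - c * tailInt k 0 := by
      rw [profile, ← h2, K.tailInt_zero, hv, add_zero, mul_one]
    rw [h3, K.profile_shift hZ hZM H c u 0 hvm.1.le, zero_add]
    exact (enorm_add_le _ _).trans (add_le_add le_rfl (hn _ _ _ hvm.1.le))

end

end PSQ

namespace PSQ

/-- data of a renewal equation on `[0, A]` with a conserved workload -/
structure RenewalData (k Z H : ℝ → ℝ) (M c A : ℝ) : Prop where
  meas : Measurable Z
  nonneg : ∀ x, 0 ≤ Z x
  le : ∀ x, Z x ≤ M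
  neg : ∀ x < 0, Z x = 0
  cont : ContinuousOn Z (Icc 0 A)
  anti : Antitone H
  Hnonneg : ∀ x, 0 ≤ H x
  Hint : IntegrableOn H (Ioi 0)
  work : ∀ u ∈ Icc 0 A, ∫ x in Ioi 0, H x =
    (∫ x in Ioi u, H x) + ∫ s in Ioi 0, tailInt k s * Z (u - s)
  mean : c * ∫ x in Ioi 0, tailInt k x = ∫ x in Ioi 0, H x

variable {k Z H : ℝ → ℝ} {α M c A : ℝ}

theorem RenewalData.abs_le (D : RenewalData k Z H M c A) (x : ℝ) : |Z x| ≤ M := by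
  rw [abs_of_nonneg (D.nonneg x)]; exact D.le x

theorem RenewalData.intervalIntegrable (D : RenewalData k Z H M c A) (a b : ℝ) :
    IntervalIntegrable Z volume a b := by
  rw [intervalIntegrable_iff]
  exact Measure.integrableOn_of_bounded (M := M) (by simp) D.meas.aestronglyMeasurable
    (ae_of_all _ fun x => D.abs_le x)

theorem RenewalKernel.intervalIntegral_shift (K : RenewalKernel k α) {s u : ℝ} (hs : 0 ≤ s)
    (hsu : s ≤ u) : ∫ w in Ioc 0 u, k (w - s) = 1 - tailInt k (u - s) := by
  have hi : ∀ a b, IntervalIntegrable k volume a b := fun a b => K.int.intervalIntegrable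
  rw [← intervalIntegral.integral_of_le (hs.trans hsu),
    intervalIntegral.integral_comp_sub_right, zero_sub,
    ← intervalIntegral.integral_add_adjacent_intervals (hi (-s) 0) (hi 0 (u - s))]
  have h1 : ∫ w in (-s)..0, k w = 0 := by
    rw [intervalIntegral.integral_of_le (by linarith), integral_Ioc_eq_integral_Ioo]
    exact setIntegral_eq_zero_of_forall_eq_zero fun x hx => K.neg x hx.2
  have hsu' : 0 ≤ u - s := sub_nonneg.2 hsu
  have h2 : tailInt k 0 = (∫ w in (0 : ℝ)..(u - s), k w) + tailInt k (u - s) := by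
    rw [intervalIntegral.integral_of_le hsu', tailInt, tailInt,
      ← setIntegral_union (Ioc_disjoint_Ioi le_rfl) measurableSet_Ioi
      K.int.integrableOn K.int.integrableOn, Ioc_union_Ioi_eq_Ioi hsu']
  rw [K.tailInt_zero] at h2
  rw [h1]; linarith

theorem RenewalKernel.integral_convolution (K : RenewalKernel k α)
    (D : RenewalData k Z H M c A) {u : ℝ} (hu : 0 ≤ u) :
    ∫ w in (0 : ℝ)..u, ∫ y, k y * Z (w - y) =
      (∫ s in (0 : ℝ)..u, Z s) - ∫ s in Ioi 0, tailInt k s * Z (u - s) := by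
  have hkm := K.meas
  have hZm := D.meas
  have htm : Measurable (tailInt k) := K.tailInt_antitone.measurable
  have h1 : ∀ w ∈ Ioc 0 u, ∫ y, k y * Z (w - y) = ∫ s in Icc 0 u, k (w - s) * Z s := by
    intro w hw
    rw [setIntegral_eq_integral_of_forall_compl_eq_zero,
      ← integral_sub_left_eq_self (fun y => k y * Z (w - y)) volume w]
    · simp
    · intro s hs
      by_cases h0 : s < 0
      · rw [D.neg s h0, mul_zero]
      · rw [K.neg, zero_mul]
        have : u < s := by by_contra hh; exact hs ⟨not_lt.1 h0, not_lt.1 hh⟩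
        linarith [hw.2]
  have hprod : Integrable (fun p : ℝ × ℝ => k (p.1 - p.2) * Z p.2)
      ((volume.restrict (Ioc 0 u)).prod (volume.restrict (Icc 0 u))) := by
    refine Integrable.of_bound (Measurable.aestronglyMeasurable (by fun_prop)) (α * M)
      (ae_of_all _ fun p => ?_)
    rw [norm_mul, Real.norm_of_nonneg (K.nonneg _)]
    exact mul_le_mul (K.le _) (D.abs_le _) (norm_nonneg _) ((K.nonneg 0).trans (K.le 0))
  rw [intervalIntegral.integral_of_le hu, setIntegral_congr_fun measurableSet_Ioc h1,
    integral_integral_swap (f := fun w s => k (w - s) * Z s) hprod]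
  have h2 : ∫ s in Icc 0 u, ∫ w in Ioc 0 u, k (w - s) * Z s =
      ∫ s in (0 : ℝ)..u, (Z s - tailInt k (u - s) * Z s) := by
    rw [intervalIntegral.integral_of_le hu, ← integral_Icc_eq_integral_Ioc]
    refine setIntegral_congr_fun measurableSet_Icc fun s hs => ?_
    rw [integral_mul_const, K.intervalIntegral_shift hs.1 hs.2]
    ring
  have hti : IntervalIntegrable (fun s => tailInt k (u - s) * Z s) volume 0 u := by
    rw [intervalIntegrable_iff, uIoc_of_le hu]
    refine Measure.integrableOn_of_bounded (M := 1 * M) (by simp)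
      (Measurable.aestronglyMeasurable (by fun_prop)) ?_
    filter_upwards [ae_restrict_mem measurableSet_Ioc] with s hs
    rw [norm_mul, Real.norm_of_nonneg (K.tailInt_nonneg _)]
    exact mul_le_mul (K.tailInt_le_one (by linarith [hs.2])) (D.abs_le _) (norm_nonneg _)
      zero_le_one
  rw [h2, intervalIntegral.integral_sub (D.intervalIntegrable _ _) hti]
  congr 1
  have h3 := intervalIntegral.integral_comp_sub_left (a := 0) (b := u)
    (fun s => tailInt k s * Z (u - s)) u
  simp only [sub_sub_cancel, sub_self, sub_zero] at h3
  rw [h3, intervalIntegral.integral_of_le hu, ← Ioc_union_Ioi_eq_Ioi hu]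
  refine (setIntegral_eq_of_subset_of_forall_sdiff_eq_zero
    (measurableSet_Ioc.union measurableSet_Ioi) subset_union_left fun s hs => ?_).symm
  have : u < s := by
    rcases hs.1 with h | h
    · exact absurd h hs.2
    · exact h
  rw [D.neg _ (by linarith), mul_zero]

theorem RenewalKernel.renewal_of_work (K : RenewalKernel k α)
    (D : RenewalData k Z H M c A) (hA : 0 ≤ A) :
    ∀ᵐ w ∂(volume.restrict (Ioo 0 A)), Z w = H w + ∫ y, k y * Z (w - y) := by
  have hkm := K.meas
  have hZm := D.meas
  have hHi : ∀ a b, IntervalIntegrable H volume a b := fun a b =>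
    (D.anti.antitoneOn _).intervalIntegrable
  have hcm : Measurable fun w => ∫ y, k y * Z (w - y) := by
    refine StronglyMeasurable.measurable
      (StronglyMeasurable.integral_prod_right (f := fun w y => k y * Z (w - y)) ?_)
    exact Measurable.stronglyMeasurable (by fun_prop)
  have hci : ∀ a b, IntervalIntegrable (fun w => ∫ y, k y * Z (w - y)) volume a b := by
    intro a b
    rw [intervalIntegrable_iff]
    refine Measure.integrableOn_of_bounded (M := M) (by simp) hcm.aestronglyMeasurable
      (ae_of_all _ fun x => ?_)
    calc ‖∫ y, k y * Z (x - y)‖ ≤ ∫ y, M * k y := by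
          refine norm_integral_le_of_norm_le (K.int.const_mul M) (ae_of_all _ fun y => ?_)
          rw [norm_mul, Real.norm_of_nonneg (K.nonneg y), mul_comm]
          exact mul_le_mul_of_nonneg_right (D.abs_le _) (K.nonneg y)
      _ = M := by rw [integral_const_mul, K.one, mul_one]
  set f : ℝ → ℝ := fun w => Z w - (H w + ∫ y, k y * Z (w - y)) with hf
  have hfi : ∀ a b, IntervalIntegrable f volume a b := fun a b =>
    (D.intervalIntegrable a b).sub ((hHi a b).add (hci a b))
  have hzero : ∀ u ∈ Icc 0 A, ∫ w in (0 : ℝ)..u, f w = 0 := by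
    intro u hu
    rw [intervalIntegral.integral_sub (D.intervalIntegrable _ _) ((hHi _ _).add (hci _ _)),
      intervalIntegral.integral_add (hHi _ _) (hci _ _), K.integral_convolution D hu.1]
    have h1 : ∫ x in Ioi 0, H x = (∫ x in (0 : ℝ)..u, H x) + ∫ x in Ioi u, H x := by
      rw [intervalIntegral.integral_of_le hu.1, ← setIntegral_union (Ioc_disjoint_Ioi le_rfl)
        measurableSet_Ioi (D.Hint.mono_set Ioc_subset_Ioi_self)
        (D.Hint.mono_set (Ioi_subset_Ioi hu.1)), Ioc_union_Ioi_eq_Ioi hu.1]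
    have := D.work u hu
    linarith
  rw [ae_restrict_iff' measurableSet_Ioo]
  have hd := (hfi 0 A).ae_hasDerivAt_integral
  filter_upwards [hd] with w hw hwm
  have h2 := hw (by rw [uIcc_of_le hA]; exact Ioo_subset_Icc_self hwm) 0 (by simp)
  have h3 : HasDerivAt (fun x => ∫ t in (0 : ℝ)..x, f t) 0 w := by
    refine (hasDerivAt_const w (0 : ℝ)).congr_of_eventuallyEq ?_
    filter_upwards [isOpen_Ioo.mem_nhds hwm] with x hx
    exact hzero x (Ioo_subset_Icc_self hx)
  have := h2.unique h3
  simp only [hf] at this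
  linarith

end PSQ

namespace PSQ
variable {k Z H : ℝ → ℝ} {α M c A : ℝ}

theorem RenewalKernel.profile_sub_le (K : RenewalKernel k α) (D : RenewalData k Z H M c A)
    (hkb : IntegrableOn (tailInt k) (Ioi 0)) {u b : ℝ} (hu : u ∈ Icc 0 A) (hb : 0 ≤ b) :
    ∫⁻ x in Ioi 0, ‖profile k Z H u x - c * tailInt k x‖ₑ ≤
      2 * (ENNReal.ofReal (∫ x in Ioi u, H x) + ((∫⁻ s in Ioo 0 b, ‖Z u - Z (u - s)‖ₑ) +
        ENNReal.ofReal (M * ∫ s in Ioi b, tailInt k s))) := by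
  have hkm := K.meas
  have hZm := D.meas
  have hHm := D.anti.measurable
  have htm : Measurable (tailInt k) := K.tailInt_antitone.measurable
  have hM : 0 ≤ M := (D.nonneg 0).trans (D.le 0)
  set P : ℝ≥0∞ := ∫⁻ s in Ioi 0, ENNReal.ofReal (tailInt k s) * ‖Z (u - s) - Z u‖ₑ with hP
  set Q : ℝ≥0∞ := ENNReal.ofReal (∫ x in Ioi u, H x) with hQ
  have hdiff : ∀ s, ‖Z (u - s) - Z u‖ₑ ≤ ENNReal.ofReal M := fun s => by
    rw [Real.enorm_eq_ofReal_abs]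
    refine ENNReal.ofReal_le_ofReal (abs_le.2 ⟨?_, ?_⟩)
    · linarith [D.nonneg (u - s), D.le u]
    · linarith [D.nonneg u, D.le (u - s)]
  have hPle : P ≤ (∫⁻ s in Ioo 0 b, ‖Z u - Z (u - s)‖ₑ) +
      ENNReal.ofReal (M * ∫ s in Ioi b, tailInt k s) := by
    rw [hP, ← Ioc_union_Ioi_eq_Ioi hb, lintegral_union measurableSet_Ioi
      (Ioc_disjoint_Ioi le_rfl), ← restrict_Ioo_eq_restrict_Ioc]
    refine add_le_add (setLIntegral_mono' measurableSet_Ioo fun s hs => ?_) ?_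
    · rw [enorm_sub_rev]
      refine mul_le_of_le_one_left' ?_
      rw [← ENNReal.ofReal_one]
      exact ENNReal.ofReal_le_ofReal (K.tailInt_le_one hs.1.le)
    · rw [ENNReal.ofReal_mul hM, ofReal_integral_eq_lintegral_ofReal
        (hkb.mono_set (Ioi_subset_Ioi hb)) (ae_of_all _ K.tailInt_nonneg),
        ← lintegral_const_mul' _ _ ENNReal.ofReal_ne_top]
      refine lintegral_mono fun s => ?_
      rw [mul_comm]
      exact mul_le_mul_left (hdiff s) _
  have hprof : ∀ x, profile k Z H u x - Z u * tailInt k x =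
      H (u + x) + ∫ s in Ioi 0, k (x + s) * (Z (u - s) - Z u) := by
    intro x
    have : ∫ s in Ioi 0, k (x + s) * (Z (u - s) - Z u) =
        (∫ s in Ioi 0, k (x + s) * Z (u - s)) - Z u * tailInt k x := by
      rw [tailInt_eq_shift, ← integral_const_mul, ← integral_sub
        (K.integrable_mul hZm D.abs_le x u).integrableOn
        ((K.int.comp_add_left x).integrableOn.const_mul _)]
      congr 1 with s
      ring
    rw [this, profile]; ring
  have hfst : ∫⁻ x in Ioi 0, ‖profile k Z H u x - Z u * tailInt k x‖ₑ ≤ Q + P := by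
    calc ∫⁻ x in Ioi 0, ‖profile k Z H u x - Z u * tailInt k x‖ₑ
        ≤ ∫⁻ x in Ioi 0, (ENNReal.ofReal (H (u + x)) +
            ∫⁻ s in Ioi 0, ENNReal.ofReal (k (x + s)) * ‖Z (u - s) - Z u‖ₑ) := by
          refine lintegral_mono fun x => ?_
          rw [hprof]
          refine (enorm_add_le _ _).trans (add_le_add ?_ ?_)
          · rw [Real.enorm_eq_ofReal (D.Hnonneg _)]
          · refine (enorm_integral_le_lintegral_enorm _).trans (le_of_eq ?_)
            refine lintegral_congr fun v => ?_
            rw [enorm_mul, Real.enorm_eq_ofReal (K.nonneg _)]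
      _ = Q + P := by
          rw [lintegral_add_left (by fun_prop)]
          congr 1
          · have h := setIntegral_Ioi_comp_add H u 0
            rw [add_zero] at h
            rw [hQ, ← h, ofReal_integral_eq_lintegral_ofReal ?_
              (ae_of_all _ fun _ => D.Hnonneg _)]
            have hi := (D.Hint.mono_set (Ioi_subset_Ioi hu.1)).integrable_indicator
              measurableSet_Ioi
            refine (integrable_indicator_iff measurableSet_Ioi).1
              ((hi.comp_add_left u).congr (ae_of_all _ fun s => ?_))
            by_cases hs : s ∈ Ioi (0 : ℝ)
            · dsimp only
              rw [indicator_of_mem hs, indicator_of_mem]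
              simpa using hs
            · dsimp only
              rw [indicator_of_notMem hs, indicator_of_notMem]
              simpa using hs
          · rw [lintegral_lintegral_swap (Measurable.aemeasurable (by fun_prop))]
            refine lintegral_congr fun s => ?_
            rw [lintegral_mul_const _ (by fun_prop), K.lintegral_shift]
  have hsnd : ∫⁻ x in Ioi 0, ‖Z u * tailInt k x - c * tailInt k x‖ₑ ≤ Q + P := by
    have e : (∫ x in Ioi 0, tailInt k x) * (c - Z u) =
        (∫ x in Ioi u, H x) + ∫ s in Ioi 0, tailInt k s * (Z (u - s) - Z u) := by
      have : ∫ s in Ioi 0, tailInt k s * (Z (u - s) - Z u) =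
          (∫ s in Ioi 0, tailInt k s * Z (u - s)) - Z u * ∫ x in Ioi 0, tailInt k x := by
        have hi : IntegrableOn (fun s => tailInt k s * Z (u - s)) (Ioi 0) :=
          hkb.mul_bdd (c := M)
            (hZm.comp (measurable_const.sub measurable_id)).aestronglyMeasurable
            (ae_of_all _ fun _ => D.abs_le _)
        rw [← integral_const_mul, ← integral_sub hi (hkb.const_mul _)]
        congr 1 with s
        ring
      have h1 := D.work u hu
      have h2 := D.mean
      rw [this]; linarith
    calc ∫⁻ x in Ioi 0, ‖Z u * tailInt k x - c * tailInt k x‖ₑ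
        = ‖(∫ x in Ioi 0, tailInt k x) * (c - Z u)‖ₑ := by
          rw [enorm_mul, Real.enorm_eq_ofReal (integral_nonneg K.tailInt_nonneg),
            ofReal_integral_eq_lintegral_ofReal hkb (ae_of_all _ K.tailInt_nonneg),
            ← lintegral_mul_const _ (by fun_prop)]
          refine lintegral_congr fun x => ?_
          rw [← sub_mul, enorm_mul, enorm_sub_rev, mul_comm,
            Real.enorm_eq_ofReal (K.tailInt_nonneg x)]
      _ ≤ Q + P := by
          rw [e]
          refine (enorm_add_le _ _).trans (add_le_add ?_ ?_)
          · rw [Real.enorm_eq_ofReal (integral_nonneg D.Hnonneg)]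
          · refine (enorm_integral_le_lintegral_enorm _).trans (le_of_eq ?_)
            refine lintegral_congr fun v => ?_
            rw [enorm_mul, Real.enorm_eq_ofReal (K.tailInt_nonneg _)]
  have hpm : Measurable fun x => profile k Z H u x := by
    have : StronglyMeasurable fun x => ∫ s in Ioi 0, k (x + s) * Z (u - s) := by
      refine StronglyMeasurable.integral_prod_right (f := fun x s => k (x + s) * Z (u - s)) ?_
      exact Measurable.stronglyMeasurable (by fun_prop)
    have := this.measurable
    unfold profile
    fun_prop
  calc ∫⁻ x in Ioi 0, ‖profile k Z H u x - c * tailInt k x‖ₑ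
      ≤ ∫⁻ x in Ioi 0, (‖profile k Z H u x - Z u * tailInt k x‖ₑ +
          ‖Z u * tailInt k x - c * tailInt k x‖ₑ) := by
        refine lintegral_mono fun x => ?_
        rw [← sub_add_sub_cancel (profile k Z H u x) (Z u * tailInt k x)]
        exact enorm_add_le _ _
    _ ≤ (Q + P) + (Q + P) := by
        rw [lintegral_add_left (by fun_prop)]
        exact add_le_add hfst hsnd
    _ ≤ _ := by
        rw [← two_mul]
        exact mul_le_mul_right (add_le_add le_rfl hPle) _

theorem RenewalKernel.exists_relaxation_time (K : RenewalKernel k α) {δ : ℝ} (hδ : 0 < δ)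
    (hkδ : 0 < k δ) (hkb : IntegrableOn (tailInt k) (Ioi 0)) {τ : ℝ → ℝ}
    (hτ : Tendsto τ atTop (nhds 0)) (hM : 0 ≤ M) {ε : ℝ} (hε : 0 < ε) :
    ∃ A₀ : ℝ, 0 < A₀ ∧ ∀ (Z H : ℝ → ℝ) (c A : ℝ), RenewalData k Z H M c A →
      ∫ x in Ioi 0, H x ≤ M → (∀ b, 0 < b → ∫ x in Ioi b, H x ≤ τ b) →
      ∀ u ∈ Icc A₀ A, ∫⁻ x in Ioi 0, ‖profile k Z H u x - c * tailInt k x‖ₑ ≤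
        ENNReal.ofReal ε := by
  have htend : Tendsto (fun b => M * ∫ s in Ioi b, tailInt k s) atTop (nhds 0) := by
    have h := (tendsto_setIntegral_of_antitone (μ := volume) (f := tailInt k)
      (s := fun b : ℝ => Ioi b) (fun _ => measurableSet_Ioi)
      (fun a b h => Ioi_subset_Ioi h) ⟨0, hkb⟩).const_mul M
    have : ⋂ b : ℝ, Ioi b = ∅ := by
      ext x; simpa using ⟨x, le_rfl⟩
    simpa [this] using h
  obtain ⟨b₁, hb₁⟩ := eventually_atTop.1 ((htend.eventually (ge_mem_nhds
    (show (0 : ℝ) < ε / 6 by positivity))).and (hτ.eventually (ge_mem_nhds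
    (show (0 : ℝ) < ε / 6 by positivity))))
  obtain ⟨n, hn⟩ := exists_nat_gt (max 0 (b₁ / δ))
  have hn0 : (0 : ℝ) < n := (le_max_left _ _).trans_lt hn
  have hnb : b₁ ≤ n * δ := ((div_lt_iff₀ hδ).1 ((le_max_right _ _).trans_lt hn)).le
  obtain ⟨A₀, hA₀, hwin⟩ := exists_nearly_constant_window K hδ hkδ (n := n)
    (by exact_mod_cast hn0) (C := 2 * M * M) (by positivity) (show (0 : ℝ) < ε / 6 by positivity)
  have hnδ : 0 < n * δ := by positivity
  refine ⟨A₀, hnδ.trans hA₀, fun Z H c A D hHM htail u hu => ?_⟩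
  have hA₀A : A₀ ≤ A := hu.1.trans hu.2
  have hA0 : 0 ≤ A := by linarith
  have hren := K.renewal_of_work D hA0
  have hen := energy_estimate K D.meas D.nonneg D.le D.neg (fun x _ => D.Hnonneg x) D.Hint
    (ae_restrict_of_ae_restrict_of_subset (Ioo_subset_Ioo_right hA₀A) hren)
  obtain ⟨u₀, hu₀, hw⟩ := hwin Z D.meas (hen.trans (ENNReal.ofReal_le_ofReal (by gcongr)))
  have hu₀A : u₀ ∈ Icc 0 A := ⟨by linarith [hu₀.1], by linarith [hu₀.2]⟩
  have hcon := K.profile_contraction D.meas D.abs_le D.anti.measurable c (h := u - u₀)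
    hu₀A.1 (by linarith [hu₀.2, hu.1]) (by linarith [hu.2]) hren
  rw [add_sub_cancel] at hcon
  refine hcon.trans ((K.profile_sub_le D hkb hu₀A hnδ.le).trans ?_)
  have e1 : ∫ x in Ioi u₀, H x ≤ ε / 6 :=
    (htail u₀ (hnδ.trans hu₀.1)).trans (hb₁ u₀ (hnb.trans hu₀.1.le)).2
  calc 2 * (ENNReal.ofReal (∫ x in Ioi u₀, H x) + ((∫⁻ s in Ioo 0 (n * δ), ‖Z u₀ - Z (u₀ - s)‖ₑ) +
        ENNReal.ofReal (M * ∫ s in Ioi (n * δ), tailInt k s)))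
      ≤ 2 * (ENNReal.ofReal (ε / 6) + (ENNReal.ofReal (ε / 6) + ENNReal.ofReal (ε / 6))) :=
        mul_le_mul_right (add_le_add (ENNReal.ofReal_le_ofReal e1) (add_le_add hw
          (ENNReal.ofReal_le_ofReal (hb₁ _ hnb).1))) _
    _ = ENNReal.ofReal ε := by
        rw [← ENNReal.ofReal_add (by positivity) (by positivity),
          ← ENNReal.ofReal_add (by positivity) (by positivity), ← ENNReal.ofReal_ofNat 2,
          ← ENNReal.ofReal_mul (by positivity)]
        congr 1; ring

end PSQ

namespace PSQ
variable {k Z H : ℝ → ℝ} {α M c A : ℝ}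

theorem mul_le_of_lintegral_enorm_le {f : ℝ → ℝ} {a h ε : ℝ} (hh : 0 < h) (hε : 0 ≤ ε)
    (hf : ∀ x ∈ Ioo 0 h, a ≤ |f x|) (hi : ∫⁻ x in Ioi 0, ‖f x‖ₑ ≤ ENNReal.ofReal ε) :
    a * h ≤ ε := by
  rcases le_total a 0 with ha | ha
  · exact (mul_nonpos_of_nonpos_of_nonneg ha hh.le).trans hε
  rw [← ENNReal.ofReal_le_ofReal_iff hε]
  calc ENNReal.ofReal (a * h) = ∫⁻ x in Ioo 0 h, ENNReal.ofReal a := by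
        rw [setLIntegral_const, Real.volume_Ioo, sub_zero, ENNReal.ofReal_mul ha]
    _ ≤ ∫⁻ x in Ioo 0 h, ‖f x‖ₑ := setLIntegral_mono' measurableSet_Ioo fun x hx => by
        rw [Real.enorm_eq_ofReal_abs]
        exact ENNReal.ofReal_le_ofReal (hf x hx)
    _ ≤ ∫⁻ x in Ioi 0, ‖f x‖ₑ := lintegral_mono_set Ioo_subset_Ioi_self
    _ ≤ _ := hi

theorem RenewalKernel.one_sub_le_tailInt (K : RenewalKernel k α) {x : ℝ} (hx : 0 ≤ x) :
    1 - α * x ≤ tailInt k x := by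
  have h := K.intervalIntegral_shift le_rfl hx
  simp only [sub_zero] at h
  have h2 : ∫ w in Ioc 0 x, k w ≤ α * x := by
    calc ∫ w in Ioc 0 x, k w ≤ ∫ w in Ioc 0 x, α :=
          integral_mono K.int.integrableOn (by simp) fun w => K.le w
      _ = α * x := by simp [hx, mul_comm]
  linarith

theorem RenewalKernel.profile_antitoneOn (K : RenewalKernel k α) (D : RenewalData k Z H M c A)
    (u : ℝ) : AntitoneOn (profile k Z H u) (Ici 0) := by
  intro x hx y _ hxy
  refine add_le_add (D.anti (by linarith)) (setIntegral_mono_on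
    (K.integrable_mul D.meas D.abs_le _ _).integrableOn
    (K.integrable_mul D.meas D.abs_le _ _).integrableOn measurableSet_Ioi fun s hs => ?_)
  have h1 : 0 ≤ x + s := add_nonneg hx (mem_Ioi.1 hs).le
  exact mul_le_mul_of_nonneg_right (K.anti h1 (h1.trans (by gcongr) : (0 : ℝ) ≤ y + s)
    (by gcongr)) (D.nonneg _)

theorem RenewalKernel.abs_sub_le_of_relaxed (K : RenewalKernel k α)
    (D : RenewalData k Z H M c A) (hc : 0 ≤ c) {A₀ ε h : ℝ} (hA₀ : 0 < A₀) (hε : 0 ≤ ε)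
    (hh : 0 < h) (hA : A₀ + h < A)
    (hrel : ∀ u ∈ Icc A₀ A, ∫⁻ x in Ioi 0, ‖profile k Z H u x - c * tailInt k x‖ₑ ≤
        ENNReal.ofReal ε) :
    ∀ u ∈ Icc (A₀ + h) A, |Z u - c| ≤ ε / h + α * h * (M + c) := by
  have hM : 0 ≤ M := (D.nonneg 0).trans (D.le 0)
  have hα : 0 ≤ α := (K.nonneg 0).trans (K.le 0)
  have hgood : ∀ u ∈ Icc (A₀ + h) A, |profile k Z H u 0 - c| ≤ ε / h + α * h * (M + c) := by
    intro u hu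
    have hup : (profile k Z H (u - h) h - c) * h ≤ ε := by
      refine mul_le_of_lintegral_enorm_le hh hε (fun x hx => ?_)
        (hrel (u - h) ⟨by linarith [hu.1], by linarith [hu.2]⟩)
      refine le_trans (sub_le_sub (K.profile_antitoneOn D (u - h) hx.1.le hh.le hx.2.le) ?_)
        (le_abs_self _)
      exact mul_le_of_le_one_right hc (K.tailInt_le_one hx.1.le)
    have hlo : (c * (1 - α * h) - profile k Z H u 0) * h ≤ ε := by
      refine mul_le_of_lintegral_enorm_le hh hε (fun x hx => ?_)
        (hrel u ⟨by linarith [hu.1], hu.2⟩)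
      rw [abs_sub_comm]
      refine le_trans (sub_le_sub ?_ (K.profile_antitoneOn D u self_mem_Ici hx.1.le hx.1.le))
        (le_abs_self _)
      refine mul_le_mul_of_nonneg_left (le_trans ?_ (K.one_sub_le_tailInt hx.1.le)) hc
      nlinarith [hx.2]
    have hsh := K.profile_shift D.meas D.abs_le H 0 (u - h) 0 hh.le
    simp only [sub_add_cancel, zero_mul, sub_zero, zero_add] at hsh
    have hint : ∫ v in Ioo 0 h, k (h - v) * Z (u - h + v) ≤ α * M * h := by
      calc ∫ v in Ioo 0 h, k (h - v) * Z (u - h + v) ≤ ∫ v in Ioo 0 h, α * M := by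
            refine integral_mono ?_ (integrable_const _) fun v =>
              mul_le_mul (K.le _) (D.le _) (D.nonneg _) hα
            have := (K.integrable_mul D.meas D.abs_le 0 u).comp_sub_left h
            refine (this.congr (ae_of_all _ fun v => ?_)).integrableOn
            beta_reduce
            rw [zero_add, show u - (h - v) = u - h + v by ring]
        _ = α * M * h := by simp [hh.le, mul_comm]
    rw [← le_div_iff₀ hh] at hup hlo
    have h1 : 0 ≤ α * h * M := by positivity
    have h2 : 0 ≤ α * h * c := by positivity
    rw [abs_le]
    constructor <;> nlinarith
  have hren := K.renewal_of_work D (by linarith)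
  have hcont : ContinuousOn (fun u => max |Z u - c| (ε / h + α * h * (M + c)))
      (Icc (A₀ + h) A) :=
    (((D.cont.mono (Icc_subset_Icc_left (by linarith))).sub continuousOn_const).abs).sup
      continuousOn_const
  have hae : (fun u => max |Z u - c| (ε / h + α * h * (M + c)))
      =ᵐ[volume.restrict (Icc (A₀ + h) A)] fun _ => ε / h + α * h * (M + c) := by
    have h1 : Ioo (A₀ + h) A =ᵐ[volume] Icc (A₀ + h) A := Ioo_ae_eq_Icc
    rw [← Measure.restrict_congr_set h1]
    filter_upwards [ae_restrict_of_ae_restrict_of_subset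
      (Ioo_subset_Ioo_left (by linarith : 0 ≤ A₀ + h)) hren, ae_restrict_mem measurableSet_Ioo]
      with u hu hum
    refine max_eq_right ?_
    have : Z u = profile k Z H u 0 := by
      rw [hu, profile, add_zero, ← integral_indicator measurableSet_Ioi]
      congr 1
      refine integral_congr_ae ?_
      have : ∀ᵐ y : ℝ, y ≠ 0 := by simp [ae_iff]
      filter_upwards [this] with y hy
      rcases lt_or_gt_of_ne hy with h | h
      · rw [indicator_of_notMem (by simpa using h.le), K.neg y h, zero_mul]
      · rw [indicator_of_mem (mem_Ioi.2 h), zero_add]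
    rw [this]
    exact hgood u (Ioo_subset_Icc_self hum)
  intro u hu
  have := Measure.eqOn_Icc_of_ae_eq volume hA.ne hae hcont continuousOn_const hu
  exact max_eq_right_iff.1 this

end PSQ

namespace PSQ

theorem mass_eq_pair (ζ : Measure ℝ) : mass ζ = pair (fun _ => 1) ζ := by
  simp [mass, pair, Measure.real]

theorem mass_nonneg (ζ : Measure ℝ) : 0 ≤ mass ζ := ENNReal.toReal_nonneg

theorem integrable_dplus (f : ℝ → ℝ) (x : ℝ) : Integrable f (dplus x) := by
  unfold dplus
  split_ifs
  · exact integrable_dirac (by simp)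
  · exact integrable_zero_measure

theorem integral_dplus_pos (f : ℝ → ℝ) (x : ℝ) :
    ∫ y, f y ∂(dplus (pos x)) = (Ioi 0).indicator f x := by
  unfold dplus pos
  by_cases hx : 0 < x
  · rw [if_pos (lt_max_of_lt_left hx), integral_dirac, max_eq_left hx.le,
      indicator_of_mem (mem_Ioi.2 hx)]
  · rw [if_neg (by simpa using hx), indicator_of_notMem (by simpa using hx)]
    simp

instance isFiniteMeasure_dplus (x : ℝ) : IsFiniteMeasure (dplus x) := by
  unfold dplus; split_ifs <;> infer_instance

theorem dplus_Iic (x : ℝ) : dplus x (Iic 0) = 0 := by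
  unfold dplus
  split_ifs with h
  · simpa using h
  · simp

section queue

variable {U v : ℕ → ℝ} {Z0 : ℕ} {vt : ℕ → ℝ} {μ : ℝ → Measure ℝ} {S : ℝ → ℝ}

theorem QueueHyps.le_Ecount_iff (hQ : QueueHyps U v Z0 vt) {t : ℝ} (ht : 0 ≤ t) (i : ℕ) :
    i ≤ Ecount U t ↔ U i ≤ t := by
  obtain ⟨h0, hmono, -, htop, -⟩ := hQ
  have hb : BddAbove {i : ℕ | U i ≤ t} := by
    obtain ⟨N, hN⟩ := eventually_atTop.1 (htop.eventually_gt_atTop t)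
    refine ⟨N, fun i hi => ?_⟩
    by_contra! h
    exact absurd (hN i h.le) (not_lt.2 hi)
  constructor
  · intro h
    exact (hmono h).trans (Nat.sSup_mem (s := {i : ℕ | U i ≤ t}) ⟨0, by simpa [h0] using ht⟩ hb)
  · intro h
    exact le_csSup hb h

theorem QueueHyps.Ecount_mono (hQ : QueueHyps U v Z0 vt) {s t : ℝ} (hs : 0 ≤ s) (hst : s ≤ t) :
    Ecount U s ≤ Ecount U t :=
  (hQ.le_Ecount_iff (hs.trans hst) _).2 (((hQ.le_Ecount_iff hs _).1 le_rfl).trans hst)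

theorem QueueHyps.nonneg (hQ : QueueHyps U v Z0 vt) (i : ℕ) : 0 ≤ U i :=
  hQ.1 ▸ hQ.2.1 (Nat.zero_le i)

theorem StateEqns.integrable (hS : StateEqns U v Z0 vt μ S) {t : ℝ} (ht : 0 ≤ t) (f : ℝ → ℝ) :
    Integrable f (μ t) := by
  rw [(hS t ht).2]
  exact (integrable_finsetSum_measure.2 fun _ _ => integrable_dplus _ _).add_measure
    (integrable_finsetSum_measure.2 fun _ _ => integrable_dplus _ _)

theorem StateEqns.isFiniteMeasure (hS : StateEqns U v Z0 vt μ S) {t : ℝ} (ht : 0 ≤ t) :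
    IsFiniteMeasure (μ t) := by
  rw [(hS t ht).2]
  infer_instance

theorem StateEqns.Iic_zero (hS : StateEqns U v Z0 vt μ S) {t : ℝ} (ht : 0 ≤ t) :
    μ t (Iic 0) = 0 := by
  rw [(hS t ht).2]
  simp [dplus_Iic]

theorem StateEqns.pair_eq (hS : StateEqns U v Z0 vt μ S) {t : ℝ} (ht : 0 ≤ t) (G : ℝ → ℝ) :
    pair G (μ t) = ∑ j ∈ Finset.range Z0, (Ioi 0).indicator G (vt (j + 1) - S t) +
      ∑ i ∈ Finset.range (Ecount U t), (Ioi 0).indicator G (v (i + 1) - S t + S (U (i + 1))) := by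
  rw [pair, (hS t ht).2, integral_add_measure
    (integrable_finsetSum_measure.2 fun _ _ => integrable_dplus _ _)
    (integrable_finsetSum_measure.2 fun _ _ => integrable_dplus _ _),
    integral_finsetSum_measure fun _ _ => integrable_dplus _ _,
    integral_finsetSum_measure fun _ _ => integrable_dplus _ _]
  simp_rw [integral_dplus_pos]

theorem StateEqns.inv_mass_mem (hS : StateEqns U v Z0 vt μ S) {t : ℝ} (ht : 0 ≤ t) :
    (mass (μ t))⁻¹ ∈ Icc (0 : ℝ) 1 := by
  have hind : ∀ x : ℝ, (Ioi (0 : ℝ)).indicator (fun _ => (1 : ℝ)) x =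
      ((Ioi (0 : ℝ)).indicator (fun _ => (1 : ℕ)) x : ℕ) := fun x => by
    by_cases hx : x ∈ Ioi (0 : ℝ) <;> simp [hx]
  have : ∃ n : ℕ, mass (μ t) = n := by
    rw [mass_eq_pair, hS.pair_eq ht]
    simp_rw [hind, ← Nat.cast_sum, ← Nat.cast_add]
    exact ⟨_, rfl⟩
  obtain ⟨n, hn⟩ := this
  rw [hn]
  exact ⟨by positivity, Nat.cast_inv_le_one n⟩

theorem StateEqns.intervalIntegrable (hQ : QueueHyps U v Z0 vt) (hS : StateEqns U v Z0 vt μ S)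
    {t : ℝ} (ht : 0 ≤ t) : IntervalIntegrable (fun s => (mass (μ s))⁻¹) volume 0 t := by
  set I : Set ℝ := {t | 0 ≤ t ∧ IntervalIntegrable (fun s => (mass (μ s))⁻¹) volume 0 t} with hI
  have hIc : I.OrdConnected := by
    refine ⟨fun a ha b hb x hx => ⟨ha.1.trans hx.1, hb.2.mono_set ?_⟩⟩
    rw [uIcc_of_le hb.1, uIcc_of_le (ha.1.trans hx.1)]
    exact Icc_subset_Icc_right hx.2
  have hmono : MonotoneOn S I := by
    intro a ha b hb hab
    rw [(hS a ha.1).1, (hS b hb.1).1, ← intervalIntegral.integral_add_adjacent_intervals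
      ha.2 (ha.2.symm.trans hb.2), le_add_iff_nonneg_right]
    exact intervalIntegral.integral_nonneg hab fun x hx =>
      (hS.inv_mass_mem (ha.1.trans hx.1)).1
  have hm1 : AEMeasurable S (volume.restrict I) :=
    aemeasurable_restrict_of_monotoneOn hIc.measurableSet hmono
  have hm2 : AEMeasurable S (volume.restrict (Ici 0 \ I)) := by
    refine (aemeasurable_const (b := (0 : ℝ))).congr ?_
    filter_upwards [ae_restrict_mem (measurableSet_Ici.diff hIc.measurableSet)] with x hx
    rw [(hS x hx.1).1, intervalIntegral.integral_undef]
    exact fun h => hx.2 ⟨hx.1, h⟩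
  have hm : AEMeasurable S (volume.restrict (Ioc 0 t)) := by
    refine ((aemeasurable_union_iff).2 ⟨hm1, hm2⟩).mono_measure
      (Measure.restrict_mono ?_ le_rfl)
    intro x hx
    by_cases h : x ∈ I
    · exact Or.inl h
    · exact Or.inr ⟨hx.1.le, h⟩
  have hind : Measurable ((Ioi (0 : ℝ)).indicator fun _ => (1 : ℝ)) :=
    measurable_const.indicator measurableSet_Ioi
  rw [intervalIntegrable_iff, uIoc_of_le ht]
  refine Integrable.of_bound ?_ 1 ?_
  · suffices h : AEMeasurable (fun s => mass (μ s)) (volume.restrict (Ioc 0 t)) from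
      h.inv.aestronglyMeasurable
    have hbase : AEMeasurable (fun s => ∑ j ∈ Finset.range Z0,
        (Ioi (0 : ℝ)).indicator (fun _ => (1 : ℝ)) (vt (j + 1) - S s) +
      ∑ i ∈ Finset.range (Ecount U t), (Ici (U (i + 1))).indicator (fun _ => (1 : ℝ)) s *
        (Ioi (0 : ℝ)).indicator (fun _ => (1 : ℝ)) (v (i + 1) - S s + S (U (i + 1))))
        (volume.restrict (Ioc 0 t)) := by
      refine AEMeasurable.add (Finset.aemeasurable_fun_sum _ fun j _ => ?_)
        (Finset.aemeasurable_fun_sum _ fun i _ => AEMeasurable.mul ?_ ?_)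
      · exact hind.comp_aemeasurable (hm.const_sub _)
      · exact (measurable_const.indicator measurableSet_Ici).aemeasurable
      · exact hind.comp_aemeasurable ((hm.const_sub _).add_const _)
    refine hbase.congr ?_
    filter_upwards [ae_restrict_mem measurableSet_Ioc] with s hs
    rw [mass_eq_pair, hS.pair_eq hs.1.le]
    congr 1
    symm
    refine Finset.sum_subset_zero_on_sdiff
      (Finset.range_subset_range.2 (hQ.Ecount_mono hs.1.le hs.2)) (fun i hi => ?_) fun i hi => ?_
    · have : ¬ U (i + 1) ≤ s := by
        rw [← hQ.le_Ecount_iff hs.1.le]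
        simp only [Finset.mem_sdiff, Finset.mem_range] at hi
        omega
      rw [indicator_of_notMem (by simpa using this), zero_mul]
    · have : U (i + 1) ≤ s := by
        rw [← hQ.le_Ecount_iff hs.1.le]
        simpa using hi
      rw [indicator_of_mem (mem_Ici.2 this), one_mul]
  · filter_upwards [ae_restrict_mem measurableSet_Ioc] with s hs
    have := hS.inv_mass_mem hs.1.le
    rw [Real.norm_of_nonneg this.1]
    exact this.2

theorem StateEqns.sub_eq (hQ : QueueHyps U v Z0 vt) (hS : StateEqns U v Z0 vt μ S)
    {s t : ℝ} (hs : 0 ≤ s) (ht : 0 ≤ t) : S t - S s = ∫ x in s..t, (mass (μ x))⁻¹ := by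
  rw [(hS t ht).1, (hS s hs).1, intervalIntegral.integral_interval_sub_left
    (hS.intervalIntegrable hQ ht) (hS.intervalIntegrable hQ hs)]

theorem StateEqns.mono (hQ : QueueHyps U v Z0 vt) (hS : StateEqns U v Z0 vt μ S)
    {s t : ℝ} (hs : 0 ≤ s) (hst : s ≤ t) : S s ≤ S t := by
  rw [← sub_nonneg, hS.sub_eq hQ hs (hs.trans hst)]
  exact intervalIntegral.integral_nonneg hst fun x hx => (hS.inv_mass_mem (hs.trans hx.1)).1

theorem StateEqns.pair_step (hQ : QueueHyps U v Z0 vt) (hS : StateEqns U v Z0 vt μ S)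
    {s t : ℝ} (hs : 0 ≤ s) (hst : s ≤ t) {G : ℝ → ℝ} (hG : ∀ x ≤ 0, G x = 0) :
    pair G (μ t) = pair (fun x => G (x - (S t - S s))) (μ s) +
      ∑ i ∈ Finset.Ioc (Ecount U s) (Ecount U t), G (v i - (S t - S (U i))) := by
  have hSst := hS.mono hQ hs hst
  have hi : ∀ a, 0 ≤ a → (Ioi 0).indicator (fun x => G (x - a)) = fun x => G (x - a) := by
    intro a ha
    refine indicator_eq_self.2 fun x hx => ?_
    by_contra h
    exact hx (hG _ (by have := not_lt.1 (mt mem_Ioi.2 h); linarith))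
  have hi0 : (Ioi 0).indicator G = G := by simpa using hi 0 le_rfl
  rw [hS.pair_eq (hs.trans hst), hS.pair_eq hs, hi _ (sub_nonneg.2 hSst), hi0,
    ← Finset.sum_range_add_sum_Ico _ (hQ.Ecount_mono hs hst), ← Finset.Ico_add_one_add_one_eq_Ioc,
    ← Finset.sum_Ico_add' _ _ _ 1, ← add_assoc]
  congr 1
  · congr 1
    · refine Finset.sum_congr rfl fun j _ => ?_
      congr 1; ring
    · refine Finset.sum_congr rfl fun j _ => ?_
      congr 1; ring
  · refine Finset.sum_congr rfl fun j _ => ?_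
    congr 1; ring

theorem StateEqns.abs_pair_step_le (hQ : QueueHyps U v Z0 vt) (hS : StateEqns U v Z0 vt μ S)
    {s t : ℝ} (hs : 0 ≤ s) (hst : s ≤ t) {G : ℝ → ℝ} (hG : ∀ x ≤ 0, G x = 0) {K : ℝ}
    (hK : ∀ x y, |G x - G y| ≤ K * |x - y|) :
    |pair G (μ t) - pair (fun x => G (x - (S t - S s))) (μ s) - arrSum U v G s t| ≤
      K * (S t - S s) * ((Ecount U t : ℝ) - Ecount U s) := by
  have hK0 : 0 ≤ K := by
    have := (abs_nonneg _).trans (hK 1 0)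
    simpa using this
  rw [hS.pair_step hQ hs hst hG, add_sub_cancel_left, arrSum, ← Finset.sum_sub_distrib]
  calc |∑ i ∈ Finset.Ioc (Ecount U s) (Ecount U t), (G (v i - (S t - S (U i))) - G (v i))|
      ≤ ∑ i ∈ Finset.Ioc (Ecount U s) (Ecount U t), K * (S t - S s) := by
        refine (Finset.abs_sum_le_sum_abs _ _).trans (Finset.sum_le_sum fun i hi => ?_)
        rw [Finset.mem_Ioc] at hi
        have h1 : U i ≤ t := (hQ.le_Ecount_iff (hs.trans hst) i).1 hi.2
        have h2 : s < U i := by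
          rw [← not_le, ← hQ.le_Ecount_iff hs i]; omega
        refine (hK _ _).trans (mul_le_mul_of_nonneg_left ?_ hK0)
        have h3 := hS.mono hQ hs h2.le
        have h4 := hS.mono hQ (hQ.nonneg i) h1
        rw [abs_le]; constructor <;> linarith
    _ = _ := by
        rw [Finset.sum_const, Nat.card_Ioc, nsmul_eq_mul, Nat.cast_sub (hQ.Ecount_mono hs hst)]
        ring

theorem StateEqns.mass_le (hQ : QueueHyps U v Z0 vt) (hS : StateEqns U v Z0 vt μ S)
    {s t : ℝ} (hs : 0 ≤ s) (hst : s ≤ t) :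
    mass (μ t) ≤ pair ((Ioi (S t - S s)).indicator fun _ => 1) (μ s) +
      ((Ecount U t : ℝ) - Ecount U s) := by
  have h1 : mass (μ t) = pair ((Ioi 0).indicator fun _ => 1) (μ t) := by
    rw [mass_eq_pair, hS.pair_eq (hs.trans hst), hS.pair_eq (hs.trans hst), indicator_indicator,
      inter_self]
  rw [h1, hS.pair_step hQ hs hst fun x hx => indicator_of_notMem (by simpa using hx) _]
  refine add_le_add (le_of_eq ?_) ?_
  · congr 1 with x
    simp [indicator_apply]
  · calc ∑ i ∈ Finset.Ioc (Ecount U s) (Ecount U t),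
          (Ioi (0 : ℝ)).indicator (fun _ => (1 : ℝ)) (v i - (S t - S (U i)))
        ≤ ∑ i ∈ Finset.Ioc (Ecount U s) (Ecount U t), (1 : ℝ) :=
          Finset.sum_le_sum fun i _ => indicator_le_self' (fun _ _ => zero_le_one) _
      _ = _ := by simp [Nat.cast_sub (hQ.Ecount_mono hs hst)]

end queue

end PSQ

namespace PSQ

/-- What is retained of a fluid scaled good path on `[0, L]`: `σ` is the cumulative service per
job, `e` the arrival process and `Ar G t` the sum of `G` over the service times of the jobs
arriving up to time `t`; the good-path bounds hold at all levels `n ≤ N`. -/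
structure PrePath (S : Setting) (L : ℝ) (N : ℕ) (ζ : ℝ → Measure ℝ) (σ e : ℝ → ℝ)
    (Ar : (ℝ → ℝ) → ℝ → ℝ) : Prop where
  fin : ∀ t ∈ Icc 0 L, IsFiniteMeasure (ζ t)
  supp : ∀ t ∈ Icc 0 L, ζ t (Iic 0) = 0
  integrable : ∀ t ∈ Icc 0 L, ∀ f : ℝ → ℝ, Integrable f (ζ t)
  inv_int : IntervalIntegrable (fun x => (mass (ζ x))⁻¹) volume 0 L
  service : ∀ s t, 0 ≤ s → s ≤ t → t ≤ L → σ t - σ s = ∫ x in s..t, (mass (ζ x))⁻¹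
  arr_mono : ∀ s t, 0 ≤ s → s ≤ t → e s ≤ e t
  step : ∀ s t, 0 ≤ s → s ≤ t → t ≤ L → ∀ (G : ℝ → ℝ) (K : ℝ), (∀ x ≤ 0, G x = 0) →
    (∀ x y, |G x - G y| ≤ K * |x - y|) →
    |pair G (ζ t) - pair (fun x => G (x - (σ t - σ s))) (ζ s) - (Ar G t - Ar G s)| ≤
      K * (σ t - σ s) * (e t - e s)
  mass_step : ∀ s t, 0 ≤ s → s ≤ t → t ≤ L →
    mass (ζ t) ≤ pair ((Ioi (σ t - σ s)).indicator fun _ => 1) (ζ s) + (e t - e s)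
  arr : ∀ n ≤ N, ∀ t ∈ Icc 0 L, e (t + S.lseq n) - e t ≤ S.εseq n / 16
  mass_le : ∀ t ∈ Icc 0 L, mass (ζ t) ≤ S.M
  mean_le : ∀ t ∈ Icc 0 L, pair id (ζ t) ≤ S.M
  moment_le : ∀ t ∈ Icc 0 L, pair (fun x => x ^ ((1 : ℝ) + S.p)) (ζ t) ≤ S.M
  work : ∀ n ≤ N, ∀ t ∈ Icc 0 L, |pair id (ζ t) - pair id (ζ 0)| ≤ S.γseq n / 4
  lln : ∀ n ≤ N, ∀ k ≤ n, ∀ C, (∀ x, |S.V k x| ≤ C) → ∀ t ∈ Icc 0 L,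
    |Ar (fun x => S.V k (pos x)) t - S.α * t * pair (S.V k) S.ν| ≤ S.εseq n * (1 + C)

theorem pair_smul (G : ℝ → ℝ) (ζ : Measure ℝ) (c : ℝ≥0∞) :
    pair G (c • ζ) = c.toReal * pair G ζ := by
  rw [pair, integral_smul_measure, smul_eq_mul, pair]

theorem pair_fmu (G : ℝ → ℝ) (μ : ℝ → Measure ℝ) {r : ℝ} (hr : 0 < r) (t : ℝ) :
    pair G (fmu μ r t) = 1 / r * pair G (μ (r * t)) := by
  rw [fmu, pair_smul, ENNReal.toReal_ofReal (by positivity)]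

theorem mass_fmu (μ : ℝ → Measure ℝ) {r : ℝ} (hr : 0 < r) (t : ℝ) :
    mass (fmu μ r t) = 1 / r * mass (μ (r * t)) := by
  rw [mass_eq_pair, mass_eq_pair, pair_fmu _ _ hr]

theorem arrSum_sub {U v : ℕ → ℝ} {G : ℝ → ℝ} {a s t : ℝ} (h1 : Ecount U a ≤ Ecount U s)
    (h2 : Ecount U s ≤ Ecount U t) : arrSum U v G a t - arrSum U v G a s = arrSum U v G s t := by
  rw [arrSum, arrSum, arrSum, ← Finset.sum_Ioc_consecutive _ h1 h2, add_sub_cancel_left]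

theorem abs_arrSum_le {U v : ℕ → ℝ} {G : ℝ → ℝ} {s t C : ℝ} (h : Ecount U s ≤ Ecount U t)
    (hC : ∀ x, |G x| ≤ C) : |arrSum U v G s t| ≤ C * ((Ecount U t : ℝ) - Ecount U s) := by
  calc |arrSum U v G s t| ≤ ∑ i ∈ Finset.Ioc (Ecount U s) (Ecount U t), C :=
        (Finset.abs_sum_le_sum_abs _ _).trans (Finset.sum_le_sum fun i _ => hC _)
    _ = _ := by
        rw [Finset.sum_const, Nat.card_Ioc, nsmul_eq_mul, Nat.cast_sub h]; ring

theorem Setting.memBLr.exists_prePath {S : Setting} {L r : ℝ} {ζ : ℝ → Measure ℝ} (hr : 0 < r)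
    (hL : 0 ≤ L) (h : S.memBLr L r ζ) : ∃ σ e Ar, PrePath S L (S.nIdx r) ζ σ e Ar := by
  obtain ⟨U, v, Z0, vt, μ, Sf, m, hQ, hS, hm, hζ, hlev⟩ := h
  have hm0 : (0 : ℝ) ≤ m := Nat.cast_nonneg m
  have hpos : ∀ t : ℝ, 0 ≤ t → 0 ≤ r * ((m : ℝ) + t) := fun t ht => by positivity
  have hle : ∀ s t : ℝ, s ≤ t → r * ((m : ℝ) + s) ≤ r * ((m : ℝ) + t) := fun s t h => by gcongr
  have hinv : ∀ x ∈ Icc 0 L, (mass (ζ x))⁻¹ = r * (mass (μ (r * (m + x))))⁻¹ := fun x hx => by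
    rw [hζ x hx, mass_fmu _ hr, mul_inv, one_div, inv_inv]
  have h0 := (hlev 0 (Nat.zero_le _)).1 m hm
  refine ⟨fun t => Sf (r * (m + t)), fun t => fE U r (m + t),
    fun G t => 1 / r * arrSum U v G (r * m) (r * (m + t)), ?_⟩
  have hm' : r * (m : ℝ) = r * ((m : ℝ) + 0) := by rw [add_zero]
  have harr_mono : ∀ s t : ℝ, 0 ≤ s → s ≤ t → fE U r (m + s) ≤ fE U r (m + t) := by
    intro s t hs hst
    have := hQ.Ecount_mono (hpos s hs) (hle s t hst)
    unfold fE
    gcongr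
  have hAr : ∀ (G : ℝ → ℝ) (s t : ℝ), 0 ≤ s → s ≤ t →
      1 / r * arrSum U v G (r * m) (r * (m + t)) - 1 / r * arrSum U v G (r * m) (r * (m + s)) =
        1 / r * arrSum U v G (r * (m + s)) (r * (m + t)) := by
    intro G s t hs hst
    rw [← mul_sub, hm', arrSum_sub (hQ.Ecount_mono (hpos 0 le_rfl) (hle 0 s hs))
      (hQ.Ecount_mono (hpos s hs) (hle s t hst))]
  exact {
    fin := fun t ht => by
      rw [hζ t ht, fmu]
      have := hS.isFiniteMeasure (hpos t ht.1)
      exact Measure.smul_finite _ ENNReal.ofReal_ne_top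
    supp := fun t ht => by
      rw [hζ t ht, fmu, Measure.smul_apply, hS.Iic_zero (hpos t ht.1), smul_zero]
    integrable := fun t ht f => by
      rw [hζ t ht, fmu]
      exact (hS.integrable (hpos t ht.1) f).smul_measure ENNReal.ofReal_ne_top
    inv_int := by
      have h1 := (hS.intervalIntegrable hQ (hpos 0 le_rfl)).symm.trans
        (hS.intervalIntegrable hQ (hpos L hL))
      have h2 := ((h1.comp_mul_left (c := r)).comp_add_left (m : ℝ)).const_mul r
      have e1 : ∀ t : ℝ, r * (m + t) / r - m = t := fun t => by field_simp; ring
      rw [e1, e1] at h2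
      refine h2.congr fun x hx => ?_
      rw [uIoc_of_le hL] at hx
      exact (hinv x (Ioc_subset_Icc_self hx)).symm
    service := fun s t hs hst ht => by
      have h1 : ∫ x in s..t, (mass (ζ x))⁻¹ =
          ∫ x in s..t, r * (mass (μ (r * x + r * m)))⁻¹ := by
        refine intervalIntegral.integral_congr fun x hx => ?_
        rw [uIcc_of_le hst] at hx
        rw [hinv x ⟨hs.trans hx.1, hx.2.trans ht⟩, mul_add, add_comm (r * (m : ℝ))]
      rw [h1, intervalIntegral.integral_const_mul,
        intervalIntegral.integral_comp_mul_add (fun y => (mass (μ y))⁻¹) hr.ne',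
        smul_eq_mul, mul_inv_cancel_left₀ hr.ne', hS.sub_eq hQ (hpos s hs)
        (hpos t (hs.trans hst))]
      congr 1 <;> ring
    arr_mono := harr_mono
    step := fun s t hs hst ht G K hG hK => by
      have h1 := hS.abs_pair_step_le hQ (hpos s hs) (hle s t hst) hG hK
      rw [hAr G s t hs hst, hζ t ⟨hs.trans hst, ht⟩, hζ s ⟨hs, hst.trans ht⟩, pair_fmu _ _ hr,
        pair_fmu _ _ hr, ← mul_sub, ← mul_sub, abs_mul, abs_of_pos (by positivity : 0 < 1 / r)]
      refine (mul_le_mul_of_nonneg_left h1 (by positivity)).trans (le_of_eq ?_)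
      unfold fE; ring
    mass_step := fun s t hs hst ht => by
      have h1 := hS.mass_le hQ (hpos s hs) (hle s t hst)
      rw [hζ t ⟨hs.trans hst, ht⟩, hζ s ⟨hs, hst.trans ht⟩, pair_fmu _ _ hr, mass_fmu _ hr]
      refine (mul_le_mul_of_nonneg_left h1 (by positivity : 0 ≤ 1 / r)).trans (le_of_eq ?_)
      unfold fE; ring
    arr := fun n hn t ht => by
      have := ((hlev n hn).1 m hm).1 t ht
      rwa [add_assoc] at this
    mass_le := fun t ht => by
      rw [hζ t ht]
      exact (le_max_left _ _).trans ((le_max_left _ _).trans (h0.2.1 t ht))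
    mean_le := fun t ht => by
      rw [hζ t ht]
      exact (le_max_right _ _).trans ((le_max_left _ _).trans (h0.2.1 t ht))
    moment_le := fun t ht => by
      rw [hζ t ht]
      exact (le_max_right _ _).trans (h0.2.1 t ht)
    work := fun n hn t ht => by
      have := ((hlev n hn).1 m hm).2.2.2.1 t ht
      rwa [hζ t ht, hζ 0 ⟨le_rfl, hL⟩, add_zero]
    lln := fun n hn k hk C hC t ht => by
      have hl := S.hl n
      have hε := S.hε n
      have hC0 : 0 ≤ C := (abs_nonneg _).trans (hC 0)
      have harr : ∀ s t, arrSum U v (fun x => S.V k (pos x)) s t = arrSum U v (S.V k) s t := by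
        intro s t
        refine Finset.sum_congr rfl fun i hi => ?_
        have : 0 < v i := hQ.2.2.2.2.1 i (by rw [Finset.mem_Ioc] at hi; omega)
        change S.V k (max (v i) 0) = _
        rw [max_eq_left this.le]
      simp only [harr]
      set l := S.lseq n
      set j := ⌊t / l⌋₊ with hj
      have hj1 : (j : ℝ) * l ≤ t := by
        rw [← le_div_iff₀ hl]; exact Nat.floor_le (div_nonneg ht.1 hl.le)
      have hj2 : t ≤ j * l + l := by
        have := (Nat.lt_floor_add_one (t / l)).le
        rw [div_le_iff₀ hl] at this
        linarith
      have hjl0 : 0 ≤ (j : ℝ) * l := by positivity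
      have hgrid : |1 / r * arrSum U v (S.V k) (r * m) (r * (m + j * l)) -
          S.α * j * l * pair (S.V k) S.ν| ≤ S.εseq n := by
        rcases Nat.eq_zero_or_pos j with h | h
        · rw [h]; simpa [arrSum] using hε.1.le
        · exact (hlev n hn).2.1 k hk j h (Nat.floor_mono (by gcongr; exact ht.2)) m hm
      have hinc : |1 / r * arrSum U v (S.V k) (r * m) (r * (m + t)) -
          1 / r * arrSum U v (S.V k) (r * m) (r * (m + j * l))| ≤ C * (S.εseq n / 16) := by
        rw [hAr _ _ _ hjl0 hj1, abs_mul, abs_of_pos (by positivity : 0 < 1 / r)]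
        have h1 := abs_arrSum_le (v := v) (hQ.Ecount_mono (hpos _ hjl0) (hle _ _ hj1)) hC
        have h2 := ((hlev n hn).1 m hm).1 (j * l) ⟨hjl0, hj1.trans ht.2⟩
        have h3 := harr_mono t (j * l + l) ht.1 hj2
        rw [← add_assoc] at h3
        calc 1 / r * |arrSum U v (S.V k) (r * (m + j * l)) (r * (m + t))|
            ≤ 1 / r * (C * ((Ecount U (r * (m + t)) : ℝ) - Ecount U (r * (m + j * l)))) := by
              gcongr
          _ = C * (fE U r (m + t) - fE U r (m + j * l)) := by unfold fE; ring
          _ ≤ C * (S.εseq n / 16) := by gcongr; linarith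
      have hνC : |pair (S.V k) S.ν| ≤ C := by
        have := S.hν
        have := norm_integral_le_of_norm_le_const (μ := S.ν) (f := S.V k) (C := C)
          (ae_of_all _ hC)
        simpa [pair] using this
      have hαl : S.α * l ≤ S.εseq n / 32 := by
        have := (S.hlε n).le
        rw [le_div_iff₀ (by have := S.hα; positivity)] at this
        change l * _ ≤ _ at this
        linarith
      have hlast : |S.α * j * l * pair (S.V k) S.ν - S.α * t * pair (S.V k) S.ν| ≤
          S.εseq n / 32 * C := by
        rw [← sub_mul, abs_mul]
        refine mul_le_mul ?_ hνC (abs_nonneg _) (by linarith [hε.1])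
        rw [abs_sub_comm, abs_le]
        have := S.hα
        constructor <;> nlinarith
      have := abs_le.1 hgrid
      have := abs_le.1 hinc
      have := abs_le.1 hlast
      have : 0 ≤ S.εseq n * C := mul_nonneg hε.1.le hC0
      rw [abs_le]
      constructor <;> nlinarith }

theorem Setting.tendsto_nIdx (S : Setting) : Tendsto S.nIdx atTop atTop := by
  refine tendsto_atTop.2 fun n => ?_
  filter_upwards [eventually_gt_atTop (S.rseq n)] with r hr
  refine le_csSup ?_ hr
  obtain ⟨N, hN⟩ := eventually_atTop.1 (S.hrtop.eventually_gt_atTop r)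
  refine ⟨N, fun i hi => ?_⟩
  by_contra! h
  exact lt_asymm (hN i h.le) hi

end PSQ

namespace PSQ

section metric

variable {g h : ℕ → ℝ → ℝ}

theorem summable_dmet (a : ℕ → ℝ) : Summable fun k : ℕ => (2 : ℝ)⁻¹ ^ (k + 1) * min |a k| 1 := by
  refine Summable.of_nonneg_of_le (fun k => by positivity) (fun k => ?_)
    ((summable_nat_add_iff 1).2 (summable_geometric_of_lt_one (r := (2 : ℝ)⁻¹) (by norm_num)
      (by norm_num)))
  exact mul_le_of_le_one_right (by positivity) (min_le_right _ _)

theorem dmet_nonneg (ζ₁ ζ₂ : Measure ℝ) : 0 ≤ dmet g h ζ₁ ζ₂ :=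
  add_nonneg (tsum_nonneg fun k => by positivity) (Real.iSup_nonneg fun k => abs_nonneg _)

theorem min_abs_pair_sub_le_dmet (ζ₁ ζ₂ : Measure ℝ) (k : ℕ) :
    min |pair (g k) ζ₁ - pair (g k) ζ₂| 1 ≤ 2 ^ (k + 1) * dmet g h ζ₁ ζ₂ := by
  have h1 := (summable_dmet fun k => pair (g k) ζ₁ - pair (g k) ζ₂).le_tsum k
    fun i _ => by positivity
  have h2 : 0 ≤ ⨆ k : ℕ, |pair (h k) ζ₁ - pair (h k) ζ₂| := Real.iSup_nonneg fun k => abs_nonneg _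
  have h3 : (2 : ℝ)⁻¹ ^ (k + 1) * min |pair (g k) ζ₁ - pair (g k) ζ₂| 1 ≤ dmet g h ζ₁ ζ₂ := by
    unfold dmet
    linarith
  rwa [inv_pow, inv_mul_le_iff₀ (by positivity)] at h3

theorem MetricFamilies.tendsto_pair (hf : MetricFamilies g h) {ζs : ℕ → Measure ℝ}
    {ζ : Measure ℝ} (hs : ∀ j, IsFiniteMeasure (ζs j)) (hζ : IsFiniteMeasure ζ)
    (hs0 : ∀ j, ζs j (Iio 0) = 0) (hζ0 : ζ (Iio 0) = 0)
    (hd : Tendsto (fun j => dmet g h (ζs j) ζ) atTop (nhds 0)) {f : ℝ → ℝ} (hc : Continuous f)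
    (hb : ∃ C, ∀ x, |f x| ≤ C) : Tendsto (fun j => pair f (ζs j)) atTop (nhds (pair f ζ)) := by
  refine hf.2.2 ζs ζ hs hζ hs0 hζ0 (fun k => ?_) f hc hb
  rw [tendsto_iff_norm_sub_tendsto_zero]
  have h1 : Tendsto (fun j => 2 ^ (k + 1) * dmet g h (ζs j) ζ) atTop (nhds 0) := by
    simpa using hd.const_mul ((2 : ℝ) ^ (k + 1))
  refine squeeze_zero' (Eventually.of_forall fun j => norm_nonneg _) ?_ h1
  filter_upwards [h1.eventually_lt_const one_pos] with j hj
  have h2 := min_abs_pair_sub_le_dmet (g := g) (h := h) (ζs j) ζ k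
  rcases min_le_iff.1 h2 with h3 | h3
  · exact h3
  · linarith

end metric

/-- A weakly continuous path on `[0, L]` together with a sequence of good paths converging to
it, for which the good-path bounds hold up to a level tending to infinity. -/
structure LimitPath (S : Setting) (L : ℝ) (ζ : ℝ → Measure ℝ) (N : ℕ → ℕ)
    (ζs : ℕ → ℝ → Measure ℝ) (σ e : ℕ → ℝ → ℝ) (Ar : ℕ → (ℝ → ℝ) → ℝ → ℝ) : Prop where
  fin : ∀ t ∈ Icc 0 L, IsFiniteMeasure (ζ t)
  supp : ∀ t ∈ Icc 0 L, ζ t (Iio 0) = 0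
  wcont : WeaklyContinuousOn ζ (Icc 0 L)
  pre : ∀ j, PrePath S L (N j) (ζs j) (σ j) (e j) (Ar j)
  tendsto_N : Tendsto N atTop atTop
  conv : ∀ t ∈ Icc 0 L, ∀ f : ℝ → ℝ, Continuous f → (∃ C, ∀ x, |f x| ≤ C) →
    Tendsto (fun j => pair f (ζs j t)) atTop (nhds (pair f (ζ t)))

theorem Setting.memBL.exists_limitPath {S : Setting} {L : ℝ} {ζ : ℝ → Measure ℝ} (hL : 0 ≤ L)
    (h : S.memBL L ζ) : ∃ N ζs σ e Ar, LimitPath S L ζ N ζs σ e Ar := by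
  obtain ⟨hfin, hcont, φ, ζs, hφ, hmem, hconv⟩ := h
  choose σ e Ar hpre using fun j => (hmem j).exists_prePath (S.hR _) hL
  refine ⟨_, ζs, σ, e, Ar, fun t ht => (hfin t ht).1, fun t ht => (hfin t ht).2, ?_, hpre,
    S.tendsto_nIdx.comp (S.hRtop.comp hφ.tendsto_atTop), fun t ht f hf hb => ?_⟩
  · intro f hf hb
    rw [continuousOn_iff_continuous_domRestrict, continuous_iff_seqContinuous]
    intro x t hx
    refine S.hmetfam.tendsto_pair (fun j => (hfin _ (x j).2).1) (hfin _ t.2).1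
      (fun j => (hfin _ (x j).2).2) (hfin _ t.2).2 ?_ hf hb
    rw [Metric.tendsto_atTop]
    intro ε hε
    obtain ⟨δ, hδ, hd⟩ := hcont t t.2 ε hε
    obtain ⟨J, hJ⟩ := Metric.tendsto_atTop.1 hx δ hδ
    refine ⟨J, fun j hj => ?_⟩
    rw [Real.dist_0_eq_abs, abs_of_nonneg (dmet_nonneg _ _)]
    exact hd _ (x j).2 (hJ j hj)
  · refine S.hmetfam.tendsto_pair (fun j => (hpre j).fin t ht) (hfin t ht).1
      (fun j => measure_mono_null Iio_subset_Iic_self ((hpre j).supp t ht)) (hfin t ht).2 ?_ hf hb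
    rw [Metric.tendsto_atTop]
    intro ε hε
    obtain ⟨J, hJ⟩ := hconv (ε / 2) (by positivity)
    refine ⟨J, fun j hj => ?_⟩
    rw [Real.dist_0_eq_abs, abs_of_nonneg (dmet_nonneg _ _)]
    linarith [hJ j hj t ht]

/-- The truncation `min x⁺ K`. -/
def trunc (K x : ℝ) : ℝ := min (max x 0) K

theorem continuous_trunc (K : ℝ) : Continuous (trunc K) := by unfold trunc; fun_prop

theorem abs_trunc_le {K : ℝ} (hK : 0 ≤ K) (x : ℝ) : |trunc K x| ≤ K := by
  rw [trunc, abs_of_nonneg (le_min (le_max_right _ _) hK)]; exact min_le_right _ _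

theorem abs_sub_trunc_le {p K x : ℝ} (hp : 0 < p) (hK : 0 < K) (hx : 0 ≤ x) :
    |x - trunc K x| ≤ (max x 0) ^ (1 + p) * K ^ (-p) := by
  rw [trunc, max_eq_left hx]
  rcases le_total x K with h | h
  · rw [min_eq_left h, sub_self, abs_zero]; positivity
  · rw [min_eq_right h, abs_of_nonneg (by linarith)]
    have h1 : 1 ≤ x ^ p * K ^ (-p) := by
      rw [Real.rpow_neg hK.le, ← div_eq_mul_inv, one_le_div (by positivity)]
      exact Real.rpow_le_rpow hK.le h hp.le
    calc x - K ≤ x * 1 := by linarith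
      _ ≤ x * (x ^ p * K ^ (-p)) := by gcongr
      _ = _ := by rw [Real.rpow_add (hK.trans_le h), Real.rpow_one]; ring

theorem continuous_max_rpow {p : ℝ} (hp : 0 < p) :
    Continuous fun x : ℝ => (max x 0) ^ ((1 : ℝ) + p) :=
  (continuous_id.max continuous_const).rpow_const fun _ => Or.inr (by linarith)

theorem ae_nonneg_of_Iio {ζ : Measure ℝ} (h : ζ (Iio 0) = 0) : ∀ᵐ x ∂ζ, 0 ≤ x := by
  rw [ae_iff]; simp only [not_le]; exact h

/-- A finite measure on the half line with `(1 + p)`-th moment at most `M`. -/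
structure MomentBound (ζ : Measure ℝ) (p M : ℝ) : Prop where
  fin : IsFiniteMeasure ζ
  supp : ζ (Iio 0) = 0
  int : Integrable (fun x : ℝ => (max x 0) ^ ((1 : ℝ) + p)) ζ
  le : ∫ x, (max x 0) ^ ((1 : ℝ) + p) ∂ζ ≤ M

theorem MomentBound.integrable_id {ζ : Measure ℝ} {p M : ℝ} (h : MomentBound ζ p M) (hp : 0 < p) :
    Integrable (fun x : ℝ => x) ζ := by
  have := h.fin
  refine ((integrable_const (1 : ℝ)).add h.int).mono' (by fun_prop) ?_
  filter_upwards [ae_nonneg_of_Iio h.supp] with x hx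
  rw [Real.norm_eq_abs, abs_of_nonneg hx, Pi.add_apply, max_eq_left hx]
  rcases le_total x 1 with h1 | h1
  · have : 0 ≤ x ^ (1 + p) := by positivity
    linarith
  · have := Real.self_le_rpow_of_one_le h1 (by linarith : (1 : ℝ) ≤ 1 + p)
    linarith

theorem MomentBound.abs_pair_sub_trunc_le {ζ : Measure ℝ} {p M : ℝ} (h : MomentBound ζ p M)
    (hp : 0 < p) {K : ℝ} (hK : 0 < K) : |pair id ζ - pair (trunc K) ζ| ≤ M * K ^ (-p) := by
  have := h.fin
  have h1 : Integrable (trunc K) ζ :=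
    Integrable.of_bound (continuous_trunc K).aestronglyMeasurable K
      (ae_of_all _ (abs_trunc_le hK.le))
  rw [pair, pair, ← integral_sub (f := id) (h.integrable_id hp) h1]
  calc |∫ x, (id x - trunc K x) ∂ζ| ≤ ∫ x, (max x 0) ^ ((1 : ℝ) + p) * K ^ (-p) ∂ζ := by
        refine norm_integral_le_of_norm_le (f := fun x => id x - trunc K x)
          (h.int.mul_const _) ?_
        filter_upwards [ae_nonneg_of_Iio h.supp] with x hx
        exact abs_sub_trunc_le hp hK hx
    _ ≤ _ := by
        rw [integral_mul_const]
        gcongr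
        exact h.le

theorem MomentBound.of_tendsto {ζs : ℕ → Measure ℝ} {ζ : Measure ℝ} {p M : ℝ} (hp : 0 < p)
    (hs : ∀ j, MomentBound (ζs j) p M) (hfin : IsFiniteMeasure ζ) (hsupp : ζ (Iio 0) = 0)
    (hconv : ∀ f : ℝ → ℝ, Continuous f → (∃ C, ∀ x, |f x| ≤ C) →
      Tendsto (fun j => pair f (ζs j)) atTop (nhds (pair f ζ))) : MomentBound ζ p M := by
  have hM : 0 ≤ M := le_trans (integral_nonneg fun x => by positivity) (hs 0).le
  set q : ℝ → ℝ := fun x => (max x 0) ^ ((1 : ℝ) + p) with hq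
  have hqc : Continuous q := continuous_max_rpow hp
  have hq0 : ∀ x, 0 ≤ q x := fun x => by positivity
  have hb : ∀ K : ℕ, ∀ x, |min (q x) K| ≤ K := fun K x => by
    rw [abs_of_nonneg (le_min (hq0 x) (Nat.cast_nonneg K))]; exact min_le_right _ _
  have h1 : ∀ K : ℕ, ∫ x, min (q x) K ∂ζ ≤ M := by
    intro K
    refine le_of_tendsto (hconv (fun x => min (q x) K) (by fun_prop) ⟨K, hb K⟩)
      (Eventually.of_forall fun j => le_trans ?_ (hs j).le)
    have := (hs j).fin
    exact integral_mono (Integrable.of_bound (by fun_prop) K (ae_of_all _ (hb K))) (hs j).int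
      fun x => min_le_left _ _
  have h2 : ∫⁻ x, ENNReal.ofReal (q x) ∂ζ ≤ ENNReal.ofReal M := by
    calc ∫⁻ x, ENNReal.ofReal (q x) ∂ζ
        ≤ ∫⁻ x, liminf (fun K : ℕ => ENNReal.ofReal (min (q x) K)) atTop ∂ζ := by
          refine lintegral_mono fun x => ?_
          have : Tendsto (fun K : ℕ => ENNReal.ofReal (min (q x) K)) atTop
              (nhds (ENNReal.ofReal (q x))) := by
            refine tendsto_const_nhds.congr' ?_
            filter_upwards [eventually_ge_atTop ⌈q x⌉₊] with K hK
            rw [min_eq_left (Nat.ceil_le.1 hK)]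
          exact this.liminf_eq.ge
      _ ≤ liminf (fun K : ℕ => ∫⁻ x, ENNReal.ofReal (min (q x) K) ∂ζ) atTop :=
          lintegral_liminf_le fun K => by fun_prop
      _ ≤ ENNReal.ofReal M := by
          refine liminf_le_of_le (by isBoundedDefault) fun b hb' => ?_
          obtain ⟨K, hK⟩ := hb'.exists
          refine hK.trans ?_
          rw [← ofReal_integral_eq_lintegral_ofReal
            (Integrable.of_bound (by fun_prop) K (ae_of_all _ (hb K)))
            (ae_of_all _ fun x => le_min (hq0 x) (Nat.cast_nonneg K))]
          exact ENNReal.ofReal_le_ofReal (h1 K)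
  have h3 : Integrable q ζ := by
    refine ⟨hqc.aestronglyMeasurable, ?_⟩
    rw [hasFiniteIntegral_iff_ofReal (ae_of_all _ hq0)]
    exact h2.trans_lt ENNReal.ofReal_lt_top
  refine ⟨hfin, hsupp, h3, ?_⟩
  rw [← ofReal_integral_eq_lintegral_ofReal h3 (ae_of_all _ hq0)] at h2
  exact (ENNReal.ofReal_le_ofReal_iff hM).1 h2

theorem MomentBound.tendsto_pair_id {ζs : ℕ → Measure ℝ} {ζ : Measure ℝ} {p M : ℝ} (hp : 0 < p)
    (hs : ∀ j, MomentBound (ζs j) p M) (h : MomentBound ζ p M)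
    (hconv : ∀ f : ℝ → ℝ, Continuous f → (∃ C, ∀ x, |f x| ≤ C) →
      Tendsto (fun j => pair f (ζs j)) atTop (nhds (pair f ζ))) :
    Tendsto (fun j => pair id (ζs j)) atTop (nhds (pair id ζ)) := by
  rw [Metric.tendsto_atTop]
  intro ε hε
  have h0 : Tendsto (fun K : ℝ => M * K ^ (-p)) atTop (nhds 0) := by
    simpa using (tendsto_rpow_neg_atTop hp).const_mul M
  obtain ⟨K, hK, hK0⟩ := ((h0.eventually_lt_const (by positivity : 0 < ε / 3)).and
    (eventually_gt_atTop 0)).exists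
  obtain ⟨J, hJ⟩ := Metric.tendsto_atTop.1
    (hconv (trunc K) (continuous_trunc K) ⟨K, abs_trunc_le hK0.le⟩) (ε / 3) (by positivity)
  refine ⟨J, fun j hj => ?_⟩
  have h1 := (hs j).abs_pair_sub_trunc_le hp hK0
  have h2 := h.abs_pair_sub_trunc_le hp hK0
  have h3 := hJ j hj
  rw [Real.dist_eq] at h3 ⊢
  rw [abs_le] at h1 h2
  rw [abs_lt] at h3 ⊢
  constructor <;> linarith

end PSQ

namespace PSQ

section prePath

variable {S : Setting} {L : ℝ} {N : ℕ} {ζ : ℝ → Measure ℝ} {σ e : ℝ → ℝ} {Ar : (ℝ → ℝ) → ℝ → ℝ}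

theorem PrePath.momentBound (P : PrePath S L N ζ σ e Ar) {t : ℝ} (ht : t ∈ Icc 0 L) :
    MomentBound (ζ t) S.p S.M := by
  have h0 := measure_mono_null Iio_subset_Iic_self (P.supp t ht)
  refine ⟨P.fin t ht, h0, P.integrable t ht _, le_trans (le_of_eq ?_) (P.moment_le t ht)⟩
  refine integral_congr_ae ?_
  filter_upwards [ae_nonneg_of_Iio h0] with x hx
  rw [max_eq_left hx]

theorem PrePath.intervalIntegrable (P : PrePath S L N ζ σ e Ar) {s t : ℝ} (hs : 0 ≤ s)
    (hst : s ≤ t) (ht : t ≤ L) : IntervalIntegrable (fun x => (mass (ζ x))⁻¹) volume s t := by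
  refine P.inv_int.mono_set ?_
  rw [uIcc_of_le hst, uIcc_of_le (hs.trans (hst.trans ht))]
  exact Icc_subset_Icc hs ht

theorem PrePath.service_nonneg (P : PrePath S L N ζ σ e Ar) {s t : ℝ} (hs : 0 ≤ s) (hst : s ≤ t)
    (ht : t ≤ L) : 0 ≤ σ t - σ s := by
  rw [P.service s t hs hst ht]
  exact intervalIntegral.integral_nonneg hst fun x _ => inv_nonneg.2 (mass_nonneg _)

theorem PrePath.mass_le_arrivals_add (P : PrePath S L N ζ σ e Ar) {s t : ℝ} (hs : 0 ≤ s)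
    (hst : s < t) (ht : t ≤ L) :
    mass (ζ t) ≤ S.M / (t - s) * pair id (ζ s) + (e t - e s) := by
  have hM : 0 < S.M := one_pos.trans S.hM
  have hs' : s ∈ Icc 0 L := ⟨hs, hst.le.trans ht⟩
  have hid : ∀ᵐ x ∂(ζ s), 0 ≤ x :=
    ae_nonneg_of_Iio (measure_mono_null Iio_subset_Iic_self (P.supp s hs'))
  have hid0 : 0 ≤ pair id (ζ s) := integral_nonneg_of_ae hid
  have hts : 0 < t - s := sub_pos.2 hst
  by_cases hz : ∃ u ∈ Icc s t, mass (ζ u) = 0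
  · obtain ⟨u, hu, hu0⟩ := hz
    have hu' : u ∈ Icc 0 L := ⟨hs.trans hu.1, hu.2.trans ht⟩
    have := P.fin u hu'
    have hzero : ζ u = 0 := by
      rw [mass, ENNReal.toReal_eq_zero_iff] at hu0
      exact Measure.measure_univ_eq_zero.1 (hu0.resolve_right (measure_ne_top _ _))
    have h1 := P.mass_step u t hu'.1 hu.2 ht
    rw [hzero, pair, integral_zero_measure] at h1
    have := P.arr_mono s u hs hu.1
    have : 0 ≤ S.M / (t - s) * pair id (ζ s) := by positivity
    linarith
  · push Not at hz
    refine (P.mass_step s t hs hst.le ht).trans (add_le_add_left ?_ _)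
    have ha : (t - s) / S.M ≤ σ t - σ s := by
      rw [P.service s t hs hst.le ht]
      have h1 : ∫ _ in s..t, S.M⁻¹ = (t - s) / S.M := by
        rw [intervalIntegral.integral_const, smul_eq_mul, div_eq_mul_inv]
      rw [← h1]
      refine intervalIntegral.integral_mono_on hst.le (by simp)
        (P.intervalIntegrable hs hst.le ht) fun x hx => ?_
      have hx' : x ∈ Icc 0 L := ⟨hs.trans hx.1, hx.2.trans ht⟩
      exact inv_anti₀ ((mass_nonneg _).lt_of_ne' (hz x hx)) (P.mass_le x hx')
    have hapos : 0 < (t - s) / S.M := by positivity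
    rw [pair, pair, ← integral_const_mul]
    refine integral_mono_ae (P.integrable s hs' _) (P.integrable s hs' _) ?_
    filter_upwards [hid] with x hx
    by_cases hxa : x ∈ Ioi (σ t - σ s)
    · rw [indicator_of_mem hxa, ← div_le_iff₀' (by positivity), one_div_div]
      exact ha.trans (mem_Ioi.1 hxa).le
    · rw [indicator_of_notMem hxa]
      have : 0 ≤ id x := hx
      positivity

end prePath

section limitPath

variable {S : Setting} {L : ℝ} {ζ : ℝ → Measure ℝ} {N : ℕ → ℕ} {ζs : ℕ → ℝ → Measure ℝ}
  {σ e : ℕ → ℝ → ℝ} {Ar : ℕ → (ℝ → ℝ) → ℝ → ℝ}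

theorem LimitPath.momentBound (P : LimitPath S L ζ N ζs σ e Ar) {t : ℝ} (ht : t ∈ Icc 0 L) :
    MomentBound (ζ t) S.p S.M :=
  .of_tendsto S.hp (fun j => (P.pre j).momentBound ht) (P.fin t ht) (P.supp t ht) (P.conv t ht)

theorem LimitPath.tendsto_pair_id (P : LimitPath S L ζ N ζs σ e Ar) {t : ℝ} (ht : t ∈ Icc 0 L) :
    Tendsto (fun j => pair id (ζs j t)) atTop (nhds (pair id (ζ t))) :=
  MomentBound.tendsto_pair_id S.hp (fun j => (P.pre j).momentBound ht) (P.momentBound ht)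
    (P.conv t ht)

theorem LimitPath.tendsto_mass (P : LimitPath S L ζ N ζs σ e Ar) {t : ℝ} (ht : t ∈ Icc 0 L) :
    Tendsto (fun j => mass (ζs j t)) atTop (nhds (mass (ζ t))) := by
  simp only [mass_eq_pair]
  exact P.conv t ht _ continuous_const ⟨1, by simp⟩

theorem LimitPath.mass_le (P : LimitPath S L ζ N ζs σ e Ar) {t : ℝ} (ht : t ∈ Icc 0 L) :
    mass (ζ t) ≤ S.M :=
  le_of_tendsto (P.tendsto_mass ht) (Eventually.of_forall fun j => (P.pre j).mass_le t ht)

theorem LimitPath.pair_id_le (P : LimitPath S L ζ N ζs σ e Ar) {t : ℝ} (ht : t ∈ Icc 0 L) :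
    pair id (ζ t) ≤ S.M :=
  le_of_tendsto (P.tendsto_pair_id ht) (Eventually.of_forall fun j => (P.pre j).mean_le t ht)

theorem Setting.lseq_lt (S : Setting) (n : ℕ) : S.α * S.lseq n < S.εseq n := by
  have h := S.hlε n
  have := S.hα
  have := (S.hε n).1
  rw [lt_div_iff₀ (by positivity)] at h
  linarith

theorem Setting.tendsto_lseq (S : Setting) : Tendsto S.lseq atTop (nhds 0) := by
  have h : Tendsto (fun n => S.εseq n / S.α) atTop (nhds 0) := by
    simpa using S.hεlim.div_const S.α
  refine squeeze_zero (fun n => (S.hl n).le) (fun n => ?_) h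
  rw [le_div_iff₀' S.hα]
  exact (S.lseq_lt n).le

theorem Setting.tendsto_γseq (S : Setting) : Tendsto S.γseq atTop (nhds 0) := by
  refine squeeze_zero (fun n => (S.hγ n).le) (fun n => ?_) S.tendsto_lseq
  have := (lt_min_iff.1 (S.hγc n)).2
  have := S.hl n
  linarith

theorem LimitPath.pair_id_eq (P : LimitPath S L ζ N ζs σ e Ar) {t : ℝ} (ht : t ∈ Icc 0 L) :
    pair id (ζ t) = pair id (ζ 0) := by
  have h0 : (0 : ℝ) ∈ Icc 0 L := ⟨le_rfl, ht.1.trans ht.2⟩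
  have h1 : ∀ n, |pair id (ζ t) - pair id (ζ 0)| ≤ S.γseq n / 4 := fun n => by
    refine le_of_tendsto ((P.tendsto_pair_id ht).sub (P.tendsto_pair_id h0)).abs ?_
    filter_upwards [P.tendsto_N.eventually_ge_atTop n] with j hj
    exact (P.pre j).work n hj t ht
  have h2 : Tendsto (fun n => S.γseq n / 4) atTop (nhds 0) := by
    simpa using S.tendsto_γseq.div_const 4
  exact sub_eq_zero.1 (abs_nonpos_iff.1 (ge_of_tendsto' h2 h1))

theorem LimitPath.eq_zero_of_pair_id (P : LimitPath S L ζ N ζs σ e Ar) (hw : pair id (ζ 0) = 0)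
    {t : ℝ} (ht : t ∈ Ioc 0 L) : ζ t = 0 := by
  have ht' : t ∈ Icc 0 L := Ioc_subset_Icc_self ht
  have := P.fin t ht'
  have h1 : ∀ᶠ n in atTop, mass (ζ t) ≤ S.εseq n / 16 := by
    filter_upwards [S.tendsto_lseq.eventually_lt_const ht.1] with n hn
    have hl := S.hl n
    have hs : t - S.lseq n ∈ Icc 0 L := ⟨by linarith, by linarith [ht.2]⟩
    have h2 : Tendsto (fun j => S.M / S.lseq n * pair id (ζs j (t - S.lseq n)) + S.εseq n / 16)
        atTop (nhds (S.M / S.lseq n * 0 + S.εseq n / 16)) := by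
      have h3 := P.tendsto_pair_id hs
      rw [P.pair_id_eq hs, hw] at h3
      exact (h3.const_mul _).add_const _
    rw [mul_zero, zero_add] at h2
    refine le_of_tendsto_of_tendsto (P.tendsto_mass ht') h2 ?_
    filter_upwards [P.tendsto_N.eventually_ge_atTop n] with j hj
    have h4 := (P.pre j).mass_le_arrivals_add hs.1 (by linarith : t - S.lseq n < t) ht.2
    have h5 := (P.pre j).arr n hj _ hs
    rw [sub_sub_cancel] at h4
    rw [sub_add_cancel] at h5
    linarith
  have h2 : Tendsto (fun n => S.εseq n / 16) atTop (nhds 0) := by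
    simpa using S.hεlim.div_const 16
  have h3 : mass (ζ t) = 0 := le_antisymm (ge_of_tendsto h2 h1) (mass_nonneg _)
  rw [mass, ENNReal.toReal_eq_zero_iff] at h3
  exact Measure.measure_univ_eq_zero.1 (h3.resolve_right (measure_ne_top _ _))

theorem LimitPath.exists_mass_ge (P : LimitPath S L ζ N ζs σ e Ar) (hL : 0 ≤ L)
    (hw : 0 < pair id (ζ 0)) :
    ∃ c, 0 < c ∧ (∀ t ∈ Icc 0 L, c ≤ mass (ζ t)) ∧
      ∀ᶠ j in atTop, ∀ t ∈ Icc 0 L, c ≤ mass (ζs j t) := by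
  have h0 : (0 : ℝ) ∈ Icc 0 L := ⟨le_rfl, hL⟩
  set w := pair id (ζ 0) with hwdef
  have hlim : Tendsto (fun K : ℝ => S.M * K ^ (-S.p)) atTop (nhds 0) := by
    simpa using (tendsto_rpow_neg_atTop S.hp).const_mul S.M
  obtain ⟨K, hK, hK0⟩ := ((hlim.eventually_lt_const (by positivity : 0 < w / 4)).and
    (eventually_gt_atTop 0)).exists
  obtain ⟨n, hn⟩ := (S.tendsto_γseq.eventually_lt_const (by positivity : 0 < w / 4)).exists
  have hev : ∀ᶠ j in atTop, ∀ t ∈ Icc 0 L, w / (4 * K) ≤ mass (ζs j t) := by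
    filter_upwards [P.tendsto_N.eventually_ge_atTop n,
      (P.tendsto_pair_id h0).eventually_const_lt (by linarith : 3 / 4 * w < w)] with j hj hj0 t ht
    have h1 := abs_le.1 ((P.pre j).work n hj t ht)
    have h2 := abs_le.1 (((P.pre j).momentBound ht).abs_pair_sub_trunc_le S.hp hK0)
    have := (P.pre j).fin t ht
    have h3 : pair (trunc K) (ζs j t) ≤ K * mass (ζs j t) := by
      rw [mass_eq_pair, pair, pair, ← integral_const_mul]
      exact integral_mono ((P.pre j).integrable t ht _) ((P.pre j).integrable t ht _)
        fun x => by simpa using (le_abs_self _).trans (abs_trunc_le hK0.le x)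
    rw [div_le_iff₀ (by positivity)]
    have := S.hγ n
    linarith
  refine ⟨w / (4 * K), by positivity, fun t ht => ?_, hev⟩
  exact ge_of_tendsto (P.tendsto_mass ht) (hev.mono fun j hj => hj t ht)

end limitPath

end PSQ

namespace PSQ

theorem continuous_pos : Continuous pos := by unfold pos; fun_prop

theorem abs_pos_sub_le (x y : ℝ) : |pos x - pos y| ≤ |x - y| := abs_max_sub_max_le_abs x y 0

theorem abs_sub_le_of_abs_deriv_le {g : ℝ → ℝ} (hg : ContDiff ℝ 1 g) {K : ℝ}
    (hK : ∀ x, |deriv g x| ≤ K) (x y : ℝ) : |g x - g y| ≤ K * |x - y| :=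
  Convex.norm_image_sub_le_of_norm_deriv_le (s := univ)
    (fun z _ => (hg.differentiable one_ne_zero) z) (fun z _ => hK z) convex_univ (mem_univ y)
    (mem_univ x)

theorem continuous_of_abs_sub_le {G : ℝ → ℝ} {K : ℝ} (hG : ∀ x y, |G x - G y| ≤ K * |x - y|) :
    Continuous G := by
  rw [continuous_iff_continuousAt]
  intro x
  rw [ContinuousAt, tendsto_iff_norm_sub_tendsto_zero]
  refine squeeze_zero (fun y => norm_nonneg _) (fun y => hG y x) ?_
  have : Tendsto (fun y => K * |y - x|) (nhds x) (nhds (K * |x - x|)) := by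
    apply Continuous.tendsto; fun_prop
  simpa using this

theorem integrable_of_continuous_bounded {ζ : Measure ℝ} [IsFiniteMeasure ζ] {f : ℝ → ℝ}
    (hf : Continuous f) {C : ℝ} (hC : ∀ x, |f x| ≤ C) : Integrable f ζ :=
  Integrable.of_bound hf.aestronglyMeasurable C (ae_of_all _ hC)

theorem abs_pair_shift_sub_le {ζ : Measure ℝ} [IsFiniteMeasure ζ] {G : ℝ → ℝ} {K C : ℝ}
    (hG : ∀ x y, |G x - G y| ≤ K * |x - y|) (hC : ∀ x, |G x| ≤ C) (a b : ℝ) :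
    |pair (fun x => G (x - a)) ζ - pair (fun x => G (x - b)) ζ| ≤ K * |a - b| * mass ζ := by
  have hc := continuous_of_abs_sub_le hG
  rw [pair, pair, ← integral_sub (f := fun x => G (x - a)) (g := fun x => G (x - b))
    (integrable_of_continuous_bounded (by fun_prop) fun x => hC _)
    (integrable_of_continuous_bounded (by fun_prop) fun x => hC _)]
  refine norm_integral_le_of_norm_le_const (μ := ζ)
    (f := fun x => G (x - a) - G (x - b)) (ae_of_all _ fun x => ?_)
  have := hG (x - a) (x - b)
  rwa [sub_sub_sub_cancel_left, abs_sub_comm b a] at this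

theorem tendsto_pair_of_bounded {ζ : Measure ℝ} [IsFiniteMeasure ζ] {f : ℕ → ℝ → ℝ} {g : ℝ → ℝ}
    {C : ℝ} (hf : ∀ i, Continuous (f i)) (hC : ∀ i x, |f i x| ≤ C)
    (h : ∀ x, Tendsto (fun i => f i x) atTop (nhds (g x))) :
    Tendsto (fun i => pair (f i) ζ) atTop (nhds (pair g ζ)) :=
  tendsto_integral_of_dominated_convergence (fun _ => C)
    (fun i => (hf i).aestronglyMeasurable) (integrable_const _) (fun i => ae_of_all _ (hC i))
    (ae_of_all _ h)

section limitPath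

variable {S : Setting} {L : ℝ} {ζ : ℝ → Measure ℝ} {N : ℕ → ℕ} {ζs : ℕ → ℝ → Measure ℝ}
  {σ e : ℕ → ℝ → ℝ} {Ar : ℕ → (ℝ → ℝ) → ℝ → ℝ}

/-- The cumulative service per job of a path during `[s, t]`. -/
noncomputable def service (ζ : ℝ → Measure ℝ) (s t : ℝ) : ℝ := ∫ x in s..t, (mass (ζ x))⁻¹

theorem LimitPath.continuousOn_mass (P : LimitPath S L ζ N ζs σ e Ar) :
    ContinuousOn (fun t => mass (ζ t)) (Icc 0 L) := by
  simp only [mass_eq_pair]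
  exact P.wcont _ continuous_const ⟨1, by simp⟩

theorem LimitPath.tendsto_service (P : LimitPath S L ζ N ζs σ e Ar) {c : ℝ} (hc : 0 < c)
    (hz : ∀ t ∈ Icc 0 L, c ≤ mass (ζ t)) (hzs : ∀ᶠ j in atTop, ∀ t ∈ Icc 0 L, c ≤ mass (ζs j t))
    {s t : ℝ} (hs : 0 ≤ s) (hst : s ≤ t) (ht : t ≤ L) :
    Tendsto (fun j => σ j t - σ j s) atTop (nhds (service ζ s t)) := by
  simp only [fun j => (P.pre j).service s t hs hst ht]
  have hsub : ∀ x ∈ uIoc s t, x ∈ Icc 0 L := fun x hx => by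
    rw [uIoc_of_le hst] at hx
    exact ⟨hs.trans hx.1.le, hx.2.trans ht⟩
  refine intervalIntegral.tendsto_integral_filter_of_dominated_convergence (fun _ => c⁻¹)
    (Eventually.of_forall fun j => ?_) ?_ (by simp) (ae_of_all _ fun x hx => ?_)
  · have := ((P.pre j).intervalIntegrable hs hst ht).1.aestronglyMeasurable
    rwa [uIoc_of_le hst]
  · filter_upwards [hzs] with j hj
    refine ae_of_all _ fun x hx => ?_
    rw [Real.norm_eq_abs, abs_of_nonneg (inv_nonneg.2 (mass_nonneg _))]
    exact inv_anti₀ hc (hj x (hsub x hx))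
  · exact (P.tendsto_mass (hsub x hx)).inv₀ (hc.trans_le (hz x (hsub x hx))).ne'

theorem LimitPath.abs_step_le (P : LimitPath S L ζ N ζs σ e Ar) {c : ℝ} (hc : 0 < c)
    (hz : ∀ t ∈ Icc 0 L, c ≤ mass (ζ t)) (hzs : ∀ᶠ j in atTop, ∀ t ∈ Icc 0 L, c ≤ mass (ζs j t))
    {k : ℕ} {K : ℝ} (hK : ∀ x, |S.V k x| ≤ K ∧ |deriv (S.V k) x| ≤ K) {n : ℕ}
    {s t : ℝ} (hs : 0 ≤ s) (hst : s ≤ t) (ht : t ≤ L) (hn : t - s ≤ S.lseq n) :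
    |pair (fun x => S.V k (pos x)) (ζ t) -
        pair (fun x => S.V k (pos (x - service ζ s t))) (ζ s) -
        S.α * (t - s) * pair (S.V k) S.ν| ≤ K * (c⁻¹ * (t - s)) * (S.εseq n / 16) := by
  have hs' : s ∈ Icc 0 L := ⟨hs, hst.trans ht⟩
  have ht' : t ∈ Icc 0 L := ⟨hs.trans hst, ht⟩
  have hK0 : 0 ≤ K := (abs_nonneg _).trans (hK 0).1
  have hlip : ∀ x y, |S.V k (pos x) - S.V k (pos y)| ≤ K * |x - y| := fun x y =>
    (abs_sub_le_of_abs_deriv_le (S.hVdiff k) (fun x => (hK x).2) _ _).trans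
      (mul_le_mul_of_nonneg_left (abs_pos_sub_le x y) hK0)
  have hcont := continuous_of_abs_sub_le hlip
  have hS := P.tendsto_service hc hz hzs hs hst ht
  have hA : ∀ u ∈ Icc 0 L, Tendsto (fun j => Ar j (fun x => S.V k (pos x)) u) atTop
      (nhds (S.α * u * pair (S.V k) S.ν)) := by
    intro u hu
    rw [Metric.tendsto_atTop]
    intro ε hε
    have h0 : Tendsto (fun n => S.εseq n * (1 + K)) atTop (nhds 0) := by
      simpa using S.hεlim.mul_const (1 + K)
    obtain ⟨n, hn, hkn⟩ := ((h0.eventually_lt_const hε).and (eventually_ge_atTop k)).exists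
    obtain ⟨J, hJ⟩ := eventually_atTop.1 (P.tendsto_N.eventually_ge_atTop n)
    exact ⟨J, fun j hj => lt_of_le_of_lt
      ((P.pre j).lln n (hJ j hj) k hkn K (fun x => (hK x).1) u hu) hn⟩
  have hshift : Tendsto (fun j => pair (fun x => S.V k (pos (x - (σ j t - σ j s)))) (ζs j s)) atTop
      (nhds (pair (fun x => S.V k (pos (x - service ζ s t))) (ζ s))) := by
    have h1 := P.conv s hs' (fun x => S.V k (pos (x - service ζ s t)))
      (hcont.comp (continuous_sub_right _))
      ⟨K, fun x => (hK _).1⟩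
    have h2 : Tendsto (fun j => K * |(σ j t - σ j s) - service ζ s t| * S.M) atTop (nhds 0) := by
      have := (((hS.sub_const (service ζ s t)).abs.const_mul K).mul_const S.M)
      simpa using this
    have h3 : Tendsto (fun j => pair (fun x => S.V k (pos (x - (σ j t - σ j s)))) (ζs j s) -
        pair (fun x => S.V k (pos (x - service ζ s t))) (ζs j s)) atTop (nhds 0) := by
      refine squeeze_zero_norm (fun j => ?_) h2
      have := (P.pre j).fin s hs'
      refine (abs_pair_shift_sub_le hlip (fun x => (hK _).1) _ _).trans ?_
      gcongr
      exact (P.pre j).mass_le s hs'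
    simpa using h3.add h1
  have hlhs := (((P.conv t ht' _ hcont ⟨K, fun x => (hK _).1⟩).sub hshift).sub
    ((hA t ht').sub (hA s hs'))).abs
  rw [show S.α * (t - s) * pair (S.V k) S.ν =
    S.α * t * pair (S.V k) S.ν - S.α * s * pair (S.V k) S.ν by ring]
  refine le_of_tendsto hlhs ?_
  filter_upwards [hzs, P.tendsto_N.eventually_ge_atTop n] with j hj hjn
  refine ((P.pre j).step s t hs hst ht (fun x => S.V k (pos x)) K (fun x hx => ?_) hlip).trans ?_
  · rw [pos, max_eq_right hx, (S.hV0 k).1]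
  · have h1 : σ j t - σ j s ≤ c⁻¹ * (t - s) := by
      rw [(P.pre j).service s t hs hst ht]
      have h2 : ∫ _ in s..t, c⁻¹ = c⁻¹ * (t - s) := by
        rw [intervalIntegral.integral_const, smul_eq_mul, mul_comm]
      rw [← h2]
      refine intervalIntegral.integral_mono_on hst ((P.pre j).intervalIntegrable hs hst ht)
        (by simp) fun x hx => inv_anti₀ hc (hj x ⟨hs.trans hx.1, hx.2.trans ht⟩)
    have h2 := (P.pre j).arr n hjn s hs'
    have h3 := (P.pre j).arr_mono t (s + S.lseq n) ht'.1 (by linarith)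
    have h4 := (P.pre j).service_nonneg hs hst ht
    have h5 := (P.pre j).arr_mono s t hs hst
    gcongr
    linarith

/-- The local form of the fluid equation. -/
theorem LimitPath.exists_abs_step_le (P : LimitPath S L ζ N ζs σ e Ar) {c : ℝ} (hc : 0 < c)
    (hz : ∀ t ∈ Icc 0 L, c ≤ mass (ζ t)) (hzs : ∀ᶠ j in atTop, ∀ t ∈ Icc 0 L, c ≤ mass (ζs j t))
    {G : ℝ → ℝ} (hG : ContDiff ℝ 1 G) (hGc : HasCompactSupport G) (hG0 : ∀ x ≤ 0, G x = 0)
    {ε : ℝ} (hε : 0 < ε) :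
    ∃ δ, 0 < δ ∧ ∀ s t, 0 ≤ s → s ≤ t → t ≤ L → t - s ≤ δ →
      |pair G (ζ t) - pair (fun x => G (x - service ζ s t)) (ζ s) - S.α * (t - s) * pair G S.ν| ≤
        ε * (t - s) := by
  have hd0 : deriv G 0 = 0 := by
    have h1 := ((hG.differentiable one_ne_zero) 0).hasDerivAt.hasDerivWithinAt (s := Iic 0)
    have h2 : HasDerivWithinAt G 0 (Iic 0) 0 :=
      (hasDerivWithinAt_const 0 (Iic 0) (0 : ℝ)).congr (fun x hx => hG0 x hx) (hG0 0 le_rfl)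
    exact (uniqueDiffWithinAt_Iic (0 : ℝ)).eq_deriv _ h1 h2
  obtain ⟨φ, ⟨C, hC⟩, hφ, -⟩ := S.hVdense G hGc hG (hG0 0 le_rfl) hd0
  have hC0 : 0 ≤ C := (abs_nonneg _).trans (hC 0 0).1
  have h0 : Tendsto (fun n => C * c⁻¹ * (S.εseq n / 16)) atTop (nhds 0) := by
    simpa using (S.hεlim.div_const 16).const_mul (C * c⁻¹)
  obtain ⟨n, hn⟩ := (h0.eventually_lt_const hε).exists
  refine ⟨S.lseq n, S.hl n, fun s t hs hst ht hts => ?_⟩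
  have hs' : s ∈ Icc 0 L := ⟨hs, hst.trans ht⟩
  have ht' : t ∈ Icc 0 L := ⟨hs.trans hst, ht⟩
  have := P.fin s hs'
  have := P.fin t ht'
  have := S.hν
  have hGpos : ∀ x, G (pos x) = G x := fun x => by
    rcases le_total x 0 with h | h
    · rw [pos, max_eq_right h, hG0 0 le_rfl, hG0 x h]
    · rw [pos, max_eq_left h]
  have hV : ∀ i, Continuous (S.V (φ i)) := fun i => (S.hVdiff _).continuous
  have hcp := continuous_pos
  have h1 : Tendsto (fun i => pair (fun x => S.V (φ i) (pos x)) (ζ t)) atTop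
      (nhds (pair G (ζ t))) :=
    tendsto_pair_of_bounded (fun i => by have := hV i; fun_prop) (fun i x => (hC i _).1)
      fun x => by simpa only [hGpos] using hφ (pos x)
  have h2 : Tendsto (fun i => pair (fun x => S.V (φ i) (pos (x - service ζ s t))) (ζ s)) atTop
      (nhds (pair (fun x => G (x - service ζ s t)) (ζ s))) :=
    tendsto_pair_of_bounded (fun i => by have := hV i; fun_prop) (fun i x => (hC i _).1)
      fun x => by simpa only [hGpos] using hφ (pos (x - service ζ s t))
  have h3 : Tendsto (fun i => pair (S.V (φ i)) S.ν) atTop (nhds (pair G S.ν)) :=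
    tendsto_pair_of_bounded hV (fun i x => (hC i _).1) hφ
  refine (le_of_tendsto ((h1.sub h2).sub (h3.const_mul (S.α * (t - s)))).abs
    (Eventually.of_forall fun i => P.abs_step_le hc hz hzs (hC i) hs hst ht hts)).trans ?_
  have h4 : 0 ≤ t - s := sub_nonneg.2 hst
  nlinarith

end limitPath

end PSQ

namespace PSQ

theorem continuousOn_pair_shift {ξ : ℝ → Measure ℝ} {s : Set ℝ} {G a : ℝ → ℝ} {K C M : ℝ}
    (hfin : ∀ t ∈ s, IsFiniteMeasure (ξ t)) (hM : ∀ t ∈ s, mass (ξ t) ≤ M)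
    (hξ : WeaklyContinuousOn ξ s) (ha : ContinuousOn a s)
    (hG : ∀ x y, |G x - G y| ≤ K * |x - y|) (hC : ∀ x, |G x| ≤ C) :
    ContinuousOn (fun t => pair (fun x => G (x - a t)) (ξ t)) s := by
  have hc := continuous_of_abs_sub_le hG
  have hK : 0 ≤ K := by simpa using (abs_nonneg _).trans (hG 0 1)
  intro t ht
  have h1 : Tendsto (fun u => pair (fun x => G (x - a t)) (ξ u)) (nhdsWithin t s)
      (nhds (pair (fun x => G (x - a t)) (ξ t))) :=
    hξ _ (by fun_prop) ⟨C, fun x => hC _⟩ t ht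
  have h2 : Tendsto (fun u => K * |a u - a t| * M) (nhdsWithin t s) (nhds 0) := by
    have := (((ha t ht).tendsto.sub_const (a t)).abs.const_mul K).mul_const M
    simpa using this
  have h3 : Tendsto (fun u => pair (fun x => G (x - a u)) (ξ u) -
      pair (fun x => G (x - a t)) (ξ u)) (nhdsWithin t s) (nhds 0) := by
    refine squeeze_zero_norm' ?_ h2
    filter_upwards [self_mem_nhdsWithin] with u hu
    have := hfin u hu
    refine (abs_pair_shift_sub_le hG hC _ _).trans ?_
    gcongr
    exact hM u hu
  have := h3.add h1
  simp only [sub_add_cancel, zero_add] at this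
  exact this

section limitPath

variable {S : Setting} {L : ℝ} {ζ : ℝ → Measure ℝ} {N : ℕ → ℕ} {ζs : ℕ → ℝ → Measure ℝ}
  {σ e : ℕ → ℝ → ℝ} {Ar : ℕ → (ℝ → ℝ) → ℝ → ℝ}

theorem LimitPath.continuousOn_inv_mass (P : LimitPath S L ζ N ζs σ e Ar) {c : ℝ} (hc : 0 < c)
    (hz : ∀ t ∈ Icc 0 L, c ≤ mass (ζ t)) : ContinuousOn (fun t => (mass (ζ t))⁻¹) (Icc 0 L) :=
  P.continuousOn_mass.inv₀ fun t ht => (hc.trans_le (hz t ht)).ne'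

theorem LimitPath.intervalIntegrable_inv_mass (P : LimitPath S L ζ N ζs σ e Ar) {c : ℝ}
    (hc : 0 < c) (hz : ∀ t ∈ Icc 0 L, c ≤ mass (ζ t)) {s t : ℝ} (hs : s ∈ Icc 0 L)
    (ht : t ∈ Icc 0 L) : IntervalIntegrable (fun t => (mass (ζ t))⁻¹) volume s t :=
  ((P.continuousOn_inv_mass hc hz).mono (uIcc_subset_Icc hs ht)).intervalIntegrable

theorem LimitPath.service_eq_sub (P : LimitPath S L ζ N ζs σ e Ar) {c : ℝ} (hc : 0 < c)
    (hz : ∀ t ∈ Icc 0 L, c ≤ mass (ζ t)) {s t : ℝ} (hs : s ∈ Icc 0 L)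
    (ht : t ∈ Icc 0 L) : service ζ s t = service ζ 0 t - service ζ 0 s := by
  have h0 : (0 : ℝ) ∈ Icc 0 L := ⟨le_rfl, hs.1.trans hs.2⟩
  exact (intervalIntegral.integral_interval_sub_left (P.intervalIntegrable_inv_mass hc hz h0 ht)
    (P.intervalIntegrable_inv_mass hc hz h0 hs)).symm

theorem service_nonneg {s t : ℝ} (hst : s ≤ t) : 0 ≤ service ζ s t :=
  intervalIntegral.integral_nonneg hst fun _ _ => inv_nonneg.2 (mass_nonneg _)

theorem LimitPath.continuousOn_service (P : LimitPath S L ζ N ζs σ e Ar) (hL : 0 ≤ L) {c : ℝ}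
    (hc : 0 < c) (hz : ∀ t ∈ Icc 0 L, c ≤ mass (ζ t)) :
    ContinuousOn (fun t => service ζ 0 t) (Icc 0 L) := by
  have := intervalIntegral.continuousOn_primitive_interval (f := fun t => (mass (ζ t))⁻¹)
    (μ := volume) (a := 0) (b := L) ?_
  · rwa [uIcc_of_le hL] at this
  · rw [uIcc_of_le hL]
    exact (P.continuousOn_inv_mass hc hz).integrableOn_Icc

/-- The mild form of the fluid equation. -/
theorem LimitPath.pair_eq (P : LimitPath S L ζ N ζs σ e Ar) {c : ℝ} (hc : 0 < c)
    (hz : ∀ t ∈ Icc 0 L, c ≤ mass (ζ t)) (hzs : ∀ᶠ j in atTop, ∀ t ∈ Icc 0 L, c ≤ mass (ζs j t))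
    {G : ℝ → ℝ} (hG : ContDiff ℝ 1 G) (hGc : HasCompactSupport G) (hG0 : ∀ x ≤ 0, G x = 0)
    {t : ℝ} (ht : t ∈ Icc 0 L) :
    IntervalIntegrable
      (fun s => pair (fun x => G (x - (service ζ 0 t - service ζ 0 s))) S.ν) volume 0 t ∧
    pair G (ζ t) = pair (fun x => G (x - service ζ 0 t)) (ζ 0) +
      ∫ s in 0..t, S.α * pair (fun x => G (x - (service ζ 0 t - service ζ 0 s))) S.ν := by
  have hL : 0 ≤ L := ht.1.trans ht.2
  have := S.hν
  obtain ⟨K, hK⟩ := hGc.deriv.exists_bound_of_continuous (hG.continuous_deriv_one)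
  obtain ⟨C, hC⟩ := hGc.exists_bound_of_continuous hG.continuous
  have hlip := abs_sub_le_of_abs_deriv_le hG hK
  set A := fun s => service ζ 0 s with hA
  have hsub : Icc 0 t ⊆ Icc 0 L := Icc_subset_Icc le_rfl ht.2
  have hAc : ContinuousOn (fun s => A t - A s) (Icc 0 t) :=
    continuousOn_const.sub ((P.continuousOn_service hL hc hz).mono hsub)
  have hΦ : ContinuousOn (fun s => pair (fun x => G (x - (A t - A s))) (ζ s)) (Icc 0 t) :=
    continuousOn_pair_shift (fun s hs => P.fin s (hsub hs)) (fun s hs => P.mass_le (hsub hs))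
      (fun f hf hb => (P.wcont f hf hb).mono hsub) hAc hlip hC
  have hN : ContinuousOn (fun s => pair (fun x => G (x - (A t - A s))) S.ν) (Icc 0 t) :=
    continuousOn_pair_shift (ξ := fun _ => S.ν) (fun _ _ => inferInstance) (fun _ _ => le_rfl)
      (fun f hf hb => continuousOn_const) hAc hlip hC
  have hrefl : MapsTo (fun τ => t - τ) (Icc 0 t) (Icc 0 t) := fun τ hτ =>
    ⟨by linarith [hτ.2], by linarith [hτ.1]⟩
  have hNi : IntervalIntegrable (fun s => pair (fun x => G (x - (A t - A s))) S.ν) volume 0 t := by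
    rw [← uIcc_of_le ht.1] at hN
    exact hN.intervalIntegrable
  refine ⟨hNi, ?_⟩
  have hftc := intervalIntegral.integral_eq_sub_of_hasDeriv_right_of_le ht.1
    (f := fun τ => pair (fun x => G (x - (A t - A (t - τ)))) (ζ (t - τ)))
    (f' := fun τ => -(S.α * pair (fun x => G (x - (A t - A (t - τ)))) S.ν))
    (hΦ.comp (by fun_prop) hrefl) (fun τ hτ => ?_) ?_
  · have h1 := intervalIntegral.integral_comp_sub_left (a := 0) (b := t)
      (fun s => -(S.α * pair (fun x => G (x - (A t - A s))) S.ν)) t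
    have hA0 : A 0 = 0 := intervalIntegral.integral_same
    rw [hftc] at h1
    simp only [sub_self, sub_zero, hA0, intervalIntegral.integral_neg] at h1
    linarith
  · have hs : t - τ ∈ Icc 0 L := hsub (hrefl (Ioo_subset_Icc_self hτ))
    set a := A t - A (t - τ) with ha
    have ha0 : 0 ≤ a := by
      rw [ha, ← P.service_eq_sub hc hz hs ht]
      exact service_nonneg (by linarith [hτ.1])
    rw [hasDerivWithinAt_iff_isLittleO, Asymptotics.isLittleO_iff]
    intro ε hε
    obtain ⟨δ, hδ, hstep⟩ := P.exists_abs_step_le hc hz hzs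
      (G := fun x => G (x - a)) (hG.comp (contDiff_id.sub contDiff_const))
      (hGc.comp_homeomorph (Homeomorph.subRight a)) (fun x hx => hG0 _ (by linarith)) hε
    have hmem : Ioo τ (min t (τ + δ)) ∈ nhdsWithin τ (Ioi τ) :=
      Ioo_mem_nhdsGT (lt_min hτ.2 (by linarith))
    filter_upwards [hmem] with τ' hτ'
    have h2 := (lt_min_iff.1 hτ'.2)
    have hs' : t - τ' ∈ Icc 0 L := ⟨by linarith, by linarith [hs.2, hτ'.1]⟩
    have h3 := hstep (t - τ') (t - τ) hs'.1 (by linarith [hτ'.1]) hs.2 (by linarith)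
    rw [P.service_eq_sub hc hz hs' hs] at h3
    have h4 : ∀ x : ℝ, x - (service ζ 0 (t - τ) - service ζ 0 (t - τ')) - a =
        x - (A t - A (t - τ')) := fun x => by rw [ha]; ring
    simp only [h4] at h3
    rw [Real.norm_eq_abs, Real.norm_eq_abs, abs_of_pos (sub_pos.2 hτ'.1), ← abs_neg]
    convert h3 using 2
    · rw [smul_eq_mul]; ring
    · ring
  · have h1 := (hNi.symm.comp_sub_left t).const_mul (-S.α)
    simpa only [sub_self, sub_zero, neg_mul] using h1

/-- A continuously differentiable approximation of the indicator of `(x, ∞)`. -/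
noncomputable def smoothTail (x : ℝ) (n : ℕ) (y : ℝ) : ℝ :=
  Real.smoothTransition (n * (y - x)) * Real.smoothTransition (n - y)

theorem contDiff_smoothTail (x : ℝ) (n : ℕ) : ContDiff ℝ 1 (smoothTail x n) :=
  (Real.smoothTransition.contDiff.comp (by fun_prop)).mul
    (Real.smoothTransition.contDiff.comp (by fun_prop))

theorem abs_smoothTail_le (x : ℝ) (n : ℕ) (y : ℝ) : |smoothTail x n y| ≤ 1 := by
  rw [smoothTail, abs_of_nonneg (mul_nonneg (Real.smoothTransition.nonneg _)
    (Real.smoothTransition.nonneg _))]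
  exact mul_le_one₀ (Real.smoothTransition.le_one _) (Real.smoothTransition.nonneg _)
    (Real.smoothTransition.le_one _)

theorem smoothTail_of_le {x y : ℝ} (n : ℕ) (h : y ≤ x) : smoothTail x n y = 0 := by
  rw [smoothTail, Real.smoothTransition.zero_of_nonpos, zero_mul]
  exact mul_nonpos_of_nonneg_of_nonpos (Nat.cast_nonneg n) (by linarith)

theorem hasCompactSupport_smoothTail (x : ℝ) (n : ℕ) : HasCompactSupport (smoothTail x n) := by
  refine HasCompactSupport.of_support_subset_isCompact (isCompact_Icc (a := x) (b := (n : ℝ))) ?_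
  intro y hy
  by_contra h
  refine hy ?_
  rw [mem_Icc, not_and_or, not_le, not_le] at h
  rcases h with h | h
  · exact smoothTail_of_le n h.le
  · rw [smoothTail, Real.smoothTransition.zero_of_nonpos (x := n - y) (by linarith), mul_zero]

theorem tendsto_smoothTail (x y : ℝ) :
    Tendsto (fun n => smoothTail x n y) atTop (nhds ((Ioi x).indicator (fun _ => 1) y)) := by
  by_cases hy : y ∈ Ioi x
  · rw [indicator_of_mem hy]
    refine tendsto_const_nhds.congr' ?_
    have hpos : 0 < y - x := sub_pos.2 hy
    filter_upwards [eventually_ge_atTop ⌈1 / (y - x)⌉₊, eventually_ge_atTop ⌈1 + y⌉₊] with n h1 h2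
    rw [Nat.ceil_le, div_le_iff₀ hpos] at h1
    rw [Nat.ceil_le] at h2
    rw [smoothTail, Real.smoothTransition.one_of_one_le h1,
      Real.smoothTransition.one_of_one_le (by linarith), mul_one]
  · rw [indicator_of_notMem hy]
    simp only [smoothTail_of_le _ (not_lt.1 hy)]
    exact tendsto_const_nhds

theorem tendsto_pair_smoothTail (ξ : Measure ℝ) [IsFiniteMeasure ξ] (x a : ℝ) :
    Tendsto (fun n => pair (fun y => smoothTail x n (y - a)) ξ) atTop
      (nhds (ξ.real (Ioi (x + a)))) := by
  have h1 : ξ.real (Ioi (x + a)) = pair (fun y => (Ioi x).indicator (fun _ => 1) (y - a)) ξ := by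
    rw [← integral_indicator_one measurableSet_Ioi, pair]
    congr 1 with y
    simp [indicator_apply, lt_sub_iff_add_lt]
  rw [h1]
  exact tendsto_pair_of_bounded (f := fun n y => smoothTail x n (y - a)) (C := 1)
    (fun n => (contDiff_smoothTail x n).continuous.comp (continuous_sub_right a))
    (fun n y => abs_smoothTail_le _ _ _) fun y => tendsto_smoothTail x (y - a)

/-- The fluid equation for the tails. -/
theorem LimitPath.real_Ioi_eq (P : LimitPath S L ζ N ζs σ e Ar) {c : ℝ} (hc : 0 < c)
    (hz : ∀ t ∈ Icc 0 L, c ≤ mass (ζ t)) (hzs : ∀ᶠ j in atTop, ∀ t ∈ Icc 0 L, c ≤ mass (ζs j t))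
    {t x : ℝ} (ht : t ∈ Icc 0 L) (hx : 0 ≤ x) :
    (ζ t).real (Ioi x) = (ζ 0).real (Ioi (x + service ζ 0 t)) +
      ∫ s in 0..t, S.α * S.ν.real (Ioi (x + (service ζ 0 t - service ζ 0 s))) := by
  have := S.hν
  have := P.fin t ht
  have := P.fin 0 ⟨le_rfl, ht.1.trans ht.2⟩
  have hm := fun n => P.pair_eq hc hz hzs (contDiff_smoothTail x n)
    (hasCompactSupport_smoothTail x n) (fun y hy => smoothTail_of_le n (hy.trans hx)) ht
  have h1 : Tendsto (fun n => pair (smoothTail x n) (ζ t)) atTop (nhds ((ζ t).real (Ioi x))) := by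
    simpa using tendsto_pair_smoothTail (ζ t) x 0
  refine tendsto_nhds_unique h1 ?_
  simp only [fun n => (hm n).2]
  refine (tendsto_pair_smoothTail (ζ 0) x _).add ?_
  refine intervalIntegral.tendsto_integral_filter_of_dominated_convergence (fun _ => S.α)
    (Eventually.of_forall fun n => ?_) (Eventually.of_forall fun n => ae_of_all _ fun s _ => ?_)
    (by simp) (ae_of_all _ fun s _ => (tendsto_pair_smoothTail S.ν x _).const_mul S.α)
  · have := ((hm n).1.const_mul S.α).1.aestronglyMeasurable
    rwa [uIoc_of_le ht.1]
  · rw [norm_mul, Real.norm_of_nonneg S.hα.le]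
    refine mul_le_of_le_one_right S.hα.le ?_
    have h2 := norm_integral_le_of_norm_le_const (μ := S.ν) (C := 1)
      (f := fun y => smoothTail x n (y - (service ζ 0 t - service ζ 0 s)))
      (ae_of_all _ fun y => abs_smoothTail_le _ _ _)
    simpa [pair] using h2

end limitPath

end PSQ

namespace PSQ

theorem antitone_real_Ioi (ξ : Measure ℝ) [IsFiniteMeasure ξ] :
    Antitone fun x => ξ.real (Ioi x) := fun _ _ h => measureReal_mono (Ioi_subset_Ioi h)

theorem integrableOn_real_Ioi {ξ : Measure ℝ} [IsFiniteMeasure ξ]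
    (hi : Integrable (fun x : ℝ => x) ξ) : IntegrableOn (fun x => ξ.real (Ioi x)) (Ioi 0) := by
  have hi' : Integrable (fun x : ℝ => max x 0) ξ := hi.pos_part
  have h1 := lintegral_eq_lintegral_meas_lt ξ (f := fun x : ℝ => max x 0)
    (ae_of_all _ fun x => le_max_right _ _) hi'.aemeasurable
  refine ⟨(antitone_real_Ioi ξ).measurable.aestronglyMeasurable, ?_⟩
  rw [hasFiniteIntegral_iff_ofReal (ae_of_all _ fun x => measureReal_nonneg)]
  refine lt_of_le_of_lt (le_of_eq ?_) hi'.lintegral_lt_top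
  rw [h1]
  refine setLIntegral_congr_fun measurableSet_Ioi fun t ht => ?_
  rw [ofReal_measureReal]
  congr 1 with a
  simp [(mem_Ioi.1 ht).not_gt]

theorem integral_real_Ioi {ξ : Measure ℝ} [IsFiniteMeasure ξ]
    (hi : Integrable (fun x : ℝ => x) ξ) (b : ℝ) :
    ∫ x in Ioi b, ξ.real (Ioi x) = ∫ x, max (x - b) 0 ∂ξ := by
  have hi' : Integrable (fun x : ℝ => max (x - b) 0) ξ := (hi.sub (integrable_const b)).pos_part
  rw [hi'.integral_eq_integral_meas_lt (ae_of_all _ fun x => le_max_right _ _)]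
  have := setIntegral_Ioi_comp_add (fun x => ξ.real (Ioi x)) b 0
  rw [add_zero] at this
  rw [← this]
  refine setIntegral_congr_fun measurableSet_Ioi fun t ht => ?_
  congr 1 with a
  simp [(mem_Ioi.1 ht).not_gt, lt_sub_iff_add_lt, add_comm]

theorem pair_id_eq_integral_real_Ioi {ξ : Measure ℝ} [IsFiniteMeasure ξ] (h0 : ξ (Iio 0) = 0)
    (hi : Integrable (fun x : ℝ => x) ξ) : pair id ξ = ∫ x in Ioi 0, ξ.real (Ioi x) := by
  rw [integral_real_Ioi hi, pair]
  refine integral_congr_ae ?_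
  filter_upwards [ae_nonneg_of_Iio h0] with x hx
  rw [sub_zero, max_eq_left hx, id]

/-- The renewal kernel `α ν((x, ∞))`, `x ≥ 0`. -/
noncomputable def Setting.kernel (S : Setting) : ℝ → ℝ :=
  (Ici 0).indicator fun x => S.α * S.ν.real (Ioi x)

theorem Setting.renewalKernel (S : Setting) : RenewalKernel S.kernel S.α := by
  have := S.hν
  have hanti := antitone_real_Ioi S.ν
  have hEq : S.kernel =ᵐ[volume] (Ioi 0).indicator fun x => S.α * S.ν.real (Ioi x) :=
    indicator_ae_eq_of_ae_eq_set Ioi_ae_eq_Ici.symm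
  have hi := integrableOn_real_Ioi S.hνint
  refine ⟨(hanti.measurable.const_mul _).indicator measurableSet_Ici, fun x =>
    indicator_nonneg (fun x _ => mul_nonneg S.hα.le measureReal_nonneg) x,
    fun x hx => indicator_of_notMem (by simpa using hx) _, fun x hx y hy h => ?_, fun x => ?_,
    ((integrable_indicator_iff measurableSet_Ioi).2 (hi.const_mul S.α)).congr hEq.symm, ?_⟩
  · rw [kernel, indicator_of_mem hx, indicator_of_mem hy]
    exact mul_le_mul_of_nonneg_left (hanti h) S.hα.le
  · refine indicator_le' (fun x _ => ?_) (fun x _ => S.hα.le) x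
    exact mul_le_of_le_one_right S.hα.le measureReal_le_one
  · rw [integral_congr_ae hEq, integral_indicator measurableSet_Ioi, integral_const_mul,
      ← pair_id_eq_integral_real_Ioi S.hνsupp S.hνint]
    exact S.hcrit

/-- Change of time along the inverse of `t ↦ ∫₀ᵗ z⁻¹`. -/
theorem exists_timeChange {z : ℝ → ℝ} (hz : Continuous z) {c M : ℝ} (hc : 0 < c)
    (hcz : ∀ t, c ≤ z t) (hzM : ∀ t, z t ≤ M) :
    ∃ σ : ℝ ≃o ℝ, (∀ t, σ t = ∫ s in 0..t, (z s)⁻¹) ∧ ∀ t, 0 ≤ t → ∀ F : ℝ → ℝ,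
      ∫ v in 0..σ t, F v * z (σ.symm v) = ∫ s in 0..t, F (σ s) := by
  have hz0 : ∀ t, 0 < z t := fun t => hc.trans_le (hcz t)
  have hM : 0 < M := (hz0 0).trans_le (hzM 0)
  have hzi : Continuous fun t => (z t)⁻¹ := hz.inv₀ fun t => (hz0 t).ne'
  set f : ℝ → ℝ := fun t => ∫ s in 0..t, (z s)⁻¹ with hf
  have hd : ∀ t, HasDerivAt f (z t)⁻¹ t := fun t => hzi.integral_hasStrictDerivAt 0 t |>.hasDerivAt
  have hmono : StrictMono f := strictMono_of_deriv_pos fun t => by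
    rw [(hd t).deriv]; exact inv_pos.2 (hz0 t)
  have hcont : Continuous f := continuous_iff_continuousAt.2 fun t => (hd t).continuousAt
  have hinc : ∀ s t, s ≤ t → M⁻¹ * (t - s) ≤ f t - f s := by
    intro s t hst
    refine Convex.mul_sub_le_image_sub_of_le_deriv convex_univ hcont.continuousOn
      (fun t _ => (hd t).differentiableAt.differentiableWithinAt) (fun t _ => ?_) s (mem_univ s) t
      (mem_univ t) hst
    rw [(hd t).deriv]
    exact inv_anti₀ (hz0 t) (hzM t)
  have hf0 : f 0 = 0 := intervalIntegral.integral_same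
  have hsurj : Function.Surjective f := by
    refine hcont.surjective ?_ ?_
    · refine tendsto_atTop_mono' _ ?_ (tendsto_id.const_mul_atTop (inv_pos.2 hM))
      filter_upwards [eventually_ge_atTop 0] with t ht
      have := hinc 0 t ht
      rwa [hf0, sub_zero, sub_zero] at this
    · refine tendsto_atBot_mono' _ ?_ (tendsto_id.const_mul_atBot (inv_pos.2 hM))
      filter_upwards [eventually_le_atBot 0] with t ht
      have := hinc t 0 ht
      rw [hf0] at this
      simp only [id]
      linarith
  let σ := hmono.orderIsoOfSurjective f hsurj
  have hσ : ∀ t, σ t = f t := fun t => rfl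
  refine ⟨σ, hσ, fun t ht F => ?_⟩
  have himg : f '' Icc 0 t = Icc 0 (σ t) := by
    have := σ.image_Icc 0 t
    rwa [show σ 0 = 0 from hf0] at this
  have h0t : 0 ≤ σ t := by rw [hσ, ← hf0]; exact hmono.monotone ht
  rw [intervalIntegral.integral_of_le h0t, intervalIntegral.integral_of_le ht,
    ← integral_Icc_eq_integral_Ioc, ← integral_Icc_eq_integral_Ioc, ← himg,
    integral_image_eq_integral_abs_deriv_smul measurableSet_Icc
      (fun x _ => (hd x).hasDerivWithinAt) hmono.injective.injOn]
  refine integral_congr_ae (ae_of_all _ fun s => ?_)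
  have h1 : σ.symm (f s) = s := σ.symm_apply_apply s
  simp only
  rw [h1, abs_of_pos (inv_pos.2 (hz0 s)), hσ, smul_eq_mul]
  have := (hz0 s).ne'
  field_simp

end PSQ

namespace PSQ

variable {S : Setting} {L : ℝ} {ζ : ℝ → Measure ℝ} {N : ℕ → ℕ} {ζs : ℕ → ℝ → Measure ℝ}
  {σ e : ℕ → ℝ → ℝ} {Ar : ℕ → (ℝ → ℝ) → ℝ → ℝ}

theorem RenewalKernel.integral_profile {k : ℝ → ℝ} {α : ℝ} (K : RenewalKernel k α)
    (hkb : IntegrableOn (tailInt k) (Ioi 0)) {Z H : ℝ → ℝ} (hZ : Measurable Z) {M : ℝ}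
    (hZM : ∀ x, |Z x| ≤ M) (hH : IntegrableOn H (Ioi 0)) {u : ℝ} (hu : 0 ≤ u) :
    ∫ x in Ioi 0, profile k Z H u x =
      (∫ x in Ioi u, H x) + ∫ s in Ioi 0, tailInt k s * Z (u - s) := by
  have hkm := K.meas
  have hk : Integrable (fun q : ℝ × ℝ => k (q.1 + q.2))
      ((volume.restrict (Ioi 0)).prod (volume.restrict (Ioi 0))) := by
    rw [integrable_prod_iff' (by exact Measurable.aestronglyMeasurable (by fun_prop))]
    refine ⟨ae_of_all _ fun s => (K.int.comp_add_right s).integrableOn, hkb.congr ?_⟩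
    refine ae_of_all _ fun s => ?_
    simp only [Real.norm_of_nonneg (K.nonneg _)]
    rw [tailInt_eq_shift]
    simp only [add_comm]
  have hf : Integrable (fun q : ℝ × ℝ => k (q.1 + q.2) * Z (u - q.2))
      ((volume.restrict (Ioi 0)).prod (volume.restrict (Ioi 0))) :=
    hk.mul_bdd (c := M) (by exact Measurable.aestronglyMeasurable (by fun_prop))
      (ae_of_all _ fun q => hZM _)
  have hHu : IntegrableOn (fun x => H (u + x)) (Ioi 0) := by
    have h1 : IntegrableOn H (Ioi u) := hH.mono_set (Ioi_subset_Ioi hu)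
    have h2 := (integrable_indicator_iff measurableSet_Ioi).2 h1
    have h3 := h2.comp_add_left u
    rw [← integrable_indicator_iff measurableSet_Ioi]
    refine h3.congr (ae_of_all _ fun x => ?_)
    simp [indicator]
  simp only [profile]
  rw [integral_add hHu hf.integral_prod_left, setIntegral_Ioi_comp_add, add_zero,
    integral_integral_swap hf]
  congr 1
  refine integral_congr_ae (ae_of_all _ fun s => ?_)
  simp only
  rw [integral_mul_const, tailInt_eq_shift]
  simp only [add_comm]

theorem LimitPath.exists_renewalData (P : LimitPath S L ζ N ζs σ e Ar) (hL : 0 ≤ L)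
    (hw : 0 < pair id (ζ 0)) (hkb : IntegrableOn (tailInt S.kernel) (Ioi 0))
    (hχ : 0 < ∫ x in Ioi 0, tailInt S.kernel x) :
    ∃ (τ : ℝ → ℝ) (Z H : ℝ → ℝ),
      RenewalData S.kernel Z H S.M (pair id (ζ 0) / ∫ x in Ioi 0, tailInt S.kernel x) (τ L) ∧
      ∫ x in Ioi 0, H x ≤ S.M ∧ (∀ b, 0 < b → ∫ x in Ioi b, H x ≤ S.M * b ^ (-S.p)) ∧
      ∀ t ∈ Icc 0 L, t / S.M ≤ τ t ∧ τ t ≤ τ L ∧ mass (ζ t) = Z (τ t) ∧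
        ∀ x, 0 ≤ x → (ζ t).real (Ioi x) = profile S.kernel Z H (τ t) x := by
  have h0L : (0 : ℝ) ∈ Icc 0 L := ⟨le_rfl, hL⟩
  have hM := S.hM
  obtain ⟨c, hc, hz, hzs⟩ := P.exists_mass_ge hL hw
  set z : ℝ → ℝ := IccExtend hL (domRestrict (Icc 0 L) fun t => mass (ζ t)) with hzdef
  have hzc : Continuous z :=
    (continuousOn_iff_continuous_domRestrict.1 P.continuousOn_mass).Icc_extend'
  have hzt : ∀ t ∈ Icc 0 L, z t = mass (ζ t) := fun t ht => IccExtend_of_mem hL _ ht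
  have hcz : ∀ t, c ≤ z t := fun t => hz _ (projIcc 0 L hL t).2
  have hzM : ∀ t, z t ≤ S.M := fun t => P.mass_le (projIcc 0 L hL t).2
  obtain ⟨τ, hτ, hchange⟩ := exists_timeChange hzc hc hcz hzM
  have hτ0 : τ 0 = 0 := by rw [hτ, intervalIntegral.integral_same]
  have hτs : ∀ t ∈ Icc 0 L, τ t = service ζ 0 t := fun t ht => by
    rw [hτ, service]
    refine intervalIntegral.integral_congr fun s hs => ?_
    rw [uIcc_of_le ht.1] at hs
    simp only [hzt s ⟨hs.1, hs.2.trans ht.2⟩]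
  set Z : ℝ → ℝ := (Ici 0).indicator fun u => z (τ.symm u) with hZdef
  set H : ℝ → ℝ := fun x => (ζ 0).real (Ioi x) with hHdef
  have hZm : Measurable Z :=
    (hzc.comp τ.symm.continuous).measurable.indicator measurableSet_Ici
  have hZ0 : ∀ x, 0 ≤ Z x := indicator_nonneg fun x _ => hc.le.trans (hcz _)
  have hZM : ∀ x, Z x ≤ S.M := indicator_le' (fun x _ => hzM _) fun x _ => by linarith
  have hZabs : ∀ x, |Z x| ≤ S.M := fun x => by rw [abs_of_nonneg (hZ0 x)]; exact hZM x
  have hZneg : ∀ x < 0, Z x = 0 := fun x hx => indicator_of_notMem (by simpa using hx) _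
  have := P.fin 0 h0L
  have hi0 := (P.momentBound h0L).integrable_id S.hp
  have hHi : IntegrableOn H (Ioi 0) := integrableOn_real_Ioi hi0
  have hwH : pair id (ζ 0) = ∫ x in Ioi 0, H x := pair_id_eq_integral_real_Ioi (P.supp 0 h0L) hi0
  have hprof : ∀ t ∈ Icc 0 L, ∀ x, 0 ≤ x →
      (ζ t).real (Ioi x) = profile S.kernel Z H (τ t) x := by
    intro t ht x hx
    have hτt : 0 ≤ τ t := by rw [← hτ0]; exact τ.monotone ht.1
    rw [P.real_Ioi_eq hc hz hzs ht hx, profile, hHdef, ← hτs t ht, add_comm x (τ t)]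
    congr 1
    have e1 : ∫ s in Ioi 0, S.kernel (x + s) * Z (τ t - s) =
        ∫ s in Ioc 0 (τ t), S.kernel (x + s) * Z (τ t - s) := by
      refine setIntegral_eq_of_subset_of_forall_sdiff_eq_zero measurableSet_Ioi
        (fun s hs => hs.1) fun s hs => ?_
      rw [hZneg, mul_zero]
      have : ¬ s ≤ τ t := fun h => hs.2 ⟨hs.1, h⟩
      linarith
    rw [e1, ← intervalIntegral.integral_of_le hτt]
    have e2 := intervalIntegral.integral_comp_sub_left (a := 0) (b := τ t)
      (fun v => S.kernel (x + (τ t - v)) * Z v) (τ t)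
    simp only [sub_sub_cancel, sub_self, sub_zero] at e2
    rw [e2]
    have e3 : ∫ v in 0..τ t, S.kernel (x + (τ t - v)) * Z v =
        ∫ v in 0..τ t, S.kernel (x + (τ t - v)) * z (τ.symm v) := by
      refine intervalIntegral.integral_congr fun v hv => ?_
      rw [uIcc_of_le hτt] at hv
      simp only [hZdef, indicator_of_mem (mem_Ici.2 hv.1)]
    rw [e3, hchange t ht.1 fun v => S.kernel (x + (τ t - v))]
    refine intervalIntegral.integral_congr fun s hs => ?_
    rw [uIcc_of_le ht.1] at hs
    have hle : τ s ≤ τ t := τ.monotone hs.2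
    rw [Setting.kernel, indicator_of_mem (mem_Ici.2 (by linarith)),
      hτs s ⟨hs.1, hs.2.trans ht.2⟩]
  have hmassZ : ∀ t ∈ Icc 0 L, mass (ζ t) = Z (τ t) := fun t ht => by
    have hτt : 0 ≤ τ t := by rw [← hτ0]; exact τ.monotone ht.1
    rw [hZdef, indicator_of_mem (mem_Ici.2 hτt), τ.symm_apply_apply, hzt t ht]
  refine ⟨τ, Z, H, ⟨hZm, hZ0, hZM, hZneg, ?_, antitone_real_Ioi _, fun x => measureReal_nonneg,
    hHi, fun u hu => ?_, ?_⟩, hwH ▸ P.pair_id_le h0L, fun b hb => ?_, fun t ht =>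
    ⟨?_, τ.monotone ht.2, hmassZ t ht, hprof t ht⟩⟩
  · refine (hzc.comp τ.symm.continuous).continuousOn.congr fun u hu => ?_
    rw [hZdef, indicator_of_mem (mem_Ici.2 hu.1)]; rfl
  · have ht : τ.symm u ∈ Icc 0 L := by
      constructor
      · rw [← τ.symm_apply_apply 0, hτ0]; exact τ.symm.monotone hu.1
      · rw [← τ.symm_apply_apply L]; exact τ.symm.monotone hu.2
    have := P.fin _ ht
    rw [← S.renewalKernel.integral_profile hkb hZm hZabs hHi hu.1, ← hwH, ← P.pair_id_eq ht,
      pair_id_eq_integral_real_Ioi (P.supp _ ht) ((P.momentBound ht).integrable_id S.hp)]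
    refine setIntegral_congr_fun measurableSet_Ioi fun x hx => ?_
    rw [hprof _ ht x (le_of_lt hx), τ.apply_symm_apply]
  · rw [← hwH, div_mul_cancel₀ _ hχ.ne']
  · have h1 := (P.momentBound h0L).abs_pair_sub_trunc_le S.hp hb
    refine le_trans ?_ ((le_abs_self _).trans h1)
    have htr : Integrable (trunc b) (ζ 0) := by
      refine Integrable.of_bound (C := b) ?_ (ae_of_all _ fun x => ?_)
      · unfold trunc; exact Measurable.aestronglyMeasurable (by fun_prop)
      · rw [trunc, Real.norm_of_nonneg (le_min (le_max_right _ _) hb.le)]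
        exact min_le_right _ _
    rw [integral_real_Ioi hi0, pair, pair, ← integral_sub (f := id) hi0 htr]
    refine le_of_eq (integral_congr_ae ?_)
    filter_upwards [ae_nonneg_of_Iio (P.supp 0 h0L)] with x hx
    rw [trunc, max_eq_left hx, id]
    rcases le_total x b with h | h
    · rw [min_eq_left h, max_eq_right (by linarith), sub_self]
    · rw [min_eq_right h, max_eq_left (by linarith)]
  · rw [hτ]
    have : ∫ s in 0..t, S.M⁻¹ ≤ ∫ s in 0..t, (z s)⁻¹ := by
      refine intervalIntegral.integral_mono_on ht.1 (by simp)
        ((hzc.inv₀ fun s => (hc.trans_le (hcz s)).ne').intervalIntegrable _ _) fun s _ => ?_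
      exact inv_anti₀ (hc.trans_le (hcz s)) (hzM s)
    rw [intervalIntegral.integral_const, smul_eq_mul, sub_zero] at this
    rwa [div_eq_mul_inv]

end PSQ

namespace PSQ

theorem Setting.nuE_eq (S : Setting) :
    S.nuE = (volume.restrict (Ioi 0)).withDensity fun y => ENNReal.ofReal (S.kernel y) := by
  have := S.hν
  rw [nuE, nue, restrict_Ioi_eq_restrict_Ici]
  refine withDensity_congr_ae ((ae_restrict_mem measurableSet_Ici).mono fun y hy => ?_)
  have hint : ∫ x, x ∂S.ν = S.α⁻¹ := eq_inv_of_mul_eq_one_right S.hcrit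
  have hky : S.kernel y = S.α * S.ν.real (Ioi y) := indicator_of_mem hy _
  simp only
  rw [hint, hky, ENNReal.ofReal_mul S.hα.le, ofReal_measureReal,
    ENNReal.ofReal_inv_of_pos S.hα, inv_inv, mul_comm]

theorem Setting.nuE_Iio (S : Setting) : S.nuE (Iio 0) = 0 := by
  rw [S.nuE_eq]
  refine withDensity_absolutelyContinuous _ _ ?_
  rw [Measure.restrict_apply measurableSet_Iio, Iio_inter_Ioi, Ioo_self, measure_empty]

theorem Setting.nuE_Ioi (S : Setting) {x : ℝ} (hx : 0 ≤ x) :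
    S.nuE (Ioi x) = ENNReal.ofReal (tailInt S.kernel x) := by
  rw [S.nuE_eq, withDensity_apply _ measurableSet_Ioi, Measure.restrict_restrict measurableSet_Ioi,
    inter_eq_left.2 (Ioi_subset_Ioi hx), tailInt,
    ofReal_integral_eq_lintegral_ofReal S.renewalKernel.int.integrableOn
      (ae_of_all _ S.renewalKernel.nonneg)]

theorem Setting.nuE_univ (S : Setting) : S.nuE univ = 1 := by
  have h : S.nuE univ = S.nuE (Ioi 0) := by
    refine (measure_eq_measure_of_null_sdiff (subset_univ _) ?_).symm
    rw [S.nuE_eq]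
    refine withDensity_absolutelyContinuous _ _ ?_
    rw [Measure.restrict_apply' measurableSet_Ioi, sdiff_inter_self, measure_empty]
  rw [h, S.nuE_Ioi le_rfl, S.renewalKernel.tailInt_zero, ENNReal.ofReal_one]

theorem Setting.integrable_id_nuE (S : Setting) {q : ℝ} (hq : 2 ≤ q)
    (hmom : ∫⁻ x, ENNReal.ofReal (x ^ q) ∂S.ν < ⊤) : Integrable (fun x => x) S.nuE := by
  have := S.hν
  have hk := S.renewalKernel.meas
  refine ⟨measurable_id.aestronglyMeasurable, ?_⟩
  have h1 := lintegral_comp_eq_lintegral_meas_lt_mul S.ν (f := fun x => max x 0) (g := fun t => t)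
    (ae_of_all _ fun x => le_max_right _ _) (by fun_prop)
    (fun t _ => intervalIntegral.intervalIntegrable_id)
    ((ae_restrict_mem measurableSet_Ioi).mono fun t ht => le_of_lt ht)
  have h2 : ∫⁻ x, ENNReal.ofReal (∫ t in 0..max x 0, t) ∂S.ν < ⊤ := by
    have h3 : ∫⁻ x, 1 + ENNReal.ofReal (x ^ q) ∂S.ν < ⊤ := by
      rw [lintegral_add_left measurable_const]
      exact ENNReal.add_lt_top.2 ⟨by simp, hmom⟩
    refine lt_of_le_of_lt (lintegral_mono_ae ?_) h3
    filter_upwards [ae_nonneg_of_Iio S.hνsupp] with x hx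
    rw [integral_id, max_eq_left hx, ← ENNReal.ofReal_one,
      ← ENNReal.ofReal_add zero_le_one (Real.rpow_nonneg hx _)]
    refine ENNReal.ofReal_le_ofReal ?_
    rcases le_total x 1 with h | h
    · have := Real.rpow_nonneg hx q
      nlinarith
    · have h4 : x ^ (2 : ℝ) ≤ x ^ q := Real.rpow_le_rpow_of_exponent_le h hq
      rw [Real.rpow_two] at h4
      nlinarith
  rw [h1] at h2
  rw [hasFiniteIntegral_iff_enorm, S.nuE_eq,
    lintegral_withDensity_eq_lintegral_mul _ (by fun_prop) (by fun_prop)]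
  have h5 := ENNReal.mul_lt_top (ENNReal.ofReal_lt_top (r := S.α)) h2
  rw [← lintegral_const_mul' _ _ ENNReal.ofReal_ne_top] at h5
  refine lt_of_le_of_lt (le_of_eq (setLIntegral_congr_fun measurableSet_Ioi fun t ht => ?_)) h5
  have ht' : 0 < t := ht
  have hset : {a : ℝ | t < max a 0} = Ioi t := by
    ext a; simp [ht'.not_gt]
  simp only [Pi.mul_apply]
  rw [hset, kernel, indicator_of_mem (mem_Ici.2 ht'.le), ENNReal.ofReal_mul S.hα.le,
    ofReal_measureReal, Real.enorm_of_nonneg ht'.le, mul_assoc]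

theorem Setting.kernel_pos (S : Setting) : ∃ δ, 0 < δ ∧ 0 < S.kernel δ := by
  by_contra! h
  have K := S.renewalKernel
  have h1 := K.tailInt_zero
  rw [tailInt, setIntegral_eq_zero_of_forall_eq_zero (t := Ioi 0)
    fun x hx => le_antisymm (h x hx) (K.nonneg x)] at h1
  exact zero_ne_one h1

/-- The excess life distribution is a probability measure. -/
theorem Setting.isProbabilityMeasure_nuE (S : Setting) : IsProbabilityMeasure S.nuE := ⟨S.nuE_univ⟩

theorem Setting.nuE_real_Ioi (S : Setting) {x : ℝ} (hx : 0 ≤ x) :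
    S.nuE.real (Ioi x) = tailInt S.kernel x := by
  rw [measureReal_def, S.nuE_Ioi hx, ENNReal.toReal_ofReal (S.renewalKernel.tailInt_nonneg x)]

theorem Setting.integrableOn_tailInt (S : Setting) (hi : Integrable (fun x => x) S.nuE) :
    IntegrableOn (tailInt S.kernel) (Ioi 0) := by
  have := S.isProbabilityMeasure_nuE
  exact (integrableOn_real_Ioi hi).congr_fun (fun x hx => S.nuE_real_Ioi (le_of_lt hx))
    measurableSet_Ioi

theorem Setting.integral_tailInt (S : Setting) (hi : Integrable (fun x => x) S.nuE) :
    ∫ x in Ioi 0, tailInt S.kernel x = ∫ x, x ∂S.nuE := by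
  have := S.isProbabilityMeasure_nuE
  refine Eq.trans ?_ (pair_id_eq_integral_real_Ioi S.nuE_Iio hi).symm
  exact setIntegral_congr_fun measurableSet_Ioi fun x hx => (S.nuE_real_Ioi (le_of_lt hx)).symm

theorem Setting.integral_nuE_pos (S : Setting) (hi : Integrable (fun x => x) S.nuE) :
    0 < ∫ x, x ∂S.nuE := by
  have := S.isProbabilityMeasure_nuE
  rw [integral_pos_iff_support_of_nonneg_ae (ae_nonneg_of_Iio S.nuE_Iio) hi]
  refine lt_of_lt_of_le ?_ (measure_mono (s := Ioi 0) fun x (hx : 0 < x) => hx.ne')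
  rw [S.nuE_Ioi le_rfl, S.renewalKernel.tailInt_zero]
  simp

end PSQ

namespace PSQ

theorem pair_eq_integral_deriv {ξ : Measure ℝ} [IsFiniteMeasure ξ] (h0 : ξ (Iio 0) = 0)
    (hi : Integrable (fun x : ℝ => x) ξ) {f : ℝ → ℝ} (hf : ContDiff ℝ 1 f) {C : ℝ}
    (hC : ∀ x, |deriv f x| ≤ C) (hb : Integrable f ξ) :
    pair f ξ = f 0 * mass ξ + ∫ x in Ioi 0, deriv f x * ξ.real (Ioi x) := by
  have hdc : Continuous (deriv f) := hf.continuous_deriv le_rfl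
  have hmeas : MeasurableSet {q : ℝ × ℝ | q.1 < q.2} :=
    measurableSet_lt measurable_fst measurable_snd
  have h1 : Integrable ({q : ℝ × ℝ | q.1 < q.2}.indicator fun _ => (1 : ℝ))
      ((volume.restrict (Ioi 0)).prod ξ) := by
    rw [integrable_prod_iff ((measurable_const.indicator hmeas).aestronglyMeasurable)]
    refine ⟨ae_of_all _ fun x => ?_, (integrableOn_real_Ioi hi).congr (ae_of_all _ fun x => ?_)⟩
    · exact (integrable_const (1 : ℝ)).indicator (s := Ioi x) measurableSet_Ioi
    · have : ∀ y, ‖({q : ℝ × ℝ | q.1 < q.2}.indicator fun _ => (1 : ℝ)) (x, y)‖ =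
          (Ioi x).indicator 1 y := fun y => by
        by_cases h : x < y <;> simp [h]
      simp only [this]
      rw [integral_indicator_one measurableSet_Ioi]
  have h2 : Integrable (fun q : ℝ × ℝ => ({q : ℝ × ℝ | q.1 < q.2}.indicator fun _ => (1 : ℝ)) q *
      deriv f q.1) ((volume.restrict (Ioi 0)).prod ξ) :=
    h1.mul_bdd (c := C) (by exact Continuous.aestronglyMeasurable (by fun_prop))
      (ae_of_all _ fun q => hC _)
  have h3 := integral_integral_swap (f := fun x y =>
    ({q : ℝ × ℝ | q.1 < q.2}.indicator fun _ => (1 : ℝ)) (x, y) * deriv f x) h2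
  have h4 : ∀ x, ∫ y, ({q : ℝ × ℝ | q.1 < q.2}.indicator fun _ => (1 : ℝ)) (x, y) * deriv f x ∂ξ =
      deriv f x * ξ.real (Ioi x) := fun x => by
    rw [integral_mul_const, mul_comm, ← integral_indicator_one measurableSet_Ioi]
    rfl
  simp only [h4] at h3
  rw [h3]
  have h5 : f 0 * mass ξ = ∫ y, f 0 ∂ξ := by
    rw [integral_const, smul_eq_mul, mul_comm]; rfl
  have h6 : ∫ y, (∫ x in Ioi 0, ({q : ℝ × ℝ | q.1 < q.2}.indicator fun _ => (1 : ℝ)) (x, y) *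
      deriv f x) ∂ξ = ∫ y, f y - f 0 ∂ξ := by
    refine integral_congr_ae ?_
    filter_upwards [ae_nonneg_of_Iio h0] with y hy
    rw [← intervalIntegral.integral_deriv_eq_sub
      (fun x _ => (hf.differentiable one_ne_zero) x) (hdc.intervalIntegrable _ _),
      intervalIntegral.integral_of_le hy, integral_Ioc_eq_integral_Ioo,
      ← Ioi_inter_Iio, ← setIntegral_indicator measurableSet_Iio]
    refine integral_congr_ae (ae_of_all _ fun x => ?_)
    by_cases h : x < y <;> simp [h]
  rw [h6, integral_sub hb (integrable_const _), h5, pair]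
  ring

theorem abs_pair_sub_le_tails {ξ η : Measure ℝ} [IsFiniteMeasure ξ] [IsFiniteMeasure η]
    (hξ0 : ξ (Iio 0) = 0) (hη0 : η (Iio 0) = 0) (hξ : Integrable (fun x : ℝ => x) ξ)
    (hη : Integrable (fun x : ℝ => x) η) {f : ℝ → ℝ} (hf : ContDiff ℝ 1 f)
    (hf1 : ∀ x, |f x| ≤ 1) {C : ℝ} (hC : ∀ x, |deriv f x| ≤ C) :
    |pair f ξ - pair f η| ≤
      |mass ξ - mass η| + C * ∫ x in Ioi 0, |ξ.real (Ioi x) - η.real (Ioi x)| := by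
  have hdc : Continuous (deriv f) := hf.continuous_deriv le_rfl
  have htξ := integrableOn_real_Ioi hξ
  have htη := integrableOn_real_Ioi hη
  have hd := htξ.sub htη
  have hm : ∀ {g : ℝ → ℝ}, IntegrableOn g (Ioi 0) →
      IntegrableOn (fun x => deriv f x * g x) (Ioi 0) := fun hg =>
    hg.bdd_mul (c := C) hdc.aestronglyMeasurable (ae_of_all _ hC)
  rw [pair_eq_integral_deriv hξ0 hξ hf hC (integrable_of_continuous_bounded hf.continuous hf1),
    pair_eq_integral_deriv hη0 hη hf hC (integrable_of_continuous_bounded hf.continuous hf1),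
    show ∀ a b c d : ℝ, f 0 * a + b - (f 0 * c + d) = f 0 * (a - c) + (b - d) by intros; ring,
    ← integral_sub (hm htξ) (hm htη)]
  refine (abs_add_le _ _).trans (add_le_add ?_ ?_)
  · rw [abs_mul]
    exact mul_le_of_le_one_left (abs_nonneg _) (hf1 0)
  · rw [← integral_const_mul, ← Real.norm_eq_abs]
    refine norm_integral_le_of_norm_le (hd.abs.const_mul C) (ae_of_all _ fun x => ?_)
    rw [← mul_sub, norm_mul]
    exact mul_le_mul_of_nonneg_right (hC x) (abs_nonneg _)

/-- Closeness of masses and of tails in `L¹` controls the metric. -/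
theorem MetricFamilies.exists_dmet_le {g h : ℕ → ℝ → ℝ} (hgh : MetricFamilies g h) {ε : ℝ}
    (hε : 0 < ε) : ∃ η, 0 < η ∧ ∀ ξ₁ ξ₂ : Measure ℝ, IsFiniteMeasure ξ₁ → IsFiniteMeasure ξ₂ →
      ξ₁ (Iio 0) = 0 → ξ₂ (Iio 0) = 0 → Integrable (fun x : ℝ => x) ξ₁ →
      Integrable (fun x : ℝ => x) ξ₂ → |mass ξ₁ - mass ξ₂| ≤ η →
      ∫ x in Ioi 0, |ξ₁.real (Ioi x) - ξ₂.real (Ioi x)| ≤ η → dmet g h ξ₁ ξ₂ ≤ ε := by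
  obtain ⟨hg, hh, -⟩ := hgh
  choose C hC using fun k => (hg k).2.2
  have hC0 : ∀ k, 0 ≤ C k := fun k => (abs_nonneg _).trans (hC k 0)
  have hlim : Tendsto (fun η : ℝ => (∑' k : ℕ, (2 : ℝ)⁻¹ ^ (k + 1) * min |(1 + C k) * η| 1) + 3 * η)
      (nhds 0) (nhds ((∑' k : ℕ, (0 : ℝ)) + 3 * 0)) := by
    refine Tendsto.add (tendsto_tsum_of_dominated_convergence
      (bound := fun k : ℕ => (2 : ℝ)⁻¹ ^ (k + 1)) ?_ (fun k => ?_) ?_) (tendsto_id.const_mul 3)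
    · exact (summable_nat_add_iff 1).2 (summable_geometric_of_lt_one (by norm_num) (by norm_num))
    · have : Continuous fun η : ℝ => (2 : ℝ)⁻¹ ^ (k + 1) * min |(1 + C k) * η| 1 := by fun_prop
      simpa using this.tendsto 0
    · refine Eventually.of_forall fun η k => ?_
      rw [Real.norm_of_nonneg (by positivity)]
      exact mul_le_of_le_one_right (by positivity) (min_le_right _ _)
  rw [tsum_zero, mul_zero, add_zero] at hlim
  obtain ⟨η, hηε, hη⟩ := (((hlim.mono_left nhdsWithin_le_nhds).eventually_lt_const hε).and
    (self_mem_nhdsWithin : Ioi (0 : ℝ) ∈ nhdsWithin 0 (Ioi 0))).exists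
  refine ⟨η, hη, fun ξ₁ ξ₂ _ _ h1 h2 hi1 hi2 hm ht => le_trans ?_ hηε.le⟩
  have key : ∀ {f : ℝ → ℝ} {D : ℝ}, ContDiff ℝ 1 f → (∀ x, 0 ≤ f x ∧ f x ≤ 1) → 0 ≤ D →
      (∀ x, |deriv f x| ≤ D) → |pair f ξ₁ - pair f ξ₂| ≤ (1 + D) * η := by
    intro f D hf hf1 hD0 hD
    have := abs_pair_sub_le_tails h1 h2 hi1 hi2 hf
      (fun x => by rw [abs_of_nonneg (hf1 x).1]; exact (hf1 x).2) hD
    nlinarith [mul_le_mul_of_nonneg_left ht hD0]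
  refine add_le_add ?_ (ciSup_le fun k => ?_)
  · refine (summable_dmet _).tsum_le_tsum (fun k => ?_) (summable_dmet _)
    refine mul_le_mul_of_nonneg_left (min_le_min_right _ ?_) (by positivity)
    exact (key (hg k).2.1 (hg k).1 (hC0 k) (hC k)).trans (le_abs_self _)
  · refine (key (hh k).2.1 (hh k).1 zero_le_two (hh k).2.2.2.2).trans (le_of_eq (by ring))

end PSQ

namespace PSQ

theorem dmet_self (g h : ℕ → ℝ → ℝ) (ξ : Measure ℝ) : dmet g h ξ ξ = 0 := by
  simp [dmet]

/-- State space collapse on `[L - 1, L]`, uniformly over all limits of good paths. -/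
theorem Setting.exists_dmet_Delta_le (S : Setting) (hi : Integrable (fun x => x) S.nuE) {ε : ℝ}
    (hε : 0 < ε) : ∃ L, 1 < L ∧ ∀ ζ, S.memBL L ζ → ∀ t ∈ Icc (L - 1) L,
      dmet S.gmet S.hmet (ζ t) (Delta S.nuE (pair id (ζ t))) ≤ ε := by
  have := S.isProbabilityMeasure_nuE
  have K := S.renewalKernel
  have hM := S.hM
  have hα := S.hα
  have hkb := S.integrableOn_tailInt hi
  have hχ := S.integral_nuE_pos hi
  rw [← S.integral_tailInt hi] at hχ
  set χ := ∫ x in Ioi 0, tailInt S.kernel x with hχdef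
  obtain ⟨δ, hδ, hkδ⟩ := S.kernel_pos
  obtain ⟨η, hη, hclose⟩ := S.hmetfam.exists_dmet_le hε
  have hB : 0 < S.α * (S.M + S.M / χ) := by positivity
  obtain ⟨h, hh, hh1, hhB⟩ : ∃ h, 0 < h ∧ h ≤ 1 ∧ h * (S.α * (S.M + S.M / χ)) ≤ η / 2 :=
    ⟨min 1 (η / 2 / (S.α * (S.M + S.M / χ))), by positivity, min_le_left _ _,
      (mul_le_mul_of_nonneg_right (min_le_right _ _) hB.le).trans (div_mul_cancel₀ _ hB.ne').le⟩
  have hε₁ : 0 < min η (η / 2 * h) := by positivity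
  have hτ : Tendsto (fun b : ℝ => S.M * b ^ (-S.p)) atTop (nhds 0) := by
    simpa using (tendsto_rpow_neg_atTop S.hp).const_mul S.M
  obtain ⟨A₀, hA₀, hrelax⟩ :=
    K.exists_relaxation_time hδ hkδ hkb hτ (by linarith : 0 ≤ S.M) hε₁
  have hL : 1 < S.M * (A₀ + 2) + 2 := by nlinarith
  refine ⟨S.M * (A₀ + 2) + 2, hL, fun ζ hζ t ht => ?_⟩
  set L := S.M * (A₀ + 2) + 2 with hLdef
  have hL0 : 0 ≤ L := by linarith
  have htL : t ∈ Icc 0 L := ⟨by linarith [ht.1], ht.2⟩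
  have h0L : (0 : ℝ) ∈ Icc 0 L := ⟨le_rfl, hL0⟩
  obtain ⟨N, ζs, σ, e, Ar, P⟩ := hζ.exists_limitPath hL0
  have := P.fin t htL
  rw [P.pair_id_eq htL, Delta, ← S.integral_tailInt hi, ← hχdef]
  have hw0 : 0 ≤ pair id (ζ 0) := integral_nonneg_of_ae (ae_nonneg_of_Iio (P.supp 0 h0L))
  rcases hw0.eq_or_lt with hw | hw
  · rw [P.eq_zero_of_pair_id hw.symm ⟨by linarith [ht.1], ht.2⟩, ← hw, zero_div,
      ENNReal.ofReal_zero, zero_smul, dmet_self]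
    exact hε.le
  obtain ⟨τ, Z, H, D, hHM, hHb, hP⟩ := P.exists_renewalData hL0 hw hkb hχ
  rw [← hχdef] at D
  obtain ⟨hτt, hτtL, hmass, htail⟩ := hP t htL
  set c := pair id (ζ 0) / χ with hc
  have hc0 : 0 ≤ c := by positivity
  have hcM : c ≤ S.M / χ := div_le_div_of_nonneg_right (P.pair_id_le h0L) hχ.le
  have hA : A₀ + 2 ≤ τ t := by
    refine le_trans ?_ hτt
    rw [le_div_iff₀ (by linarith)]
    linarith [ht.1]
  have hrel := hrelax Z H c (τ L) D hHM hHb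
  have hZ := K.abs_sub_le_of_relaxed D hc0 hA₀ hε₁.le hh (by linarith) hrel (τ t)
    ⟨by linarith, hτtL⟩
  have hsmul : ∀ s, (ENNReal.ofReal c • S.nuE).real s = c * S.nuE.real s := fun s => by
    simp [measureReal_def, ENNReal.toReal_mul, ENNReal.toReal_ofReal hc0]
  have hfin : IsFiniteMeasure (ENNReal.ofReal c • S.nuE) := S.nuE.smul_finite ENNReal.ofReal_ne_top
  refine hclose _ _ ‹_› hfin (P.supp t htL) (by simp [S.nuE_Iio])
    ((P.momentBound htL).integrable_id S.hp) (hi.smul_measure ENNReal.ofReal_ne_top) ?_ ?_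
  · have hm : mass (ENNReal.ofReal c • S.nuE) = c := by
      refine (hsmul univ).trans ?_
      rw [probReal_univ, mul_one]
    rw [hm, hmass]
    refine hZ.trans ?_
    have h1 : min η (η / 2 * h) / h ≤ η / 2 := by
      rw [div_le_iff₀ hh]
      exact min_le_right _ _
    have h2 : S.α * h * (S.M + c) ≤ h * (S.α * (S.M + S.M / χ)) := by
      rw [mul_comm S.α h, mul_assoc]
      gcongr
    linarith
  · have hmeas : Measurable fun x : ℝ =>
        (ζ t).real (Ioi x) - (ENNReal.ofReal c • S.nuE).real (Ioi x) :=
      (antitone_real_Ioi _).measurable.sub (antitone_real_Ioi _).measurable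
    simp only [← Real.norm_eq_abs]
    rw [integral_norm_eq_lintegral_enorm hmeas.aestronglyMeasurable]
    refine ENNReal.toReal_le_of_le_ofReal hη.le ?_
    have h2 := hrel (τ t) ⟨by linarith, hτtL⟩
    refine le_trans (le_of_eq (setLIntegral_congr_fun measurableSet_Ioi fun x hx => ?_))
      (h2.trans (ENNReal.ofReal_le_ofReal (min_le_left _ _)))
    rw [htail x (le_of_lt hx), hsmul, S.nuE_real_Ioi (le_of_lt hx)]

end PSQ

open PSQ MeasureTheory in
/-- Proposition 4.5: for L* large, elements of B_{L*} are close to the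
lifted workload (i.e. nearly in steady state) on [L*-1, L*]. -/
theorem stmt_14 (S : PSQ.Setting) (θ : ℝ) (hθ : 0 < θ)
    (hmom : ∫⁻ x, ENNReal.ofReal (x ^ ((4:ℝ)+θ)) ∂S.ν < ⊤) :
    ∀ ε : ℝ, 0 < ε → ∃ Lstar : ℝ, 1 < Lstar ∧
      ∀ ζ : ℝ → Measure ℝ, S.memBL Lstar ζ →
        ∀ t ∈ Set.Icc (Lstar - 1) Lstar,
          dmet S.gmet S.hmet (ζ t) (Delta S.nuE (pair id (ζ t))) ≤ ε := by
  intro ε hε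
  exact S.exists_dmet_Delta_le (S.integrable_id_nuE (by linarith) hmom) hε
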